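/- Let K be the dodecahedron, i.e. the regular polyhedron {5, 3}, and let D2K be the dual of the generalised cube 2^{K*}; D2K is a non-degenerate regular polytope of rank 4 of type {5, 3, 4}. Then the halving group H(D2K) has order 2^{11} · 120 = 245760, and it is the type-preserving automorphism group of the regular rank-4 hypertope Γ(H(D2K)) of type {5, ₃³} (a locally spherical hypertope of hyperbolic type). -/

import Mathlib

set_option autoImplicit false

noncomputable section

/-! ### C-groups -/

/-- A family of involutions satisfying the intersection condition
(the family is a *C-group* for the group it generates). -/
def IsCGroup {G : Type*} [Group G] {I : Type*} (ρ : I → G) : Prop :=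
  (∀ i, orderOf (ρ i) = 2) ∧
    ∀ J K : Set I,
      Subgroup.closure (ρ '' J) ⊓ Subgroup.closure (ρ '' K) =
        Subgroup.closure (ρ '' (J ∩ K))

/-! ### Incidence systems -/

/-- The data of an incidence system over a type set `I`. -/
structure IncidenceSystem (I : Type*) where
  X : Type*
  t : X → I
  inc : X → X → Prop

namespace IncidenceSystem

variable {I : Type*} (Γ : IncidenceSystem I)

/-- The axioms of an incidence system: incidence is reflexive, symmetric and
two incident elements of the same type are equal. -/
def IsSystem : Prop :=
  (∀ x, Γ.inc x x) ∧ (∀ x y, Γ.inc x y → Γ.inc y x) ∧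
    ∀ x y, Γ.inc x y → Γ.t x = Γ.t y → x = y

/-- A flag: a set of pairwise incident elements. -/
def IsFlag (F : Set Γ.X) : Prop := ∀ x ∈ F, ∀ y ∈ F, Γ.inc x y

/-- A chamber: a flag whose type set is all of `I`. -/
def IsChamber (C : Set Γ.X) : Prop := Γ.IsFlag C ∧ Γ.t '' C = Set.univ

/-- An incidence geometry: every flag is contained in a chamber. -/
def IsGeometry : Prop :=
  Γ.IsSystem ∧ ∀ F : Set Γ.X, Γ.IsFlag F → ∃ C : Set Γ.X, Γ.IsChamber C ∧ F ⊆ C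

/-- The set of elements of the residue of the flag `F`. -/
def residueSet (F : Set Γ.X) : Set Γ.X := {x | x ∉ F ∧ ∀ y ∈ F, Γ.inc x y}

/-- Thin: every residue of rank one has exactly two elements. -/
def IsThin : Prop :=
  ∀ F : Set Γ.X, Γ.IsFlag F → (Set.univ \ Γ.t '' F).ncard = 1 →
    (Γ.residueSet F).ncard = 2

/-- Connectivity of the incidence graph restricted to a set `S`. -/
def ConnOn (S : Set Γ.X) : Prop :=
  ∀ x ∈ S, ∀ y ∈ S,
    Relation.ReflTransGen (fun a b => a ∈ S ∧ b ∈ S ∧ Γ.inc a b) x y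

/-- Connectivity of the incidence graph. -/
def IsConnected : Prop := Γ.ConnOn Set.univ

/-- Residual connectedness: connected and every residue of rank at least two
is connected. -/
def IsResiduallyConnected : Prop :=
  Γ.IsConnected ∧
    ∀ F : Set Γ.X, Γ.IsFlag F → 2 ≤ (Set.univ \ Γ.t '' F).ncard →
      Γ.ConnOn (Γ.residueSet F)

/-- A hypertope: a thin residually connected incidence geometry. -/
def IsHypertope : Prop := Γ.IsGeometry ∧ Γ.IsThin ∧ Γ.IsResiduallyConnected

/-- The group of type-preserving automorphisms. -/
def typeAut : Subgroup (Equiv.Perm Γ.X) where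
  carrier := {α | (∀ x, Γ.t (α x) = Γ.t x) ∧
    ∀ x y, Γ.inc (α x) (α y) ↔ Γ.inc x y}
  one_mem' := ⟨fun _ => rfl, fun _ _ => Iff.rfl⟩
  mul_mem' := by
    rintro a b ⟨ha1, ha2⟩ ⟨hb1, hb2⟩
    refine ⟨fun x => ?_, fun x y => ?_⟩
    · simp only [Equiv.Perm.mul_apply]; rw [ha1, hb1]
    · simp only [Equiv.Perm.mul_apply]; rw [ha2, hb2]
  inv_mem' := by
    rintro a ⟨ha1, ha2⟩
    refine ⟨fun x => ?_, fun x y => ?_⟩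
    · simpa using (ha1 (a⁻¹ x)).symm
    · simpa using (ha2 (a⁻¹ x) (a⁻¹ y)).symm

/-- Transitivity of the type-preserving automorphism group on chambers. -/
def ChamberTransitive : Prop :=
  ∀ C D : Set Γ.X, Γ.IsChamber C → Γ.IsChamber D →
    ∃ α ∈ Γ.typeAut, ⇑α '' C = D

/-- A regular hypertope: a chamber-transitive hypertope. -/
def IsRegularHypertope : Prop := Γ.IsHypertope ∧ Γ.ChamberTransitive

/-- Flag-transitivity: for each type set, the type-preserving automorphism group
is transitive on flags of that type. -/
def FlagTransitive : Prop :=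
  ∀ F G : Set Γ.X, Γ.IsFlag F → Γ.IsFlag G → Γ.t '' F = Γ.t '' G →
    ∃ α ∈ Γ.typeAut, ⇑α '' F = G

/-- `C'` is the chamber `i`-adjacent to the chamber `C`:  it is a chamber
differing from `C` exactly in its element of type `i`. -/
def IAdjacentChamber (C C' : Set Γ.X) (i : I) : Prop :=
  Γ.IsChamber C' ∧ C' ≠ C ∧ ∀ x ∈ C, Γ.t x ≠ i → x ∈ C'

/-- The stabiliser of a flag in the type-preserving automorphism group. -/
def flagStab (F : Set Γ.X) : Subgroup ↥Γ.typeAut where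
  carrier := {α | ∀ x ∈ F, (↑α : Equiv.Perm Γ.X) x = x}
  one_mem' := by intro x hx; simp
  mul_mem' := by
    intro a b ha hb x hx
    simp only [Subgroup.coe_mul, Equiv.Perm.mul_apply]
    rw [hb x hx, ha x hx]
  inv_mem' := by
    intro a ha x hx
    have h2 := congrArg (⇑(↑a : Equiv.Perm Γ.X)⁻¹) (ha x hx)
    simpa using h2.symm

end IncidenceSystem
/-! ### Coset incidence systems -/

/-- The right coset `H g`. -/
def rCoset {G : Type*} [Group G] (H : Subgroup G) (g : G) : Set G :=
  {x | x * g⁻¹ ∈ H}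

/-- The elements of the coset incidence system: right cosets of the `Gi`,
marked by their type. -/
abbrev cosetX {G : Type*} [Group G] {I : Type*} (Gi : I → Subgroup G) : Type _ :=
  Σ i : I, {s : Set G // ∃ g : G, s = rCoset (Gi i) g}

/-- The coset incidence system `Γ(G; (G_i)_{i ∈ I})`: the `i`-elements are the
right cosets of `G_i`, and two cosets are incident iff they meet. -/
def cosetSystem {G : Type*} [Group G] {I : Type*} (Gi : I → Subgroup G) :
    IncidenceSystem I where
  X := cosetX Gi
  t := fun x => x.1
  inc := fun x y => (x.2.1 ∩ y.2.1).Nonempty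

/-- Right multiplication by `g` on the cosets. -/
def cosetMul {G : Type*} [Group G] {I : Type*} (Gi : I → Subgroup G) (g : G) :
    cosetX Gi → cosetX Gi :=
  fun x => ⟨x.1, ⟨(· * g) '' x.2.1, by
    obtain ⟨s, g₀, hg₀⟩ := x.2
    refine ⟨g₀ * g, ?_⟩
    subst hg₀
    ext y
    simp only [Set.mem_image, rCoset, Set.mem_setOf_eq, mul_inv_rev]
    constructor
    · rintro ⟨z, hz, rfl⟩
      simpa [mul_assoc] using hz
    · intro hy
      exact ⟨y * g⁻¹, by simpa [mul_assoc] using hy, by simp⟩⟩⟩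
/-! ### Abstract polytopes -/

/-- A flag of a partially ordered set: a maximal chain. -/
def IsMaxFlag (P : Type*) [PartialOrder P] (F : Set P) : Prop :=
  IsMaxChain (· ≤ ·) F

/-- Strong flag-connectivity: any two flags `F`, `G` are joined by a sequence of
flags, each containing `F ∩ G`, in which consecutive flags differ in exactly
one face. -/
def StronglyFlagConnected (P : Type*) [PartialOrder P] : Prop :=
  ∀ F G : Set P, IsMaxFlag P F → IsMaxFlag P G →
    Relation.ReflTransGen
      (fun A B => IsMaxFlag P A ∧ IsMaxFlag P B ∧ F ∩ G ⊆ A ∧ F ∩ G ⊆ B ∧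
        (A \ B).ncard = 1 ∧ (B \ A).ncard = 1) F G

/-- An abstract polytope of rank `n`: a bounded poset, graded by the rank
function `rk` ranging from `-1` (the least face) to `n` (the greatest face),
each flag containing exactly one face of each rank (hence `n + 2` faces),
satisfying the diamond condition and strong flag-connectivity. -/
def IsPolytope (P : Type*) [PartialOrder P] (rk : P → ℤ) (n : ℕ) : Prop :=
  (∃ b : P, IsBot b ∧ rk b = -1) ∧
  (∃ tp : P, IsTop tp ∧ rk tp = n) ∧
  StrictMono rk ∧
  (∀ F : Set P, IsMaxFlag P F → ∀ k : ℤ, -1 ≤ k → k ≤ (n : ℤ) → ∃ x ∈ F, rk x = k) ∧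
  (∀ x z : P, x < z → rk z = rk x + 2 → {y : P | x < y ∧ y < z}.ncard = 2) ∧
  StronglyFlagConnected P

/-- Non-degenerate: every section of rank 2 is a `p`-gon with `p ≥ 3`,
i.e. has at least three faces of each intermediate rank. -/
def NonDegenerate (P : Type*) [PartialOrder P] (rk : P → ℤ) : Prop :=
  ∀ F G : P, F < G → rk G = rk F + 3 →
    ∃ H₁ H₂ H₃ : P,
      (F < H₁ ∧ H₁ < G ∧ rk H₁ = rk F + 1) ∧
      (F < H₂ ∧ H₂ < G ∧ rk H₂ = rk F + 1) ∧
      (F < H₃ ∧ H₃ < G ∧ rk H₃ = rk F + 1) ∧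
      H₁ ≠ H₂ ∧ H₁ ≠ H₃ ∧ H₂ ≠ H₃

/-- The group of order automorphisms of a poset (the automorphism group of an
abstract polytope). -/
def orderAut (P : Type*) [PartialOrder P] : Subgroup (Equiv.Perm P) where
  carrier := {α | ∀ x y : P, α x ≤ α y ↔ x ≤ y}
  one_mem' := fun _ _ => Iff.rfl
  mul_mem' := by
    intro a b ha hb x y
    simp only [Equiv.Perm.mul_apply]
    rw [ha, hb]
  inv_mem' := by
    intro a ha x y
    simpa using (ha (a⁻¹ x) (a⁻¹ y)).symm

/-- A regular polytope: the automorphism group is transitive on flags. -/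
def IsRegularPolytope (P : Type*) [PartialOrder P] : Prop :=
  ∀ F G : Set P, IsMaxFlag P F → IsMaxFlag P G →
    ∃ α ∈ orderAut P, ⇑α '' F = G

/-- `Φ` is a base flag and `ϱ` the corresponding family of distinguished
generators: `ϱ i` maps `Φ` to the flag `Φ^i` differing from `Φ` exactly in
its face of rank `i`. -/
def IsDistinguishedGens (P : Type*) [PartialOrder P] (rk : P → ℤ) (n : ℕ)
    (Φ : Set P) (ϱ : Fin n → ↥(orderAut P)) : Prop :=
  IsMaxFlag P Φ ∧
    ∀ i : Fin n,
      ⇑(ϱ i).1 '' Φ ≠ Φ ∧ ∀ x ∈ Φ, rk x ≠ (i : ℤ) → x ∈ ⇑(ϱ i).1 '' Φ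

/-- The incidence system associated with an abstract polytope: the elements are
the proper faces (the faces of ranks `0, …, n-1`), the type of a face is its
rank and incidence is comparability. -/
def polytopeSystem (P : Type*) [PartialOrder P] (rk : P → ℤ) (n : ℕ) :
    IncidenceSystem (Fin n) where
  X := {x : P // 0 ≤ rk x ∧ rk x < (n : ℤ)}
  t := fun x => ⟨(rk x.1).toNat, by
    have h1 := x.2.1; have h2 := x.2.2; omega⟩
  inc := fun x y => x.1 ≤ y.1 ∨ y.1 ≤ x.1

/-! ### The halving operation -/

/-- The halving generators: `ρ i = ϱ i` for `i ≤ n - 2` and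
`ρ (n-1) = ϱ (n-1) * ϱ (n-2) * ϱ (n-1)`. -/
def halvingGens {G : Type*} [Group G] (n : ℕ) (ϱ : Fin n → G) : Fin n → G :=
  fun i =>
    if (i : ℕ) = n - 1 then
      ϱ i * ϱ (⟨n - 2, by have := i.isLt; omega⟩ : Fin n) * ϱ i
    else ϱ i

/-- The lift of a generating family into the subgroup it generates. -/
def liftGens {G : Type*} [Group G] {I : Type*} (ρ : I → G) :
    I → ↥(Subgroup.closure (Set.range ρ)) :=
  fun i => ⟨ρ i, Subgroup.subset_closure (Set.mem_range_self i)⟩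

/-- The subgroups `H_i = ⟨ρ_j : j ≠ i⟩` of the halving group `H(P)`,
where `ρ` is the family of halving generators obtained from `ϱ`. -/
def halvingCosetFamily {G : Type*} [Group G] (n : ℕ) (ϱ : Fin n → G) :
    Fin n → Subgroup ↥(Subgroup.closure (Set.range (halvingGens n ϱ))) :=
  fun i => Subgroup.closure (liftGens (halvingGens n ϱ) '' {j | j ≠ i})

/-- The coset incidence system `Γ(H(P); (H_i))` of the halving group. -/
def halvingCosetSystem {G : Type*} [Group G] (n : ℕ) (ϱ : Fin n → G) :
    IncidenceSystem (Fin n) :=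
  cosetSystem (halvingCosetFamily n ϱ)
/-! ### Generalised cubes -/

/-- The vertex set of a polytope: the faces of rank `0`. -/
abbrev polyVertices (K : Type*) (rk : K → ℤ) : Type _ := {v : K // rk v = 0}

/-- The face `F(x)` of the generalised cube `2^K`:
`F(x) = {y : y_v = x_v whenever the vertex v is not incident to F}`. -/
def cubeFace (K : Type*) [PartialOrder K] (rk : K → ℤ) (F : K)
    (x : polyVertices K rk → Bool) : Set (polyVertices K rk → Bool) :=
  {y | ∀ v : polyVertices K rk, ¬ v.1 ≤ F → y v = x v}

/-- Danzer's generalised cube `2^K`: the improper least face `∅` together with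
the sets `F(x)` for `F` a face of `K` (for `F` the least face of `K` this
gives the singletons `{x}`, the vertices of `2^K`; the faces of rank `i ≥ 1`
are the `F(x)` with `rk F = i - 1 ≥ 0`), ordered by inclusion. -/
abbrev genCube (K : Type*) [PartialOrder K] (rk : K → ℤ) : Type _ :=
  {S : Set (polyVertices K rk → Bool) //
    S = ∅ ∨ ∃ (F : K) (x : polyVertices K rk → Bool), S = cubeFace K rk F x}

/-- The rank function of the dual of a polytope of rank `n`. -/
def dualRk {P : Type*} (rk : P → ℤ) (n : ℕ) : Pᵒᵈ → ℤ :=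
  fun x => (n : ℤ) - 1 - rk (OrderDual.ofDual x)

/-- `D2 K rk n`, for `K` a polytope of rank `n`, is the polytope
`D2K = (2^{K*})*`, the dual of the generalised cube over the dual of `K`. -/
abbrev D2 (K : Type*) [PartialOrder K] (rkK : K → ℤ) (n : ℕ) : Type _ :=
  (genCube Kᵒᵈ (dualRk rkK n))ᵒᵈ

/-! ### Flags of posets -/

theorem isMaxFlag_iff {P : Type*} [PartialOrder P] {F : Set P} :
    IsMaxFlag P F ↔ ∀ x, x ∈ F ↔ ∀ y ∈ F, x ≤ y ∨ y ≤ x := by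
  constructor
  · intro h x
    constructor
    · intro hx y hy
      rcases eq_or_ne x y with rfl | hne
      · exact Or.inl le_rfl
      · exact h.1 hx hy hne
    · intro hx
      have h1 : IsChain (· ≤ ·) (insert x F) := h.1.insert fun y hy _ => hx y hy
      rw [h.2 h1 (Set.subset_insert _ _)]
      exact Set.mem_insert _ _
  · intro h
    refine ⟨fun x hx y hy _ => (h x).1 hx y hy, fun t ht hst => ?_⟩
    refine hst.antisymm fun x hx => (h x).2 fun y hy => ?_
    rcases eq_or_ne x y with rfl | hne
    · exact Or.inl le_rfl
    · exact ht hx (hst hy) hne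

theorem IsMaxFlag.dual {P : Type*} [PartialOrder P] {F : Set P} (h : IsMaxFlag P F) :
    IsMaxFlag Pᵒᵈ F :=
  IsMaxChain.symm h

/-- The type of flags of a poset. -/
abbrev PolyFlag (P : Type*) [PartialOrder P] : Type _ := {F : Set P // IsMaxFlag P F}

theorem PolyFlag.le_or_le {P : Type*} [PartialOrder P] (Φ : PolyFlag P) {x y : P}
    (hx : x ∈ Φ.1) (hy : y ∈ Φ.1) : x ≤ y ∨ y ≤ x :=
  (isMaxFlag_iff.1 Φ.2 x).1 hx y hy

theorem PolyFlag.eq_of_subset {P : Type*} [PartialOrder P] {Φ Ψ : PolyFlag P}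
    (h : Φ.1 ⊆ Ψ.1) : Φ = Ψ :=
  Subtype.ext (Φ.2.2 Ψ.2.1 h)

theorem exists_polyFlag {P : Type*} [PartialOrder P] (c : Set P)
    (hc : ∀ x ∈ c, ∀ y ∈ c, x ≤ y ∨ y ≤ x) : ∃ Φ : PolyFlag P, c ⊆ Φ.1 := by
  have h : IsChain (· ≤ ·) c := fun x hx y hy _ => hc x hx y hy
  obtain ⟨M, hM, hcM⟩ := h.exists_maxChain
  exact ⟨⟨M, hM⟩, hcM⟩

/-- The action of automorphisms on flags. -/
def flagMap {P : Type*} [PartialOrder P] (g : ↥(orderAut P)) (Φ : PolyFlag P) : PolyFlag P :=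
  ⟨⇑g.1 '' Φ.1, by
    rw [isMaxFlag_iff]
    intro x
    have := (isMaxFlag_iff.1 Φ.2) (g.1⁻¹ x)
    have hg := g.2
    constructor
    · rintro ⟨a, ha, rfl⟩ _ ⟨b, hb, rfl⟩
      rw [hg, hg]
      exact Φ.le_or_le ha hb
    · intro h
      refine ⟨g.1⁻¹ x, this.2 fun y hy => ?_, by simp⟩
      have h2 := h (g.1 y) ⟨y, hy, rfl⟩
      rw [← hg (g.1⁻¹ x) y, ← hg y]
      simpa using h2⟩

theorem flagMap_mul {P : Type*} [PartialOrder P] (g h : ↥(orderAut P)) (Φ : PolyFlag P) :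
    flagMap (g * h) Φ = flagMap g (flagMap h Φ) := by
  apply Subtype.ext
  simp only [flagMap, Set.image_image]
  rfl

theorem flagMap_one {P : Type*} [PartialOrder P] (Φ : PolyFlag P) : flagMap 1 Φ = Φ := by
  apply Subtype.ext
  simp [flagMap]

/-! ### Basic theory of abstract polytopes -/

namespace IsPolytope

variable {P : Type*} [PartialOrder P] {rk : P → ℤ} {n : ℕ}

theorem strictMono (h : IsPolytope P rk n) : StrictMono rk := h.2.2.1

theorem exists_mem_rk (h : IsPolytope P rk n) (Φ : PolyFlag P) {k : ℤ} (h1 : -1 ≤ k)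
    (h2 : k ≤ n) : ∃ x ∈ Φ.1, rk x = k :=
  h.2.2.2.1 Φ.1 Φ.2 k h1 h2

theorem isBot_iff (h : IsPolytope P rk n) {x : P} : IsBot x ↔ rk x = -1 := by
  obtain ⟨b, hb, hr⟩ := h.1
  constructor
  · intro hx
    rw [le_antisymm (hx b) (hb x), hr]
  · intro hx
    rcases (hb x).eq_or_lt with rfl | hlt
    · exact hb
    · have := h.strictMono hlt
      omega

theorem isTop_iff (h : IsPolytope P rk n) {x : P} : IsTop x ↔ rk x = n := by
  obtain ⟨b, hb, hr⟩ := h.2.1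
  constructor
  · intro hx
    rw [le_antisymm (hb x) (hx b), hr]
  · intro hx
    rcases (hb x).eq_or_lt with rfl | hlt
    · exact hb
    · have := h.strictMono hlt
      omega

theorem neg_one_le_rk (h : IsPolytope P rk n) (x : P) : -1 ≤ rk x := by
  obtain ⟨b, hb, hr⟩ := h.1
  rw [← hr]
  exact h.strictMono.monotone (hb x)

theorem rk_le (h : IsPolytope P rk n) (x : P) : rk x ≤ n := by
  obtain ⟨b, hb, hr⟩ := h.2.1
  rw [← hr]
  exact h.strictMono.monotone (hb x)

theorem eq_of_rk_eq (h : IsPolytope P rk n) {x y : P} (hxy : x ≤ y ∨ y ≤ x)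
    (hr : rk x = rk y) : x = y := by
  rcases hxy with hxy | hxy <;> rcases hxy.eq_or_lt with e | hlt
  · exact e
  · have := h.strictMono hlt
    omega
  · exact e.symm
  · have := h.strictMono hlt
    omega

theorem lt_of_rk_lt (h : IsPolytope P rk n) {x y : P} (hxy : x ≤ y ∨ y ≤ x)
    (hr : rk x < rk y) : x < y := by
  rcases hxy with hxy | hxy
  · rcases hxy.eq_or_lt with rfl | hlt
    · omega
    · exact hlt
  · have := h.strictMono.monotone hxy
    omega

theorem isMaxFlag_of_rk (h : IsPolytope P rk n) {F : Set P}
    (hc : ∀ x ∈ F, ∀ y ∈ F, x ≤ y ∨ y ≤ x)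
    (hF : ∀ k : ℤ, -1 ≤ k → k ≤ n → ∃ x ∈ F, rk x = k) : IsMaxFlag P F := by
  rw [isMaxFlag_iff]
  refine fun x => ⟨fun hx y hy => hc x hx y hy, fun hx => ?_⟩
  obtain ⟨y, hy, hr⟩ := hF (rk x) (h.neg_one_le_rk x) (h.rk_le x)
  rwa [h.eq_of_rk_eq (hx y hy) hr.symm]

theorem rk_le_of_strictMono (h : IsPolytope P rk n) {rk' : P → ℤ} (h' : StrictMono rk')
    (hb : ∀ x, -1 ≤ rk' x) (x : P) : rk x ≤ rk' x := by
  have key : ∀ (m : ℕ) (x : P), rk x = m - 1 → rk x ≤ rk' x := by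
    intro m
    induction m with
    | zero =>
      intro x hx
      have := hb x
      omega
    | succ m ih =>
      intro x hx
      obtain ⟨Φ, hΦ⟩ := exists_polyFlag {x} (by simp)
      have h1 := h.rk_le x
      obtain ⟨y, hy, hr⟩ := h.exists_mem_rk Φ (k := m - 1) (by omega) (by push_cast at hx; omega)
      have hlt := h' (h.lt_of_rk_lt (Φ.le_or_le hy (hΦ rfl)) (by push_cast at hx; omega))
      have := ih y hr
      push_cast at hx
      omega
  have := h.neg_one_le_rk x
  exact key (rk x + 1).toNat x (by omega)

theorem rk_unique (h : IsPolytope P rk n) {rk' : P → ℤ} (h' : IsPolytope P rk' n) :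
    rk = rk' := by
  ext x
  exact le_antisymm (h.rk_le_of_strictMono h'.strictMono h'.neg_one_le_rk x)
    (h'.rk_le_of_strictMono h.strictMono h.neg_one_le_rk x)

theorem rk_aut (h : IsPolytope P rk n) (g : ↥(orderAut P)) (x : P) : rk (g.1 x) = rk x := by
  have key : ∀ (g : ↥(orderAut P)) (x : P), rk x ≤ rk (g.1 x) := by
    intro g x
    refine h.rk_le_of_strictMono (rk' := fun x => rk (g.1 x)) (fun a b hab => ?_)
      (fun x => h.neg_one_le_rk _) x
    apply h.strictMono
    rw [lt_iff_le_not_ge] at hab ⊢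
    rwa [g.2, g.2]
  refine le_antisymm ?_ (key g x)
  have := key g⁻¹ (g.1 x)
  simpa using this

/-- The face of rank `i` of a flag. -/
def face (h : IsPolytope P rk n) (Φ : PolyFlag P) (i : Fin n) : P :=
  Classical.choose (h.exists_mem_rk Φ (k := (i : ℕ)) (by omega) (by have := i.2; omega))

theorem face_mem (h : IsPolytope P rk n) (Φ : PolyFlag P) (i : Fin n) : h.face Φ i ∈ Φ.1 :=
  (Classical.choose_spec
    (h.exists_mem_rk Φ (k := (i : ℕ)) (by omega) (by have := i.2; omega))).1

theorem rk_face (h : IsPolytope P rk n) (Φ : PolyFlag P) (i : Fin n) :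
    rk (h.face Φ i) = (i : ℕ) :=
  (Classical.choose_spec
    (h.exists_mem_rk Φ (k := (i : ℕ)) (by omega) (by have := i.2; omega))).2

theorem face_eq (h : IsPolytope P rk n) {Φ : PolyFlag P} {i : Fin n} {x : P} (hx : x ∈ Φ.1)
    (hr : rk x = (i : ℕ)) : h.face Φ i = x :=
  h.eq_of_rk_eq (Φ.le_or_le (h.face_mem Φ i) hx) (by rw [h.rk_face, hr])

theorem face_lt_face (h : IsPolytope P rk n) (Φ : PolyFlag P) {i j : Fin n} (hij : i < j) :
    h.face Φ i < h.face Φ j :=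
  h.lt_of_rk_lt (Φ.le_or_le (h.face_mem Φ i) (h.face_mem Φ j)) (by
    rw [h.rk_face, h.rk_face]
    exact_mod_cast hij)

theorem mem_flag_iff (h : IsPolytope P rk n) (Φ : PolyFlag P) (x : P) :
    x ∈ Φ.1 ↔ rk x = -1 ∨ rk x = n ∨ ∃ i, h.face Φ i = x := by
  constructor
  · intro hx
    by_cases h1 : rk x = -1
    · exact Or.inl h1
    by_cases h2 : rk x = n
    · exact Or.inr (Or.inl h2)
    have h3 := h.neg_one_le_rk x
    have h4 := h.rk_le x
    refine Or.inr (Or.inr ⟨⟨(rk x).toNat, by omega⟩, h.face_eq hx ?_⟩)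
    simp only
    omega
  · rintro (h1 | h1 | ⟨i, rfl⟩)
    · exact (isMaxFlag_iff.1 Φ.2 x).2 fun y _ => Or.inl (h.isBot_iff.2 h1 y)
    · exact (isMaxFlag_iff.1 Φ.2 x).2 fun y _ => Or.inr (h.isTop_iff.2 h1 y)
    · exact h.face_mem Φ i

theorem flag_ext (h : IsPolytope P rk n) {Φ Ψ : PolyFlag P}
    (hf : ∀ i, h.face Φ i = h.face Ψ i) : Φ = Ψ := by
  apply Subtype.ext
  ext x
  rw [h.mem_flag_iff, h.mem_flag_iff]
  simp only [hf]

theorem exists_adj (h : IsPolytope P rk n) (Φ : PolyFlag P) (i : Fin n) :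
    ∃ Ψ : PolyFlag P, Ψ ≠ Φ ∧ ∀ x ∈ Φ.1, rk x ≠ (i : ℕ) → x ∈ Ψ.1 := by
  have hi := i.2
  obtain ⟨a, ha, har⟩ := h.exists_mem_rk Φ (k := (i : ℕ) - 1) (by omega) (by omega)
  obtain ⟨c, hc, hcr⟩ := h.exists_mem_rk Φ (k := (i : ℕ) + 1) (by omega) (by omega)
  have hbr := h.rk_face Φ i
  have hb := h.face_mem Φ i
  have hab := h.lt_of_rk_lt (Φ.le_or_le ha hb) (by omega)
  have hbc := h.lt_of_rk_lt (Φ.le_or_le hb hc) (by omega)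
  have hd := h.2.2.2.2.1 a c (hab.trans hbc) (by omega)
  obtain ⟨b', ⟨hab', hb'c⟩, hne⟩ := Set.exists_ne_of_one_lt_ncard (by rw [hd]; omega)
    (h.face Φ i)
  have hb'r : rk b' = (i : ℕ) := by
    have := h.strictMono hab'
    have := h.strictMono hb'c
    omega
  have hcomp : ∀ x ∈ Φ.1, rk x ≠ (i : ℕ) → x ≤ b' ∨ b' ≤ x := by
    intro x hx hxi
    rcases lt_or_ge (rk x) (i : ℕ) with hlt | hge
    · left
      refine le_trans ?_ hab'.le
      rcases (Φ.le_or_le hx ha) with h1 | h1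
      · exact h1
      · exact (h.eq_of_rk_eq (Or.inr h1)
          (by have := h.strictMono.monotone h1; omega)).le
    · right
      refine hb'c.le.trans ?_
      rcases (Φ.le_or_le hc hx) with h1 | h1
      · exact h1
      · exact (h.eq_of_rk_eq (Or.inr h1)
          (by have := h.strictMono.monotone h1; omega)).le
  refine ⟨⟨insert b' {x | x ∈ Φ.1 ∧ rk x ≠ (i : ℕ)}, h.isMaxFlag_of_rk ?_ ?_⟩, ?_, ?_⟩
  · rintro x (rfl | ⟨hx, hxr⟩) y (rfl | ⟨hy, hyr⟩)
    · exact Or.inl le_rfl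
    · exact (hcomp y hy hyr).symm
    · exact hcomp x hx hxr
    · exact Φ.le_or_le hx hy
  · intro k h1 h2
    by_cases hk : k = (i : ℕ)
    · exact ⟨b', Or.inl rfl, by rw [hb'r, hk]⟩
    · obtain ⟨x, hx, hr⟩ := h.exists_mem_rk Φ h1 h2
      exact ⟨x, Or.inr ⟨hx, by omega⟩, hr⟩
  · intro he
    have : b' ∈ Φ.1 := by
      rw [← he]
      exact Or.inl rfl
    exact hne (h.face_eq this hb'r).symm
  · intro x hx hr
    exact Or.inr ⟨hx, hr⟩

/-- The `i`-adjacent flag. -/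
def adj (h : IsPolytope P rk n) (i : Fin n) (Φ : PolyFlag P) : PolyFlag P :=
  Classical.choose (h.exists_adj Φ i)

theorem adj_ne (h : IsPolytope P rk n) (i : Fin n) (Φ : PolyFlag P) : h.adj i Φ ≠ Φ :=
  (Classical.choose_spec (h.exists_adj Φ i)).1

theorem mem_adj (h : IsPolytope P rk n) {i : Fin n} {Φ : PolyFlag P} {x : P} (hx : x ∈ Φ.1)
    (hr : rk x ≠ (i : ℕ)) : x ∈ (h.adj i Φ).1 :=
  (Classical.choose_spec (h.exists_adj Φ i)).2 x hx hr

theorem face_adj_of_ne (h : IsPolytope P rk n) {i j : Fin n} (hij : j ≠ i) (Φ : PolyFlag P) :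
    h.face (h.adj i Φ) j = h.face Φ j := by
  refine h.face_eq (h.mem_adj (h.face_mem Φ j) ?_) (h.rk_face Φ j)
  rw [h.rk_face]
  exact_mod_cast fun e => hij (Fin.ext e)

theorem face_eq_face (h : IsPolytope P rk n) {Φ Ψ : PolyFlag P} {i : Fin n}
    (hsub : ∀ x ∈ Φ.1, rk x ≠ (i : ℕ) → x ∈ Ψ.1) (hf : h.face Φ i = h.face Ψ i) : Φ = Ψ := by
  apply PolyFlag.eq_of_subset
  intro x hx
  by_cases hr : rk x = (i : ℕ)
  · rw [← h.face_eq hx hr, hf]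
    exact h.face_mem Ψ i
  · exact hsub x hx hr

theorem face_adj_self_ne (h : IsPolytope P rk n) (i : Fin n) (Φ : PolyFlag P) :
    h.face (h.adj i Φ) i ≠ h.face Φ i := by
  intro he
  exact h.adj_ne i Φ (h.face_eq_face (fun x hx hr => h.mem_adj hx hr) he.symm).symm

/-- Three flags sharing their faces of ranks `i - 1` and `i + 1` cannot have three distinct
faces of rank `i`. -/
theorem face_eq_of_ne_of_ne (h : IsPolytope P rk n) {i : Fin n} {Φ Ψ Θ : PolyFlag P}
    (hΨ : ∀ x ∈ Φ.1, (rk x = (i : ℕ) - 1 ∨ rk x = (i : ℕ) + 1) → x ∈ Ψ.1)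
    (hΘ : ∀ x ∈ Φ.1, (rk x = (i : ℕ) - 1 ∨ rk x = (i : ℕ) + 1) → x ∈ Θ.1)
    (h1 : h.face Ψ i ≠ h.face Φ i) (h2 : h.face Θ i ≠ h.face Φ i) :
    h.face Ψ i = h.face Θ i := by
  have hi := i.2
  obtain ⟨a, ha, har⟩ := h.exists_mem_rk Φ (k := (i : ℕ) - 1) (by omega) (by omega)
  obtain ⟨c, hc, hcr⟩ := h.exists_mem_rk Φ (k := (i : ℕ) + 1) (by omega) (by omega)
  have mem : ∀ Ω : PolyFlag P, a ∈ Ω.1 → c ∈ Ω.1 → a < h.face Ω i ∧ h.face Ω i < c := by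
    intro Ω h1 h2
    have := h.rk_face Ω i
    exact ⟨h.lt_of_rk_lt (Ω.le_or_le h1 (h.face_mem _ _)) (by omega),
      h.lt_of_rk_lt (Ω.le_or_le (h.face_mem _ _) h2) (by omega)⟩
  have hd := h.2.2.2.2.1 a c ((mem Φ ha hc).1.trans (mem Φ ha hc).2) (by omega)
  obtain ⟨p, q, -, hpq⟩ := Set.ncard_eq_two.1 hd
  have k1 : h.face Φ i ∈ ({p, q} : Set P) := hpq ▸ mem Φ ha hc
  have k2 : h.face Ψ i ∈ ({p, q} : Set P) :=
    hpq ▸ mem Ψ (hΨ a ha (Or.inl har)) (hΨ c hc (Or.inr hcr))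
  have k3 : h.face Θ i ∈ ({p, q} : Set P) :=
    hpq ▸ mem Θ (hΘ a ha (Or.inl har)) (hΘ c hc (Or.inr hcr))
  simp only [Set.mem_insert_iff, Set.mem_singleton_iff] at k1 k2 k3
  grind

theorem eq_adj (h : IsPolytope P rk n) {i : Fin n} {Φ Ψ : PolyFlag P} (hne : Ψ ≠ Φ)
    (hsub : ∀ x ∈ Φ.1, rk x ≠ (i : ℕ) → x ∈ Ψ.1) : Ψ = h.adj i Φ := by
  refine h.face_eq_face (i := i) (fun x hx hr => ?_) ?_
  · rw [h.mem_flag_iff] at hx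
    rcases hx with hx | hx | ⟨j, rfl⟩
    · exact (h.mem_flag_iff _ _).2 (Or.inl hx)
    · exact (h.mem_flag_iff _ _).2 (Or.inr (Or.inl hx))
    · have hj : j ≠ i := by
        rintro rfl
        exact hr (h.rk_face _ _)
      have : h.face Ψ j = h.face Φ j :=
        h.face_eq (hsub _ (h.face_mem _ _) (by
          rw [h.rk_face]
          exact_mod_cast fun e => hj (Fin.ext e))) (h.rk_face _ _)
      rw [this]
      exact h.mem_adj (h.face_mem _ _) (by
          rw [h.rk_face]
          exact_mod_cast fun e => hj (Fin.ext e))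
  · refine h.face_eq_of_ne_of_ne (Φ := Φ) (fun x hx hr => hsub x hx (by omega))
      (fun x hx hr => h.mem_adj hx (by omega)) (fun he => hne ?_) (h.face_adj_self_ne i Φ)
    exact (h.face_eq_face hsub he.symm).symm

theorem adj_adj (h : IsPolytope P rk n) (i : Fin n) (Φ : PolyFlag P) :
    h.adj i (h.adj i Φ) = Φ := by
  symm
  refine h.eq_adj (h.adj_ne i Φ).symm fun x hx hr => ?_
  rw [h.mem_flag_iff] at hx ⊢
  rcases hx with hx | hx | ⟨j, rfl⟩
  · exact Or.inl hx
  · exact Or.inr (Or.inl hx)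
  · refine Or.inr (Or.inr ⟨j, ?_⟩)
    rw [h.face_adj_of_ne]
    rintro rfl
    exact hr (h.rk_face _ _)

theorem face_adj_congr (h : IsPolytope P rk n) {i : Fin n} {Φ Ψ : PolyFlag P}
    (hf : h.face Φ i = h.face Ψ i)
    (hs : ∀ x ∈ Φ.1, (rk x = (i : ℕ) - 1 ∨ rk x = (i : ℕ) + 1) → x ∈ Ψ.1) :
    h.face (h.adj i Φ) i = h.face (h.adj i Ψ) i := by
  refine h.face_eq_of_ne_of_ne (Φ := Φ) (fun x hx hr => h.mem_adj hx (by omega))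
    (fun x hx hr => h.mem_adj (hs x hx hr) (by omega)) (h.face_adj_self_ne i Φ) ?_
  rw [hf]
  exact h.face_adj_self_ne i Ψ

theorem adj_comm (h : IsPolytope P rk n) {i j : Fin n} (hij : (i : ℕ) + 2 ≤ j)
    (Φ : PolyFlag P) : h.adj i (h.adj j Φ) = h.adj j (h.adj i Φ) := by
  have hne : i ≠ j := fun e => by rw [e] at hij; omega
  apply h.flag_ext
  intro k
  by_cases hki : k = i
  · subst hki
    rw [h.face_adj_of_ne hne (h.adj k Φ)]
    refine h.face_adj_congr (h.face_adj_of_ne hne Φ) fun x hx hr => ?_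
    have := h.mem_adj (i := j) hx (by omega)
    rwa [h.adj_adj] at this
  by_cases hkj : k = j
  · subst hkj
    rw [h.face_adj_of_ne hki (h.adj k Φ)]
    refine h.face_adj_congr (h.face_adj_of_ne hki Φ).symm fun x hx hr => ?_
    exact h.mem_adj hx (by omega)
  rw [h.face_adj_of_ne hki, h.face_adj_of_ne hkj, h.face_adj_of_ne hkj, h.face_adj_of_ne hki]

/-- Strong flag-connectivity in terms of adjacent flags. -/
theorem flag_induction (h : IsPolytope P rk n) {p : PolyFlag P → Prop} {Φ Ψ : PolyFlag P}
    (h0 : p Φ) (hstep : ∀ Θ i, h.face Φ i ≠ h.face Ψ i → p Θ → p (h.adj i Θ)) : p Ψ := by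
  have key : ∀ B : Set P, Relation.ReflTransGen
      (fun A B => IsMaxFlag P A ∧ IsMaxFlag P B ∧ Φ.1 ∩ Ψ.1 ⊆ A ∧ Φ.1 ∩ Ψ.1 ⊆ B ∧
        (A \ B).ncard = 1 ∧ (B \ A).ncard = 1) Φ.1 B → ∀ hB : IsMaxFlag P B, p ⟨B, hB⟩ := by
    intro B hpath
    induction hpath with
    | refl => exact fun _ => h0
    | @tail A B _ hs ih =>
      obtain ⟨hA, hB, hsA, hsB, h1, h2⟩ := hs
      intro hB'
      have hp := ih hA
      obtain ⟨a, ha⟩ := Set.ncard_eq_one.1 h1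
      have haA : a ∈ A \ B := by rw [ha]; rfl
      have haB : ∀ x ∈ A, x ≠ a → x ∈ B := by
        intro x hx hxa
        by_contra hxB
        have : x ∈ A \ B := ⟨hx, hxB⟩
        rw [ha] at this
        exact hxa this
      rcases (h.mem_flag_iff ⟨A, hA⟩ a).1 haA.1 with hr | hr | ⟨i, hi⟩
      · exact absurd ((h.mem_flag_iff ⟨B, hB⟩ a).2 (Or.inl hr)) haA.2
      · exact absurd ((h.mem_flag_iff ⟨B, hB⟩ a).2 (Or.inr (Or.inl hr))) haA.2
      · have hra : rk a = (i : ℕ) := by rw [← hi, h.rk_face]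
        have : (⟨B, hB⟩ : PolyFlag P) = h.adj i ⟨A, hA⟩ := by
          refine h.eq_adj (fun e => ?_) fun x hx hr => haB x hx ?_
          · have e' : B = A := congrArg Subtype.val e
            exact haA.2 (e' ▸ haA.1)
          · rintro rfl
            exact hr hra
        rw [this]
        refine hstep _ _ (fun he => ?_) hp
        have hm : h.face Φ i ∈ Φ.1 ∩ Ψ.1 := ⟨h.face_mem _ _, he ▸ h.face_mem _ _⟩
        have e1 : a = h.face Φ i := by
          rw [← hi]
          exact h.face_eq (hsA hm) (h.rk_face _ _)
        exact haA.2 (e1 ▸ hsB hm)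
  exact key Ψ.1 (h.2.2.2.2.2 Φ.1 Ψ.1 Φ.2 Ψ.2) Ψ.2

theorem face_flagMap (h : IsPolytope P rk n) (g : ↥(orderAut P)) (Φ : PolyFlag P) (i : Fin n) :
    h.face (flagMap g Φ) i = g.1 (h.face Φ i) :=
  h.face_eq ⟨_, h.face_mem Φ i, rfl⟩ (by rw [h.rk_aut, h.rk_face])

theorem adj_flagMap (h : IsPolytope P rk n) (g : ↥(orderAut P)) (Φ : PolyFlag P) (i : Fin n) :
    h.adj i (flagMap g Φ) = flagMap g (h.adj i Φ) := by
  symm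
  apply h.eq_adj
  · intro e
    apply h.adj_ne i Φ
    have := congrArg (flagMap g⁻¹) e
    rwa [← flagMap_mul, ← flagMap_mul, inv_mul_cancel, flagMap_one, flagMap_one] at this
  · rintro _ ⟨x, hx, rfl⟩ hr
    rw [h.rk_aut] at hr
    exact ⟨x, h.mem_adj hx hr, rfl⟩

theorem flagMap_injective (h : IsPolytope P rk n) (Φ : PolyFlag P) :
    Function.Injective fun g : ↥(orderAut P) => flagMap g Φ := by
  intro g g' hg
  have hall : ∀ Ψ : PolyFlag P, flagMap g Ψ = flagMap g' Ψ := by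
    intro Ψ
    refine h.flag_induction (p := fun Ψ => flagMap g Ψ = flagMap g' Ψ) (Φ := Φ) hg ?_
    intro Θ i _ hΘ
    simp only [← h.adj_flagMap, hΘ]
  apply Subtype.ext
  ext x
  obtain ⟨Ψ, hΨ⟩ := exists_polyFlag {x} (by simp)
  have h1 : g.1 x ∈ (flagMap g Ψ).1 := ⟨x, hΨ rfl, rfl⟩
  have h2 : g'.1 x ∈ (flagMap g Ψ).1 := by
    rw [hall]
    exact ⟨x, hΨ rfl, rfl⟩
  exact h.eq_of_rk_eq (PolyFlag.le_or_le _ h1 h2) (by rw [h.rk_aut, h.rk_aut])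

theorem exists_flagMap (hreg : IsRegularPolytope P) (Φ Ψ : PolyFlag P) :
    ∃ g : ↥(orderAut P), flagMap g Φ = Ψ := by
  obtain ⟨α, hα, he⟩ := hreg Φ.1 Ψ.1 Φ.2 Ψ.2
  exact ⟨⟨α, hα⟩, Subtype.ext he⟩

theorem flagMap_gen (h : IsPolytope P rk n) {Φ : PolyFlag P} {ϱ : Fin n → ↥(orderAut P)}
    (hϱ : IsDistinguishedGens P rk n Φ.1 ϱ) (i : Fin n) : flagMap (ϱ i) Φ = h.adj i Φ := by
  apply h.eq_adj
  · intro e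
    exact (hϱ.2 i).1 (congrArg Subtype.val e)
  · exact (hϱ.2 i).2

theorem flagMap_mul_gen (h : IsPolytope P rk n) {Φ : PolyFlag P} {ϱ : Fin n → ↥(orderAut P)}
    (hϱ : IsDistinguishedGens P rk n Φ.1 ϱ) (g : ↥(orderAut P)) (i : Fin n) :
    flagMap (g * ϱ i) Φ = h.adj i (flagMap g Φ) := by
  rw [flagMap_mul, h.flagMap_gen hϱ, h.adj_flagMap]

theorem flagMap_mul_gen_pow (h : IsPolytope P rk n) {Φ : PolyFlag P}
    {ϱ : Fin n → ↥(orderAut P)} (hϱ : IsDistinguishedGens P rk n Φ.1 ϱ) (g : ↥(orderAut P))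
    (i j : Fin n) (m : ℕ) :
    flagMap (g * (ϱ i * ϱ j) ^ m) Φ = (h.adj j ∘ h.adj i)^[m] (flagMap g Φ) := by
  induction m with
  | zero => simp
  | succ m ih =>
    rw [pow_succ, ← mul_assoc, ← mul_assoc, h.flagMap_mul_gen hϱ, h.flagMap_mul_gen hϱ, ih,
      Function.iterate_succ_apply']
    rfl

theorem iterate_adj_eq_iff (h : IsPolytope P rk n) (hreg : IsRegularPolytope P)
    {Φ : PolyFlag P} {ϱ : Fin n → ↥(orderAut P)} (hϱ : IsDistinguishedGens P rk n Φ.1 ϱ)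
    (Ψ : PolyFlag P) (i j : Fin n) (m : ℕ) :
    (h.adj j ∘ h.adj i)^[m] Ψ = Ψ ↔ orderOf (ϱ i * ϱ j) ∣ m := by
  obtain ⟨g, rfl⟩ := exists_flagMap hreg Φ Ψ
  rw [← h.flagMap_mul_gen_pow hϱ, (h.flagMap_injective Φ).eq_iff, mul_eq_left,
    orderOf_dvd_iff_pow_eq_one]

theorem gen_mul_self (h : IsPolytope P rk n) {Φ : PolyFlag P} {ϱ : Fin n → ↥(orderAut P)}
    (hϱ : IsDistinguishedGens P rk n Φ.1 ϱ) (i : Fin n) : ϱ i * ϱ i = 1 := by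
  apply h.flagMap_injective Φ
  simp only
  rw [h.flagMap_mul_gen hϱ, h.flagMap_gen hϱ, h.adj_adj, flagMap_one]

theorem gen_comm (h : IsPolytope P rk n) {Φ : PolyFlag P} {ϱ : Fin n → ↥(orderAut P)}
    (hϱ : IsDistinguishedGens P rk n Φ.1 ϱ) {i j : Fin n} (hij : (i : ℕ) + 2 ≤ j) :
    ϱ i * ϱ j = ϱ j * ϱ i := by
  apply h.flagMap_injective Φ
  simp only
  rw [h.flagMap_mul_gen hϱ, h.flagMap_gen hϱ, h.flagMap_mul_gen hϱ, h.flagMap_gen hϱ,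
    h.adj_comm hij]

theorem dual (h : IsPolytope P rk n) : IsPolytope Pᵒᵈ (dualRk rk n) n := by
  obtain ⟨⟨b, hb, hbr⟩, ⟨t, ht, htr⟩, hm, hf, hd, hc⟩ := h
  refine ⟨⟨t, ht, ?_⟩, ⟨b, hb, ?_⟩, ?_, ?_, ?_, ?_⟩
  · change (n : ℤ) - 1 - rk t = -1
    omega
  · change (n : ℤ) - 1 - rk b = n
    omega
  · intro x y hxy
    have : rk (OrderDual.ofDual y) < rk (OrderDual.ofDual x) := hm hxy
    change (n : ℤ) - 1 - rk (OrderDual.ofDual x) < (n : ℤ) - 1 - rk (OrderDual.ofDual y)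
    omega
  · intro F hF k h1 h2
    obtain ⟨x, hx, hr⟩ := hf F hF.dual ((n : ℤ) - 1 - k) (by omega) (by omega)
    refine ⟨x, hx, ?_⟩
    change (n : ℤ) - 1 - rk x = k
    omega
  · intro x z hxz hr
    have hr' : (n : ℤ) - 1 - rk (OrderDual.ofDual z) =
      (n : ℤ) - 1 - rk (OrderDual.ofDual x) + 2 := hr
    have := hd (OrderDual.ofDual z) (OrderDual.ofDual x) hxz (by omega)
    rw [← this]
    congr 1
    ext y
    exact and_comm
  · intro F G hF hG
    refine Relation.ReflTransGen.mono ?_ _ _ (hc F G hF.dual hG.dual)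
    rintro A B ⟨hA, hB, hrest⟩
    exact ⟨IsMaxFlag.dual hA, IsMaxFlag.dual hB, hrest⟩

end IsPolytope

/-! ### Generalised cubes of vertex-describable polytopes -/

/-- Faces are determined by their vertices, compatibly with the order. -/
def VertexDescribable (L : Type*) [PartialOrder L] (rk : L → ℤ) : Prop :=
  ∀ a b : L, (∀ v : polyVertices L rk, v.1 ≤ a → v.1 ≤ b) → a ≤ b

open Classical in
/-- Change the coordinate `v`. -/
def flipAt {V : Type*} (v : V) (x : V → Bool) : V → Bool := Function.update x v (!x v)

theorem flipAt_self {V : Type*} (v : V) (x : V → Bool) : flipAt v x v = !x v := by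
  simp [flipAt]

theorem flipAt_of_ne {V : Type*} {v w : V} (h : w ≠ v) (x : V → Bool) :
    flipAt v x w = x w := by
  simp [flipAt, h]

theorem flipAt_flipAt {V : Type*} (v : V) (x : V → Bool) : flipAt v (flipAt v x) = x := by
  ext w
  by_cases h : w = v
  · subst h
    simp [flipAt_self]
  · rw [flipAt_of_ne h, flipAt_of_ne h]

theorem flipAt_comm {V : Type*} (v w : V) (x : V → Bool) :
    flipAt v (flipAt w x) = flipAt w (flipAt v x) := by
  by_cases h : v = w
  · rw [h]
  ext u
  by_cases hv : u = v
  · subst hv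
    rw [flipAt_self, flipAt_of_ne h, flipAt_of_ne h, flipAt_self]
  · by_cases hw : u = w
    · subst hw
      rw [flipAt_of_ne hv, flipAt_self, flipAt_self, flipAt_of_ne hv]
    · rw [flipAt_of_ne hv, flipAt_of_ne hw, flipAt_of_ne hw, flipAt_of_ne hv]

theorem flipAt_ne {V : Type*} (v : V) (x : V → Bool) : flipAt v x ≠ x := by
  intro h
  have := congrFun h v
  simp [flipAt_self] at this

theorem flipAt_eq_of_ne {V : Type*} {v : V} {x y : V → Bool} (h : x v ≠ y v) :
    flipAt v x v = y v := by
  rw [flipAt_self]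
  revert h
  cases x v <;> cases y v <;> simp

theorem ncard_diff_eq_one {α : Type*} {A B : Set α} {a : α} (ha : a ∈ A) (hb : a ∉ B)
    (h : ∀ x ∈ A, x ≠ a → x ∈ B) : (A \ B).ncard = 1 := by
  rw [Set.ncard_eq_one]
  refine ⟨a, Set.ext fun x => ⟨fun hx => ?_, ?_⟩⟩
  · by_contra hne
    exact hx.2 (h x hx.1 hne)
  · rintro rfl
    exact ⟨ha, hb⟩

section GenCube

variable {L : Type*} [PartialOrder L] {rk : L → ℤ}

/-- The face `F(x)` as an element of the generalised cube. -/
def cubeMk (rk : L → ℤ) (F : L) (x : polyVertices L rk → Bool) : genCube L rk :=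
  ⟨cubeFace L rk F x, Or.inr ⟨F, x, rfl⟩⟩

/-- The least face of the generalised cube. -/
def cubeBot (rk : L → ℤ) : genCube L rk := ⟨∅, Or.inl rfl⟩

theorem mem_cubeFace_self (F : L) (x : polyVertices L rk → Bool) : x ∈ cubeFace L rk F x :=
  fun _ _ => rfl

theorem cube_cases (S : genCube L rk) : S = cubeBot rk ∨ ∃ F x, S = cubeMk rk F x := by
  rcases S with ⟨S, rfl | ⟨F, x, rfl⟩⟩
  · exact Or.inl rfl
  · exact Or.inr ⟨F, x, rfl⟩

theorem cubeBot_le (S : genCube L rk) : cubeBot rk ≤ S := Set.empty_subset S.1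

theorem cubeMk_ne_bot (F : L) (x : polyVertices L rk → Bool) : cubeMk rk F x ≠ cubeBot rk := by
  intro h
  have h1 : x ∈ (cubeMk rk F x).1 := mem_cubeFace_self F x
  rw [h] at h1
  exact h1

theorem cubeBot_lt_mk (F : L) (x : polyVertices L rk → Bool) : cubeBot rk < cubeMk rk F x :=
  lt_of_le_of_ne (cubeBot_le _) (cubeMk_ne_bot F x).symm

theorem cubeMk_le_iff (hV : VertexDescribable L rk) {F G : L}
    {x y : polyVertices L rk → Bool} :
    cubeMk rk F x ≤ cubeMk rk G y ↔
      F ≤ G ∧ ∀ v : polyVertices L rk, ¬ v.1 ≤ G → x v = y v := by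
  constructor
  · intro h
    have h1 : ∀ v : polyVertices L rk, ¬ v.1 ≤ G → x v = y v := h (mem_cubeFace_self F x)
    refine ⟨hV F G fun v hv => ?_, h1⟩
    by_contra hvG
    have h2 : flipAt v x ∈ cubeFace L rk G y := by
      apply h
      intro w hw
      exact flipAt_of_ne (fun e => hw (by rwa [e])) x
    have h3 := h2 v hvG
    rw [← h1 v hvG, flipAt_self] at h3
    simp at h3
  · rintro ⟨hFG, hxy⟩ z hz v hv
    rw [hz v fun hvF => hv (hvF.trans hFG), hxy v hv]

theorem cubeMk_eq_iff (hV : VertexDescribable L rk) {F G : L}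
    {x y : polyVertices L rk → Bool} :
    cubeMk rk F x = cubeMk rk G y ↔
      F = G ∧ ∀ v : polyVertices L rk, ¬ v.1 ≤ F → x v = y v := by
  constructor
  · intro h
    have h1 := (cubeMk_le_iff hV).1 h.le
    have h2 := (cubeMk_le_iff hV).1 h.ge
    have e := le_antisymm h1.1 h2.1
    subst e
    exact ⟨rfl, h1.2⟩
  · rintro ⟨rfl, h⟩
    exact le_antisymm ((cubeMk_le_iff hV).2 ⟨le_rfl, h⟩)
      ((cubeMk_le_iff hV).2 ⟨le_rfl, fun v hv => (h v hv).symm⟩)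

theorem cubeMk_right_eq_iff (hV : VertexDescribable L rk) {F G : L}
    {x : polyVertices L rk → Bool} : cubeMk rk F x = cubeMk rk G x ↔ F = G := by
  rw [cubeMk_eq_iff hV]
  simp

theorem eq_cubeMk_of_mem (hV : VertexDescribable L rk) {S : genCube L rk}
    {x : polyVertices L rk → Bool} (hx : x ∈ S.1) : ∃ F, S = cubeMk rk F x := by
  rcases cube_cases S with rfl | ⟨F, y, rfl⟩
  · exact hx.elim
  · exact ⟨F, (cubeMk_eq_iff hV).2 ⟨rfl, fun v hv => (hx v hv).symm⟩⟩

open Classical in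
/-- The rank function of the generalised cube. -/
def cubeRk (rk : L → ℤ) (S : genCube L rk) : ℤ :=
  if h : ∃ F x, S = cubeMk rk F x then rk h.choose + 1 else -1

theorem cubeRk_bot : cubeRk rk (cubeBot rk) = -1 := by
  rw [cubeRk, dif_neg]
  rintro ⟨F, x, h⟩
  exact cubeMk_ne_bot F x h.symm

theorem cubeRk_mk (hV : VertexDescribable L rk) (F : L) (x : polyVertices L rk → Bool) :
    cubeRk rk (cubeMk rk F x) = rk F + 1 := by
  have h : ∃ G y, cubeMk rk F x = cubeMk rk G y := ⟨F, x, rfl⟩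
  rw [cubeRk, dif_pos h]
  obtain ⟨y, hy⟩ := h.choose_spec
  rw [← ((cubeMk_eq_iff hV).1 hy).1]

/-- The flag of the generalised cube given by a vertex `x` and a flag of `L`. -/
def cubeFlag (hV : VertexDescribable L rk) (x : polyVertices L rk → Bool) (Φ : PolyFlag L) :
    PolyFlag (genCube L rk) :=
  ⟨insert (cubeBot rk) ((fun F => cubeMk rk F x) '' Φ.1), by
    have hle : ∀ {F G : L}, F ≤ G → cubeMk rk F x ≤ cubeMk rk G x :=
      fun h => (cubeMk_le_iff hV).2 ⟨h, fun _ _ => rfl⟩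
    rw [isMaxFlag_iff]
    intro S
    constructor
    · rintro (rfl | ⟨F, hF, rfl⟩) T (rfl | ⟨G, hG, rfl⟩)
      · exact Or.inl le_rfl
      · exact Or.inl (cubeBot_le _)
      · exact Or.inr (cubeBot_le _)
      · exact (Φ.le_or_le hF hG).imp hle hle
    · intro h
      rcases cube_cases S with rfl | ⟨F, y, rfl⟩
      · exact Or.inl rfl
      · right
        have key : ∀ G ∈ Φ.1, (F ≤ G ∨ G ≤ F) := by
          intro G hG
          refine (h _ (Or.inr ⟨G, hG, rfl⟩)).imp (fun h => ?_) (fun h => ?_)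
          · exact ((cubeMk_le_iff hV).1 h).1
          · exact ((cubeMk_le_iff hV).1 h).1
        have hF : F ∈ Φ.1 := (isMaxFlag_iff.1 Φ.2 F).2 key
        refine ⟨F, hF, ?_⟩
        rw [cubeMk_eq_iff hV]
        refine ⟨rfl, ?_⟩
        rcases h _ (Or.inr ⟨F, hF, rfl⟩) with h | h
        · intro v hv
          exact (((cubeMk_le_iff hV).1 h).2 v hv).symm
        · exact ((cubeMk_le_iff hV).1 h).2⟩

theorem cubeBot_mem_cubeFlag (hV : VertexDescribable L rk) (x : polyVertices L rk → Bool)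
    (Φ : PolyFlag L) : cubeBot rk ∈ (cubeFlag hV x Φ).1 := Or.inl rfl

theorem mem_cubeFlag_iff (hV : VertexDescribable L rk) {x y : polyVertices L rk → Bool}
    {Φ : PolyFlag L} {F : L} :
    cubeMk rk F y ∈ (cubeFlag hV x Φ).1 ↔
      F ∈ Φ.1 ∧ ∀ v : polyVertices L rk, ¬ v.1 ≤ F → x v = y v := by
  constructor
  · rintro (h | ⟨G, hG, h⟩)
    · exact absurd h (cubeMk_ne_bot F y)
    · obtain ⟨rfl, h2⟩ := (cubeMk_eq_iff hV).1 h
      exact ⟨hG, h2⟩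
  · rintro ⟨hF, h⟩
    exact Or.inr ⟨F, hF, (cubeMk_eq_iff hV).2 ⟨rfl, h⟩⟩

theorem cubeMk_mem_cubeFlag_iff (hV : VertexDescribable L rk) {x : polyVertices L rk → Bool}
    {Φ : PolyFlag L} {F : L} : cubeMk rk F x ∈ (cubeFlag hV x Φ).1 ↔ F ∈ Φ.1 := by
  rw [mem_cubeFlag_iff]
  simp

variable {n : ℕ}

theorem not_le_bot_of_vertex (h : IsPolytope L rk n) {b : L} (hb : rk b = -1)
    (v : polyVertices L rk) : ¬ v.1 ≤ b := by
  intro hv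
  have := h.strictMono.monotone hv
  have := v.2
  omega

theorem cubeFlag_injective (h : IsPolytope L rk n) (hV : VertexDescribable L rk)
    {x y : polyVertices L rk → Bool} {Φ Ψ : PolyFlag L}
    (he : cubeFlag hV x Φ = cubeFlag hV y Ψ) : x = y ∧ Φ = Ψ := by
  obtain ⟨b, hb, hbr⟩ := h.exists_mem_rk Φ (k := -1) le_rfl (by omega)
  have h1 := (cubeMk_mem_cubeFlag_iff hV (x := x)).2 hb
  rw [he, mem_cubeFlag_iff] at h1
  have hxy : x = y := by
    ext v
    exact (h1.2 v (not_le_bot_of_vertex h hbr v)).symm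
  subst hxy
  refine ⟨rfl, PolyFlag.eq_of_subset fun F hF => ?_⟩
  rw [← cubeMk_mem_cubeFlag_iff hV (x := x)] at hF ⊢
  rwa [← he]

theorem exists_cubeFlag (h : IsPolytope L rk n) [Finite L] (hV : VertexDescribable L rk)
    (M : PolyFlag (genCube L rk)) : ∃ x Φ, M = cubeFlag hV x Φ := by
  obtain ⟨b, hbot, hbr⟩ := h.1
  obtain ⟨t, htop, htr⟩ := h.2.1
  have htop_mem : cubeMk rk t (fun _ => false) ∈ M.1 := by
    refine (isMaxFlag_iff.1 M.2 _).2 fun S _ => Or.inr ?_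
    rcases cube_cases S with rfl | ⟨F, y, rfl⟩
    · exact cubeBot_le _
    · exact (cubeMk_le_iff hV).2 ⟨htop F, fun v hv => absurd (htop v.1) hv⟩
  obtain ⟨S, hS⟩ := (Set.toFinite {S | S ∈ M.1 ∧ S ≠ cubeBot rk}).exists_minimal
    ⟨_, htop_mem, cubeMk_ne_bot _ _⟩
  obtain ⟨⟨hSM, hSb⟩, hmin⟩ := hS
  rcases cube_cases S with rfl | ⟨F, x, rfl⟩
  · exact absurd rfl hSb
  have hx : ∀ T ∈ M.1, T ≠ cubeBot rk → x ∈ T.1 := by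
    intro T hT hTb
    rcases M.le_or_le hSM hT with hle | hle
    · exact hle (mem_cubeFace_self F x)
    · exact hmin ⟨hT, hTb⟩ hle (mem_cubeFace_self F x)
  have hc : ∀ A ∈ {A : L | cubeMk rk A x ∈ M.1}, ∀ B ∈ {A : L | cubeMk rk A x ∈ M.1},
      A ≤ B ∨ B ≤ A := by
    intro A hA B hB
    refine (M.le_or_le hA hB).imp (fun h => ?_) (fun h => ?_)
    · exact ((cubeMk_le_iff hV).1 h).1
    · exact ((cubeMk_le_iff hV).1 h).1
  obtain ⟨Φ, hΦ⟩ := exists_polyFlag _ hc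
  refine ⟨x, Φ, PolyFlag.eq_of_subset fun T hT => ?_⟩
  by_cases hTb : T = cubeBot rk
  · rw [hTb]
    exact cubeBot_mem_cubeFlag hV x Φ
  · obtain ⟨A, rfl⟩ := eq_cubeMk_of_mem hV (hx T hT hTb)
    exact (cubeMk_mem_cubeFlag_iff hV).2 (hΦ hT)

theorem cubeRk_strictMono (h : IsPolytope L rk n) (hV : VertexDescribable L rk) :
    StrictMono (cubeRk rk) := by
  intro S T hST
  rcases cube_cases T with rfl | ⟨G, y, rfl⟩
  · exact absurd (cubeBot_le S) (not_le_of_gt hST)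
  rcases cube_cases S with rfl | ⟨F, x, rfl⟩
  · rw [cubeRk_bot, cubeRk_mk hV]
    have := h.neg_one_le_rk G
    omega
  · rw [cubeRk_mk hV, cubeRk_mk hV]
    have h1 := (cubeMk_le_iff hV).1 hST.le
    have h2 : F < G := lt_of_le_of_ne h1.1 (by
      rintro rfl
      exact hST.ne ((cubeMk_eq_iff hV).2 ⟨rfl, h1.2⟩))
    have := h.strictMono h2
    omega

theorem cubeMk_flipAt (hV : VertexDescribable L rk) {F : L} {v : polyVertices L rk}
    (hv : v.1 ≤ F) (x : polyVertices L rk → Bool) :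
    cubeMk rk F (flipAt v x) = cubeMk rk F x :=
  (cubeMk_eq_iff hV).2 ⟨rfl, fun w hw => flipAt_of_ne (by rintro rfl; exact hw hv) x⟩

theorem cube_diamond (h : IsPolytope L rk n) (hV : VertexDescribable L rk)
    {S T : genCube L rk} (hST : S < T) (hr : cubeRk rk T = cubeRk rk S + 2) :
    {U | S < U ∧ U < T}.ncard = 2 := by
  rcases cube_cases T with rfl | ⟨G, y, rfl⟩
  · exact absurd (cubeBot_le S) (not_le_of_gt hST)
  rcases cube_cases S with rfl | ⟨F, x, rfl⟩
  · rw [cubeRk_bot, cubeRk_mk hV] at hr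
    obtain ⟨b, hb, hbr⟩ := h.1
    have hGr : rk G = 0 := by omega
    set v : polyVertices L rk := ⟨G, hGr⟩ with hv
    rw [Set.ncard_eq_two]
    refine ⟨cubeMk rk b y, cubeMk rk b (flipAt v y), ?_, ?_⟩
    · intro he
      have := ((cubeMk_eq_iff hV).1 he).2 v (not_le_bot_of_vertex h hbr v)
      rw [flipAt_self] at this
      simp at this
    · have hbG : b < G := lt_of_le_of_ne (hb G) (by rintro rfl; omega)
      ext U
      constructor
      · rintro ⟨hU1, hU2⟩
        rcases cube_cases U with rfl | ⟨F, x, rfl⟩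
        · exact absurd hU1 (lt_irrefl _)
        · have h2 := cubeRk_strictMono h hV hU2
          rw [cubeRk_mk hV, cubeRk_mk hV] at h2
          have h3 := h.neg_one_le_rk F
          obtain rfl : F = b := h.eq_of_rk_eq (Or.inr (hb F)) (by omega)
          have h4 := ((cubeMk_le_iff hV).1 hU2.le).2
          have hw : ∀ w : polyVertices L rk, w ≠ v → x w = y w := by
            intro w hw
            refine h4 w fun hle => hw (Subtype.ext ?_)
            exact h.eq_of_rk_eq (Or.inl hle) (by rw [w.2, hGr])
          by_cases hxy : x v = y v
          · left
            congr 1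
            ext w
            by_cases e : w = v
            · rw [e, hxy]
            · rw [hw w e]
          · right
            change _ = _
            congr 1
            ext w
            by_cases e : w = v
            · rw [e, flipAt_eq_of_ne (Ne.symm hxy)]
            · rw [hw w e, flipAt_of_ne e]
      · rintro (rfl | rfl)
        · exact ⟨cubeBot_lt_mk _ _, lt_of_le_of_ne
            ((cubeMk_le_iff hV).2 ⟨hbG.le, fun _ _ => rfl⟩)
            (fun he => hbG.ne ((cubeMk_eq_iff hV).1 he).1)⟩
        · refine ⟨cubeBot_lt_mk _ _, lt_of_le_of_ne ?_
            (fun he => hbG.ne ((cubeMk_eq_iff hV).1 he).1)⟩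
          refine (cubeMk_le_iff hV).2 ⟨hbG.le, fun w hw => flipAt_of_ne ?_ _⟩
          rintro rfl
          exact hw le_rfl
  · have h1 := (cubeMk_le_iff hV).1 hST.le
    have hy : cubeMk rk G y = cubeMk rk G x :=
      (cubeMk_eq_iff hV).2 ⟨rfl, fun v hv => (h1.2 v hv).symm⟩
    rw [hy] at hST hr ⊢
    have hlt : ∀ {A B : L}, cubeMk rk A x < cubeMk rk B x ↔ A < B := by
      intro A B
      rw [lt_iff_le_not_ge, lt_iff_le_not_ge, cubeMk_le_iff hV, cubeMk_le_iff hV]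
      simp
    rw [cubeRk_mk hV, cubeRk_mk hV] at hr
    rw [← h.2.2.2.2.1 F G (hlt.1 hST) (by omega),
      ← Set.ncard_image_of_injective (f := fun A => cubeMk rk A x) _
        fun A B e => (cubeMk_right_eq_iff hV).1 e]
    congr 1
    ext U
    constructor
    · rintro ⟨h2, h3⟩
      obtain ⟨A, rfl⟩ := eq_cubeMk_of_mem hV (h2.le (mem_cubeFace_self F x))
      exact ⟨A, ⟨hlt.1 h2, hlt.1 h3⟩, rfl⟩
    · rintro ⟨A, ⟨h2, h3⟩, rfl⟩
      exact ⟨hlt.2 h2, hlt.2 h3⟩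

/-- The elementary steps of strong flag-connectivity relative to a set `I` of faces. -/
def FlagStep {P : Type*} [PartialOrder P] (I : Set P) (A B : Set P) : Prop :=
  IsMaxFlag P A ∧ IsMaxFlag P B ∧ I ⊆ A ∧ I ⊆ B ∧ (A \ B).ncard = 1 ∧ (B \ A).ncard = 1

theorem cubeFlag_ncard_diff_adj (h : IsPolytope L rk n) (hV : VertexDescribable L rk)
    (x : polyVertices L rk → Bool) (Θ : PolyFlag L) (i : Fin n) :
    ((cubeFlag hV x Θ).1 \ (cubeFlag hV x (h.adj i Θ)).1).ncard = 1 := by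
  apply ncard_diff_eq_one (a := cubeMk rk (h.face Θ i) x)
  · exact (cubeMk_mem_cubeFlag_iff hV).2 (h.face_mem Θ i)
  · rw [cubeMk_mem_cubeFlag_iff hV]
    intro hm
    exact h.face_adj_self_ne i Θ (h.face_eq hm (h.rk_face _ _))
  · rintro S (rfl | ⟨F, hF, rfl⟩) hne
    · exact cubeBot_mem_cubeFlag hV _ _
    · refine (cubeMk_mem_cubeFlag_iff hV).2 (h.mem_adj hF fun hr => hne ?_)
      simp only
      rw [h.face_eq hF hr]

theorem cubeMk_mem_cubeFlag_flipAt (h : IsPolytope L rk n) (hV : VertexDescribable L rk)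
    {x : polyVertices L rk → Bool} {Θ : PolyFlag L} {v : polyVertices L rk} (hv : v.1 ∈ Θ.1)
    {F : L} (hF : F ∈ Θ.1) (hr : rk F ≠ -1) :
    cubeMk rk F x ∈ (cubeFlag hV (flipAt v x) Θ).1 := by
  have hvF : v.1 ≤ F := by
    rcases Θ.le_or_le hv hF with hle | hle
    · exact hle
    · refine (h.eq_of_rk_eq (Or.inr hle) ?_).le
      have := h.strictMono.monotone hle
      have := h.neg_one_le_rk F
      have := v.2
      omega
  rw [← cubeMk_flipAt hV hvF, cubeMk_mem_cubeFlag_iff hV]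
  exact hF

theorem cubeFlag_ncard_diff_flipAt (h : IsPolytope L rk n) (hV : VertexDescribable L rk)
    (x : polyVertices L rk → Bool) (Θ : PolyFlag L) {v : polyVertices L rk} (hv : v.1 ∈ Θ.1) :
    ((cubeFlag hV x Θ).1 \ (cubeFlag hV (flipAt v x) Θ).1).ncard = 1 := by
  obtain ⟨b, hb, hbr⟩ := h.exists_mem_rk Θ (k := -1) le_rfl (by omega)
  apply ncard_diff_eq_one (a := cubeMk rk b x)
  · exact (cubeMk_mem_cubeFlag_iff hV).2 hb
  · rw [mem_cubeFlag_iff hV]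
    rintro ⟨-, h2⟩
    have := h2 v (not_le_bot_of_vertex h hbr v)
    rw [flipAt_self] at this
    simp at this
  · rintro S (rfl | ⟨F, hF, rfl⟩) hne
    · exact cubeBot_mem_cubeFlag hV _ _
    · refine cubeMk_mem_cubeFlag_flipAt h hV hv hF fun hr => hne ?_
      simp only
      rw [h.eq_of_rk_eq (Θ.le_or_le hF hb) (by omega)]

theorem cubeFlag_reach (h : IsPolytope L rk n) (hV : VertexDescribable L rk)
    (x : polyVertices L rk → Bool) {Φ Ψ : PolyFlag L} {I : Set (genCube L rk)}
    (h1 : I ⊆ (cubeFlag hV x Φ).1) (h2 : I ⊆ (cubeFlag hV x Ψ).1) :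
    Relation.ReflTransGen (FlagStep I) (cubeFlag hV x Φ).1 (cubeFlag hV x Ψ).1 := by
  refine (h.flag_induction (Φ := Φ) (Ψ := Ψ) (p := fun Θ => I ⊆ (cubeFlag hV x Θ).1 ∧
    Relation.ReflTransGen (FlagStep I) (cubeFlag hV x Φ).1 (cubeFlag hV x Θ).1)
    ⟨h1, .refl⟩ ?_).2
  rintro Θ i hne ⟨hI, hreach⟩
  have hI' : I ⊆ (cubeFlag hV x (h.adj i Θ)).1 := by
    intro S hS
    rcases h1 hS with rfl | ⟨F, hF, rfl⟩
    · exact cubeBot_mem_cubeFlag hV _ _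
    · refine (cubeMk_mem_cubeFlag_iff hV).2
        (h.mem_adj ((cubeMk_mem_cubeFlag_iff hV).1 (hI hS)) fun hr => hne ?_)
      rw [h.face_eq hF hr, h.face_eq ((cubeMk_mem_cubeFlag_iff hV).1 (h2 hS)) hr]
  refine ⟨hI', hreach.tail ⟨Subtype.prop _, Subtype.prop _, hI, hI',
    cubeFlag_ncard_diff_adj h hV x Θ i, ?_⟩⟩
  have := cubeFlag_ncard_diff_adj h hV x (h.adj i Θ) i
  rwa [h.adj_adj] at this

theorem cube_stronglyFlagConnected (h : IsPolytope L rk n) [Finite L]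
    (hV : VertexDescribable L rk) : StronglyFlagConnected (genCube L rk) := by
  intro F G hF hG
  obtain ⟨x, Φ, hx⟩ := exists_cubeFlag h hV ⟨F, hF⟩
  obtain ⟨y, Ψ, hy⟩ := exists_cubeFlag h hV ⟨G, hG⟩
  obtain rfl : F = (cubeFlag hV x Φ).1 := congrArg Subtype.val hx
  obtain rfl : G = (cubeFlag hV y Ψ).1 := congrArg Subtype.val hy
  clear hx hy hF hG
  change Relation.ReflTransGen (FlagStep ((cubeFlag hV x Φ).1 ∩ (cubeFlag hV y Ψ).1)) _ _
  generalize hI : (cubeFlag hV x Φ).1 ∩ (cubeFlag hV y Ψ).1 = I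
  have h1 : I ⊆ (cubeFlag hV x Φ).1 := hI ▸ Set.inter_subset_left
  have h2 : I ⊆ (cubeFlag hV y Ψ).1 := hI ▸ Set.inter_subset_right
  clear hI
  generalize hm : {v | x v ≠ y v}.ncard = m
  induction m generalizing x Φ with
  | zero =>
    rw [Set.ncard_eq_zero] at hm
    obtain rfl : x = y := by
      ext v
      by_contra hv
      have : v ∈ ({v | x v ≠ y v} : Set _) := hv
      rw [hm] at this
      exact this
    exact cubeFlag_reach h hV x h1 h2
  | succ m ih =>
    obtain ⟨v, hv⟩ : {v | x v ≠ y v}.Nonempty := by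
      rw [← Set.ncard_pos]
      omega
    have hvI : ∀ A ∈ {A : L | cubeMk rk A x ∈ I}, v.1 ≤ A := by
      intro A hA
      by_contra hvA
      exact hv (((mem_cubeFlag_iff hV).1 (h2 hA)).2 v hvA).symm
    have hc : ∀ A ∈ insert v.1 {A : L | cubeMk rk A x ∈ I},
        ∀ B ∈ insert v.1 {A : L | cubeMk rk A x ∈ I}, A ≤ B ∨ B ≤ A := by
      rintro A (rfl | hA) B (rfl | hB)
      · exact Or.inl le_rfl
      · exact Or.inl (hvI B hB)
      · exact Or.inr (hvI A hA)
      · exact Φ.le_or_le ((cubeMk_mem_cubeFlag_iff hV).1 (h1 hA))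
          ((cubeMk_mem_cubeFlag_iff hV).1 (h1 hB))
    obtain ⟨Θ, hΘ⟩ := exists_polyFlag _ hc
    have hI1 : I ⊆ (cubeFlag hV x Θ).1 := by
      intro S hS
      rcases h1 hS with rfl | ⟨A, hA, rfl⟩
      · exact cubeBot_mem_cubeFlag hV _ _
      · exact (cubeMk_mem_cubeFlag_iff hV).2 (hΘ (Or.inr hS))
    have hI2 : I ⊆ (cubeFlag hV (flipAt v x) Θ).1 := by
      intro S hS
      rcases h1 hS with rfl | ⟨A, hA, rfl⟩
      · exact cubeBot_mem_cubeFlag hV _ _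
      · simp only
        rw [← cubeMk_flipAt hV (hvI A hS)]
        exact (cubeMk_mem_cubeFlag_iff hV).2 (hΘ (Or.inr hS))
    have hvΘ : v.1 ∈ Θ.1 := hΘ (Or.inl rfl)
    refine ((cubeFlag_reach h hV x h1 hI1).tail ⟨Subtype.prop _, Subtype.prop _, hI1, hI2,
      cubeFlag_ncard_diff_flipAt h hV x Θ hvΘ, ?_⟩).trans (ih (flipAt v x) Θ hI2 ?_)
    · have := cubeFlag_ncard_diff_flipAt h hV (flipAt v x) Θ hvΘ
      rwa [flipAt_flipAt] at this
    · have : {w | x w ≠ y w} = insert v {w | flipAt v x w ≠ y w} := by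
        ext w
        by_cases hw : w = v
        · subst hw
          simpa using hv
        · simp [flipAt_of_ne hw, hw]
      rw [this, Set.ncard_insert_of_notMem] at hm
      · omega
      · intro hmem
        exact hmem (flipAt_eq_of_ne hv)

theorem cube_isPolytope (h : IsPolytope L rk n) [Finite L] (hV : VertexDescribable L rk) :
    IsPolytope (genCube L rk) (cubeRk rk) (n + 1) := by
  obtain ⟨t, htop, htr⟩ := h.2.1
  refine ⟨⟨cubeBot rk, cubeBot_le, cubeRk_bot⟩, ⟨cubeMk rk t fun _ => false, ?_, ?_⟩,
    cubeRk_strictMono h hV, ?_, fun S T => cube_diamond h hV, cube_stronglyFlagConnected h hV⟩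
  · intro S
    rcases cube_cases S with rfl | ⟨F, y, rfl⟩
    · exact cubeBot_le _
    · exact (cubeMk_le_iff hV).2 ⟨htop F, fun v hv => absurd (htop v.1) hv⟩
  · rw [cubeRk_mk hV, htr]
    push_cast
    rfl
  · intro F hF k h1 h2
    obtain ⟨x, Φ, hx⟩ := exists_cubeFlag h hV ⟨F, hF⟩
    obtain rfl : F = (cubeFlag hV x Φ).1 := congrArg Subtype.val hx
    rcases h1.eq_or_lt with rfl | hlt
    · exact ⟨_, cubeBot_mem_cubeFlag hV _ _, cubeRk_bot⟩
    · obtain ⟨A, hA, hr⟩ := h.exists_mem_rk Φ (k := k - 1) (by omega)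
        (by push_cast at h2; omega)
      refine ⟨_, (cubeMk_mem_cubeFlag_iff hV (x := x)).2 hA, ?_⟩
      rw [cubeRk_mk hV]
      omega

/-- The automorphism of the generalised cube induced by a permutation of its vertices that
preserves faces. -/
def cubeAut (β : Equiv.Perm (polyVertices L rk → Bool))
    (h1 : ∀ F x, ∃ G y, ⇑β '' cubeFace L rk F x = cubeFace L rk G y)
    (h2 : ∀ F x, ∃ G y, ⇑β.symm '' cubeFace L rk F x = cubeFace L rk G y) :
    ↥(orderAut (genCube L rk)) :=
  ⟨{ toFun := fun S => ⟨⇑β '' S.1, by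
        rcases S with ⟨S, rfl | ⟨F, x, rfl⟩⟩
        · exact Or.inl (Set.image_empty _)
        · exact Or.inr (h1 F x)⟩
     invFun := fun S => ⟨⇑β.symm '' S.1, by
        rcases S with ⟨S, rfl | ⟨F, x, rfl⟩⟩
        · exact Or.inl (Set.image_empty _)
        · exact Or.inr (h2 F x)⟩
     left_inv := fun S => Subtype.ext (by simp)
     right_inv := fun S => Subtype.ext (by simp) },
    fun S T => Set.image_subset_image_iff β.injective⟩

theorem cube_isRegularPolytope (h : IsPolytope L rk n) [Finite L]
    (hV : VertexDescribable L rk) (hreg : IsRegularPolytope L) :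
    IsRegularPolytope (genCube L rk) := by
  intro F G hF hG
  obtain ⟨x, Φ, hx⟩ := exists_cubeFlag h hV ⟨F, hF⟩
  obtain ⟨y, Ψ, hy⟩ := exists_cubeFlag h hV ⟨G, hG⟩
  obtain rfl : F = (cubeFlag hV x Φ).1 := congrArg Subtype.val hx
  obtain rfl : G = (cubeFlag hV y Ψ).1 := congrArg Subtype.val hy
  obtain ⟨g, hg⟩ := IsPolytope.exists_flagMap hreg Φ Ψ
  let π : Equiv.Perm (polyVertices L rk) := g.1.subtypeEquiv fun a => by rw [h.rk_aut]
  have hπ : ∀ (v : polyVertices L rk) (A : L), v.1 ≤ A ↔ (π v).1 ≤ g.1 A :=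
    fun v A => (g.2 v.1 A).symm
  let β : Equiv.Perm (polyVertices L rk → Bool) :=
    { toFun := fun z v => xor (z (π.symm v)) (xor (x (π.symm v)) (y v))
      invFun := fun z v => xor (z (π v)) (xor (x v) (y (π v)))
      left_inv := fun z => by
        ext v
        simp
      right_inv := fun z => by
        ext v
        simp }
  have hβ : ∀ A z, ⇑β '' cubeFace L rk A z = cubeFace L rk (g.1 A) (β z) := by
    intro A z
    ext w
    constructor
    · rintro ⟨u, hu, rfl⟩ v hv
      change xor (u (π.symm v)) _ = xor (z (π.symm v)) _
      rw [hu (π.symm v) ?_]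
      rw [hπ]
      simpa using hv
    · intro hw
      refine ⟨β.symm w, fun v hv => ?_, by simp⟩
      have h1 := hw (π v) (by rwa [← hπ])
      change xor (w (π v)) (xor (x v) (y (π v))) = z v
      rw [h1]
      change xor (xor (z (π.symm (π v))) (xor (x (π.symm (π v))) (y (π v)))) _ = z v
      simp
  have hβ' : ∀ A z, ⇑β.symm '' cubeFace L rk A z =
      cubeFace L rk (g.1⁻¹ A) (β.symm z) := by
    intro A z
    apply Set.image_injective.2 β.injective
    rw [hβ]
    simp
  have hβx : β x = y := by
    ext v
    change xor (x (π.symm v)) (xor (x (π.symm v)) (y v)) = y v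
    simp
  refine ⟨_, (cubeAut β (fun A z => ⟨_, _, hβ A z⟩) (fun A z => ⟨_, _, hβ' A z⟩)).2, ?_⟩
  change (flagMap (cubeAut β _ _) (cubeFlag hV x Φ)).1 = _
  congr 1
  apply PolyFlag.eq_of_subset
  rintro _ ⟨S, rfl | ⟨A, hA, rfl⟩, rfl⟩
  · exact Or.inl (Subtype.ext (Set.image_empty _))
  · right
    refine ⟨g.1 A, ?_, Subtype.ext ?_⟩
    · rw [← hg]
      exact ⟨A, hA, rfl⟩
    · change cubeFace L rk (g.1 A) y = ⇑β '' cubeFace L rk A x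
      rw [hβ, hβx]

end GenCube

/-! ### Coset hypertopes -/

/-- Conditions on involutions `r i` generating a group and on subgroups `Hi i` containing
all `r j` with `j ≠ i` which ensure that the coset system is a regular hypertope. -/
structure IsHypertopeFamily {H I : Type*} [Group H] (r : I → H) (Hi : I → Subgroup H) :
    Prop where
  sq : ∀ i, r i * r i = 1
  ne_one : ∀ i, r i ≠ 1
  closure_eq : Subgroup.closure (Set.range r) = ⊤
  gen_mem : ∀ i j, j ≠ i → r j ∈ Hi i
  inter : ∀ (J : Set I) (g : H), (∀ j ∈ J, g ∈ Hi j) → g ∈ Subgroup.closure (r '' Jᶜ)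
  lift : ∀ (J : Set I) (g : I → H),
    (∀ i ∈ J, ∀ j ∈ J, (rCoset (Hi i) (g i) ∩ rCoset (Hi j) (g j)).Nonempty) →
      ∃ k, ∀ i ∈ J, k ∈ rCoset (Hi i) (g i)

theorem mem_rCoset {G : Type*} [Group G] {K : Subgroup G} {x g : G} :
    x ∈ rCoset K g ↔ x * g⁻¹ ∈ K := Iff.rfl

theorem self_mem_rCoset {G : Type*} [Group G] (K : Subgroup G) (g : G) : g ∈ rCoset K g := by
  rw [mem_rCoset, mul_inv_cancel]
  exact K.one_mem

theorem rCoset_eq_of_mem {G : Type*} [Group G] {K : Subgroup G} {x g : G}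
    (h : x ∈ rCoset K g) : rCoset K g = rCoset K x := by
  ext y
  rw [mem_rCoset, mem_rCoset, ← K.mul_mem_cancel_right (x := x * g⁻¹) (y := y * x⁻¹) h]
  group

theorem image_rCoset {G : Type*} [Group G] (K : Subgroup G) (k g : G) :
    (· * g) '' rCoset K k = rCoset K (k * g) := by
  ext y
  constructor
  · rintro ⟨z, hz, rfl⟩
    simpa [mem_rCoset, mul_assoc] using hz
  · intro hy
    exact ⟨y * g⁻¹, by simpa [mem_rCoset, mul_assoc] using hy, by simp⟩

section Coset

variable {H I : Type*} [Group H] {Hi : I → Subgroup H}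

/-- The coset `Hi i * g` as an element of the coset system. -/
def cosetElt (Hi : I → Subgroup H) (i : I) (g : H) : (cosetSystem Hi).X :=
  ⟨i, ⟨rCoset (Hi i) g, g, rfl⟩⟩

theorem exists_cosetElt (x : (cosetSystem Hi).X) : ∃ g, x = cosetElt Hi x.1 g := by
  obtain ⟨i, s, g, rfl⟩ := x
  exact ⟨g, rfl⟩

theorem cosetElt_eq_of_mem {i : I} {g k : H} (h : k ∈ rCoset (Hi i) g) :
    cosetElt Hi i g = cosetElt Hi i k :=
  Sigma.ext rfl (heq_of_eq (Subtype.ext (rCoset_eq_of_mem h)))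

theorem cosetElt_eq_iff {i : I} {g k : H} :
    cosetElt Hi i k = cosetElt Hi i g ↔ k * g⁻¹ ∈ Hi i := by
  constructor
  · intro h
    have h1 : rCoset (Hi i) k = rCoset (Hi i) g :=
      congrArg Subtype.val (eq_of_heq (Sigma.ext_iff.1 h).2)
    have h2 := self_mem_rCoset (Hi i) k
    rwa [h1] at h2
  · intro h
    exact (cosetElt_eq_of_mem h).symm

theorem cosetElt_inc (i j : I) (g : H) :
    (cosetSystem Hi).inc (cosetElt Hi i g) (cosetElt Hi j g) :=
  ⟨g, self_mem_rCoset _ _, self_mem_rCoset _ _⟩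

theorem cosetSystem_isSystem : (cosetSystem Hi).IsSystem := by
  refine ⟨fun x => ?_, fun x y ⟨a, h1, h2⟩ => ⟨a, h2, h1⟩, ?_⟩
  · obtain ⟨g, hg⟩ := exists_cosetElt x
    rw [hg]
    exact cosetElt_inc _ _ g
  · rintro x y ⟨a, h1, h2⟩ ht
    obtain ⟨g, hg⟩ := exists_cosetElt x
    obtain ⟨k, hk⟩ := exists_cosetElt y
    change x.1 = y.1 at ht
    rw [hg] at h1 ⊢
    rw [hk] at h2 ⊢
    rw [cosetElt_eq_of_mem h1, cosetElt_eq_of_mem h2, ht]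

theorem cosetMul_cosetElt (g : H) (i : I) (k : H) :
    cosetMul Hi g (cosetElt Hi i k) = cosetElt Hi i (k * g) :=
  Sigma.ext rfl (heq_of_eq (Subtype.ext (image_rCoset _ _ _)))

/-- Right multiplication as a permutation of the cosets. -/
def cosetPerm (Hi : I → Subgroup H) (g : H) : Equiv.Perm (cosetSystem Hi).X where
  toFun := cosetMul Hi g
  invFun := cosetMul Hi g⁻¹
  left_inv x := by
    obtain ⟨k, hk⟩ := exists_cosetElt x
    rw [hk, cosetMul_cosetElt, cosetMul_cosetElt, mul_inv_cancel_right]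
  right_inv x := by
    obtain ⟨k, hk⟩ := exists_cosetElt x
    rw [hk, cosetMul_cosetElt, cosetMul_cosetElt, inv_mul_cancel_right]

theorem cosetPerm_mem (g : H) : cosetPerm Hi g ∈ (cosetSystem Hi).typeAut := by
  refine ⟨fun _ => rfl, fun x y => ?_⟩
  change (((· * g) '' x.2.1) ∩ ((· * g) '' y.2.1)).Nonempty ↔ (x.2.1 ∩ y.2.1).Nonempty
  rw [← Set.image_inter (mul_left_injective g), Set.image_nonempty]

namespace IsHypertopeFamily

variable {r : I → H}

theorem closure_le (h : IsHypertopeFamily r Hi) {J : Set I} {i : I} (hi : i ∈ J) :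
    Subgroup.closure (r '' Jᶜ) ≤ Hi i := by
  rw [Subgroup.closure_le]
  rintro _ ⟨j, hj, rfl⟩
  exact h.gen_mem i j fun e => hj (e ▸ hi)

theorem eq_of_forall (h : IsHypertopeFamily r Hi) {g k : H}
    (hgk : ∀ i, cosetElt Hi i g = cosetElt Hi i k) : g = k := by
  have h1 := h.inter Set.univ (g * k⁻¹) fun i _ => cosetElt_eq_iff.1 (hgk i)
  rw [Set.compl_univ, Set.image_empty, Subgroup.closure_empty, Subgroup.mem_bot] at h1
  exact mul_inv_eq_one.1 h1

theorem cosetElt_gen_mul (h : IsHypertopeFamily r Hi) {i j : I} (hij : j ≠ i) (g : H) :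
    cosetElt Hi i (r j * g) = cosetElt Hi i g := by
  rw [cosetElt_eq_iff, mul_inv_cancel_right]
  exact h.gen_mem i j hij

theorem cosetElt_gen_mul_self_ne (h : IsHypertopeFamily r Hi) (i : I) (g : H) :
    cosetElt Hi i (r i * g) ≠ cosetElt Hi i g := by
  intro he
  apply h.ne_one i
  have := h.eq_of_forall (g := r i * g) (k := g) fun j => ?_
  · simpa using this
  by_cases hj : i = j
  · rw [← hj, he]
  · exact h.cosetElt_gen_mul hj g

theorem exists_of_isFlag (h : IsHypertopeFamily r Hi) {F : Set (cosetSystem Hi).X}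
    (hF : (cosetSystem Hi).IsFlag F) : ∃ k, ∀ x ∈ F, x = cosetElt Hi x.1 k := by
  have hex : ∀ i, ∃ g, ∀ x ∈ F, x.1 = i → x = cosetElt Hi i g := by
    intro i
    by_cases hi : ∃ x ∈ F, x.1 = i
    · obtain ⟨x, hx, rfl⟩ := hi
      obtain ⟨g, hg⟩ := exists_cosetElt x
      refine ⟨g, fun y hy hyx => ?_⟩
      rw [← hg]
      exact cosetSystem_isSystem.2.2 y x (hF y hy x hx) hyx
    · push Not at hi
      exact ⟨1, fun x hx hxi => absurd hxi (hi x hx)⟩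
  choose g hg using hex
  obtain ⟨k, hk⟩ := h.lift {i | ∃ x ∈ F, x.1 = i} g (by
    rintro i ⟨x, hx, hxi⟩ j ⟨y, hy, hyj⟩
    have := hF x hx y hy
    rw [hg i x hx hxi, hg j y hy hyj] at this
    exact this)
  refine ⟨k, fun x hx => ?_⟩
  rw [← cosetElt_eq_of_mem (hk x.1 ⟨x, hx, rfl⟩)]
  exact hg x.1 x hx rfl

theorem isChamber_iff (h : IsHypertopeFamily r Hi) {C : Set (cosetSystem Hi).X} :
    (cosetSystem Hi).IsChamber C ↔ ∃ k, C = Set.range fun i => cosetElt Hi i k := by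
  constructor
  · rintro ⟨hC, ht⟩
    obtain ⟨k, hk⟩ := h.exists_of_isFlag hC
    refine ⟨k, Set.Subset.antisymm (fun x hx => ⟨x.1, (hk x hx).symm⟩) ?_⟩
    rintro _ ⟨i, rfl⟩
    obtain ⟨x, hx, rfl⟩ : i ∈ (cosetSystem Hi).t '' C := ht ▸ Set.mem_univ i
    have := hk x hx
    change cosetElt Hi x.1 k ∈ C
    rwa [← this]
  · rintro ⟨k, rfl⟩
    refine ⟨?_, Set.eq_univ_of_forall fun i => ⟨_, ⟨i, rfl⟩, rfl⟩⟩
    rintro _ ⟨i, rfl⟩ _ ⟨j, rfl⟩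
    exact cosetElt_inc i j k

theorem isGeometry (h : IsHypertopeFamily r Hi) : (cosetSystem Hi).IsGeometry := by
  refine ⟨cosetSystem_isSystem, fun F hF => ?_⟩
  obtain ⟨k, hk⟩ := h.exists_of_isFlag hF
  exact ⟨_, h.isChamber_iff.2 ⟨k, rfl⟩, fun x hx => ⟨x.1, (hk x hx).symm⟩⟩

theorem mem_residueSet_iff (h : IsHypertopeFamily r Hi) {F : Set (cosetSystem Hi).X} {k : H}
    (hk : ∀ x ∈ F, x = cosetElt Hi x.1 k) {x : (cosetSystem Hi).X} :
    x ∈ (cosetSystem Hi).residueSet F ↔ x.1 ∉ (cosetSystem Hi).t '' F ∧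
      ∃ m ∈ Subgroup.closure (r '' ((cosetSystem Hi).t '' F)ᶜ),
        x = cosetElt Hi x.1 (m * k) := by
  have hsys := cosetSystem_isSystem (Hi := Hi)
  constructor
  · rintro ⟨hxF, hx⟩
    have hflag : (cosetSystem Hi).IsFlag (insert x F) := by
      rintro y (rfl | hy) z (rfl | hz)
      · exact hsys.1 _
      · exact hx z hz
      · exact hsys.2.1 _ _ (hx y hy)
      · rw [hk y hy, hk z hz]
        exact cosetElt_inc _ _ k
    obtain ⟨k', hk'⟩ := h.exists_of_isFlag hflag
    refine ⟨?_, k' * k⁻¹, h.inter _ _ ?_, ?_⟩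
    · rintro ⟨y, hy, hyx⟩
      have := hsys.2.2 x y (hx y hy) hyx.symm
      exact hxF (this ▸ hy)
    · rintro _ ⟨y, hy, rfl⟩
      rw [← cosetElt_eq_iff]
      exact (hk' y (Or.inr hy)).symm.trans (hk y hy)
    · rw [inv_mul_cancel_right]
      exact hk' x (Or.inl rfl)
  · rintro ⟨hx, m, hm, hxm⟩
    refine ⟨fun hxF => hx ⟨x, hxF, rfl⟩, fun y hy => ?_⟩
    have hmy : cosetElt Hi y.1 (m * k) = cosetElt Hi y.1 k := by
      rw [cosetElt_eq_iff, mul_inv_cancel_right]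
      have hyt : y.1 ∈ (cosetSystem Hi).t '' F := ⟨y, hy, rfl⟩
      exact h.closure_le hyt hm
    rw [hxm, hk y hy]
    have := cosetElt_inc (Hi := Hi) x.1 y.1 (m * k)
    rw [hmy] at this
    exact this

theorem eq_of_mem_closure_singleton (h : IsHypertopeFamily r Hi) {i : I} {m : H}
    (hm : m ∈ Subgroup.closure (r '' {i})) : m = 1 ∨ m = r i := by
  induction hm using Subgroup.closure_induction with
  | mem x hx =>
    obtain ⟨j, rfl, rfl⟩ := hx
    exact Or.inr rfl
  | one => exact Or.inl rfl
  | mul x y _ _ hx hy =>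
    rcases hx with rfl | rfl <;> rcases hy with rfl | rfl <;> simp [h.sq]
  | inv x _ hx =>
    rcases hx with rfl | rfl
    · simp
    · exact Or.inr (inv_eq_of_mul_eq_one_left (h.sq i))

theorem residueSet_eq (h : IsHypertopeFamily r Hi) {F : Set (cosetSystem Hi).X} {k : H} {i : I}
    (hk : ∀ x ∈ F, x = cosetElt Hi x.1 k) (hi : ((cosetSystem Hi).t '' F)ᶜ = {i}) :
    (cosetSystem Hi).residueSet F = {cosetElt Hi i k, cosetElt Hi i (r i * k)} := by
  ext x
  rw [h.mem_residueSet_iff hk, hi, ← Set.mem_compl_iff, hi]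
  constructor
  · rintro ⟨hx, m, hm, hxm⟩
    have hx' : x.1 = i := hx
    rw [hx'] at hxm
    rcases h.eq_of_mem_closure_singleton hm with rfl | rfl
    · left
      rw [hxm, one_mul]
    · exact Or.inr hxm
  · rintro (rfl | rfl)
    · exact ⟨rfl, 1, one_mem _, by rw [one_mul]; rfl⟩
    · exact ⟨rfl, r i, Subgroup.subset_closure ⟨i, rfl, rfl⟩, rfl⟩

theorem isThin (h : IsHypertopeFamily r Hi) : (cosetSystem Hi).IsThin := by
  intro F hF hc
  obtain ⟨k, hk⟩ := h.exists_of_isFlag hF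
  rw [← Set.compl_eq_univ_sdiff, Set.ncard_eq_one] at hc
  obtain ⟨i, hi⟩ := hc
  rw [h.residueSet_eq hk hi]
  exact Set.ncard_pair (h.cosetElt_gen_mul_self_ne i k).symm

theorem connOn_residueSet (h : IsHypertopeFamily r Hi) {F : Set (cosetSystem Hi).X}
    (hF : (cosetSystem Hi).IsFlag F)
    (hc : 2 ≤ (Set.univ \ (cosetSystem Hi).t '' F).ncard) :
    (cosetSystem Hi).ConnOn ((cosetSystem Hi).residueSet F) := by
  have hsys := cosetSystem_isSystem (Hi := Hi)
  rw [← Set.compl_eq_univ_sdiff] at hc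
  intro x hx y hy
  obtain ⟨k₀, hk₀⟩ := h.exists_of_isFlag hF
  obtain ⟨hxt, mx, hmx, hxm⟩ := (h.mem_residueSet_iff hk₀).1 hx
  have hk : ∀ z ∈ F, z = cosetElt Hi z.1 (mx * k₀) := by
    intro z hz
    have hzt : z.1 ∈ (cosetSystem Hi).t '' F := ⟨z, hz, rfl⟩
    have hz' : cosetElt Hi z.1 (mx * k₀) = cosetElt Hi z.1 k₀ := by
      rw [cosetElt_eq_iff, mul_inv_cancel_right]
      exact h.closure_le hzt hmx
    rw [hz']
    exact hk₀ z hz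
  generalize mx * k₀ = k at hxm hk
  obtain ⟨hyt, m, hm, hym⟩ := (h.mem_residueSet_iff hk).1 hy
  set J := (cosetSystem Hi).t '' F with hJ
  have hmem : ∀ i ∉ J, ∀ m ∈ Subgroup.closure (r '' Jᶜ),
      cosetElt Hi i (m * k) ∈ (cosetSystem Hi).residueSet F := fun i hi m hm =>
    (h.mem_residueSet_iff hk).2 ⟨hi, m, hm, rfl⟩
  have key : ∀ m ∈ Subgroup.closure (r '' Jᶜ), ∀ i ∉ J, Relation.ReflTransGen
      (fun a b => a ∈ (cosetSystem Hi).residueSet F ∧ b ∈ (cosetSystem Hi).residueSet F ∧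
        (cosetSystem Hi).inc a b) x (cosetElt Hi i (m * k)) := by
    intro m hm
    have hstep : ∀ l ∉ J, ∀ m ∈ Subgroup.closure (r '' Jᶜ),
        (∀ i ∉ J, Relation.ReflTransGen
          (fun a b => a ∈ (cosetSystem Hi).residueSet F ∧
            b ∈ (cosetSystem Hi).residueSet F ∧
            (cosetSystem Hi).inc a b) x (cosetElt Hi i (m * k))) →
        ∀ i ∉ J, Relation.ReflTransGen
          (fun a b => a ∈ (cosetSystem Hi).residueSet F ∧
            b ∈ (cosetSystem Hi).residueSet F ∧
            (cosetSystem Hi).inc a b) x (cosetElt Hi i (r l * m * k)) := by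
      intro l hl m hm ih i hi
      obtain ⟨j, hj, hjl⟩ := Set.exists_ne_of_one_lt_ncard hc l
      have hlm : r l * m ∈ Subgroup.closure (r '' Jᶜ) :=
        mul_mem (Subgroup.subset_closure ⟨l, hl, rfl⟩) hm
      have h1 := ih j hj
      rw [← h.cosetElt_gen_mul (Ne.symm hjl), ← mul_assoc] at h1
      exact h1.tail ⟨hmem j hj _ hlm, hmem i hi _ hlm, cosetElt_inc j i _⟩
    induction hm using Subgroup.closure_induction_left with
    | one =>
      intro i hi
      refine .single ⟨hx, hmem i hi 1 (one_mem _), ?_⟩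
      rw [hxm, one_mul]
      exact cosetElt_inc _ _ k
    | mul_left a ha m hm ih =>
      obtain ⟨l, hl, rfl⟩ := ha
      exact hstep l hl m hm ih
    | inv_mul_cancel a ha m hm ih =>
      obtain ⟨l, hl, rfl⟩ := ha
      rw [inv_eq_of_mul_eq_one_left (h.sq l)]
      exact hstep l hl m hm ih
  rw [hym]
  exact key m hm _ hyt

theorem isResiduallyConnected (h : IsHypertopeFamily r Hi)
    (hI : 2 ≤ (Set.univ : Set I).ncard) : (cosetSystem Hi).IsResiduallyConnected := by
  refine ⟨?_, fun F hF hc => h.connOn_residueSet hF hc⟩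
  have h1 := h.connOn_residueSet (F := ∅) (fun x hx => hx.elim) (by simpa using hI)
  have h2 : (cosetSystem Hi).residueSet ∅ = Set.univ :=
    Set.eq_univ_of_forall fun x => ⟨fun hx => hx, fun y hy => hy.elim⟩
  rwa [h2] at h1

theorem chamberTransitive (h : IsHypertopeFamily r Hi) :
    (cosetSystem Hi).ChamberTransitive := by
  intro C D hC hD
  obtain ⟨k, rfl⟩ := h.isChamber_iff.1 hC
  obtain ⟨m, rfl⟩ := h.isChamber_iff.1 hD
  refine ⟨_, cosetPerm_mem (k⁻¹ * m), ?_⟩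
  rw [← Set.range_comp]
  congr 1
  ext1 i
  change cosetMul Hi _ (cosetElt Hi i k) = _
  rw [cosetMul_cosetElt, mul_inv_cancel_left]

theorem isRegularHypertope (h : IsHypertopeFamily r Hi)
    (hI : 2 ≤ (Set.univ : Set I).ncard) : (cosetSystem Hi).IsRegularHypertope :=
  ⟨⟨h.isGeometry, h.isThin, h.isResiduallyConnected hI⟩, h.chamberTransitive⟩

theorem existsUnique_of_mem_typeAut (h : IsHypertopeFamily r Hi)
    {α : Equiv.Perm (cosetSystem Hi).X} (hα : α ∈ (cosetSystem Hi).typeAut) :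
    ∃! g, ⇑α = cosetMul Hi g := by
  obtain ⟨hαt, hαi⟩ := hα
  have hαt' : ∀ i k, (α (cosetElt Hi i k)).1 = i := fun i k => hαt _
  obtain ⟨g, hg⟩ := h.exists_of_isFlag (F := Set.range fun i => α (cosetElt Hi i 1)) (by
    rintro _ ⟨i, rfl⟩ _ ⟨j, rfl⟩
    exact (hαi _ _).2 (cosetElt_inc i j 1))
  have key : ∀ k i, α (cosetElt Hi i k) = cosetElt Hi i (k * g) := by
    intro k
    have hk : k ∈ Subgroup.closure (Set.range r) := by
      rw [h.closure_eq]
      trivial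
    have hstep : ∀ l k, (∀ i, α (cosetElt Hi i k) = cosetElt Hi i (k * g)) →
        ∀ i, α (cosetElt Hi i (r l * k)) = cosetElt Hi i (r l * k * g) := by
      intro l k ih i
      rw [mul_assoc]
      by_cases hil : l = i
      · subst hil
        have h1 : α (cosetElt Hi l (r l * k)) ∈ (cosetSystem Hi).residueSet
            ((fun i => cosetElt Hi i (k * g)) '' {l}ᶜ) := by
          constructor
          · rintro ⟨i, hi, he⟩
            apply hi
            have := congrArg Sigma.fst he
            rw [hαt'] at this
            exact this
          · rintro _ ⟨i, hi, rfl⟩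
            simp only
            rw [← ih, hαi, ← h.cosetElt_gen_mul (Ne.symm hi)]
            exact cosetElt_inc _ _ _
        rw [h.residueSet_eq (k := k * g) (i := l)] at h1
        · rcases h1 with h1 | h1
          · rw [← ih, α.injective.eq_iff] at h1
            exact absurd h1 (h.cosetElt_gen_mul_self_ne l k)
          · exact h1
        · rintro _ ⟨i, hi, rfl⟩
          rfl
        · rw [← Set.image_comp]
          change (id '' {l}ᶜ)ᶜ = _
          simp
      · rw [h.cosetElt_gen_mul hil, h.cosetElt_gen_mul hil, ih]
    induction hk using Subgroup.closure_induction_left with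
    | one =>
      intro i
      have := hg _ ⟨i, rfl⟩
      simp only at this
      rw [hαt'] at this
      rw [this, one_mul]
    | mul_left a ha m hm ih =>
      obtain ⟨l, rfl⟩ := ha
      exact hstep l m ih
    | inv_mul_cancel a ha m hm ih =>
      obtain ⟨l, rfl⟩ := ha
      rw [inv_eq_of_mul_eq_one_left (h.sq l)]
      exact hstep l m ih
  refine ⟨g, ?_, fun g' hg' => ?_⟩
  · funext x
    obtain ⟨k, hk⟩ := exists_cosetElt x
    rw [hk, key, cosetMul_cosetElt]
  · apply h.eq_of_forall
    intro i
    have h1 := key 1 i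
    rw [hg', cosetMul_cosetElt, one_mul, one_mul] at h1
    exact h1

end IsHypertopeFamily

end Coset

/-! ### Adjacency in terms of faces -/

namespace IsPolytope

variable {P : Type*} [PartialOrder P] {rk : P → ℤ} {n : ℕ}

theorem exists_flag_of_le {x y : P} (hxy : x ≤ y) : ∃ Φ : PolyFlag P, x ∈ Φ.1 ∧ y ∈ Φ.1 := by
  obtain ⟨Φ, hΦ⟩ := exists_polyFlag {x, y} (by
    rintro a (rfl | rfl) b (rfl | rfl)
    · exact Or.inl le_rfl
    · exact Or.inl hxy
    · exact Or.inr hxy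
    · exact Or.inl le_rfl)
  exact ⟨Φ, hΦ (Or.inl rfl), hΦ (Or.inr rfl)⟩

theorem mem_of_face_eq (h : IsPolytope P rk n) {Φ Ψ : PolyFlag P} {x : P} (hx : x ∈ Φ.1)
    (hf : ∀ j : Fin n, rk x = (j : ℕ) → h.face Φ j = h.face Ψ j) : x ∈ Ψ.1 := by
  rw [h.mem_flag_iff]
  rcases (h.mem_flag_iff Φ x).1 hx with h1 | h1 | ⟨j, rfl⟩
  · exact Or.inl h1
  · exact Or.inr (Or.inl h1)
  · exact Or.inr (Or.inr ⟨j, (hf j (h.rk_face Φ j)).symm⟩)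

theorem face_adj_eq_of_ne (h : IsPolytope P rk n) {i : Fin n} {Φ Ψ : PolyFlag P}
    (hf : ∀ j : Fin n, j ≠ i → h.face Φ j = h.face Ψ j ∨ (j : ℕ) + 1 < i ∨ (i : ℕ) + 1 < j)
    (hne : h.face Ψ i ≠ h.face Φ i) : h.face (h.adj i Φ) i = h.face Ψ i := by
  refine h.face_eq_of_ne_of_ne (fun x hx hr => h.mem_adj hx ?_)
    (fun x hx hr => h.mem_of_face_eq hx fun j hj => ?_) (h.face_adj_self_ne i Φ) hne
  · omega
  · have hji : j ≠ i := by
      rintro rfl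
      omega
    rcases hf j hji with h1 | h1
    · exact h1
    · omega

theorem exists_iterate_adj (h : IsPolytope P rk n) {i j : Fin n} {p : ℕ} (hp : 0 < p)
    {Φ Ψ : PolyFlag P} (hper : (h.adj j ∘ h.adj i)^[p] Φ = Φ)
    (hf : ∀ k, k ≠ i → k ≠ j → h.face Φ k = h.face Ψ k) :
    ∃ m < p, Ψ = (h.adj j ∘ h.adj i)^[m] Φ ∨ Ψ = h.adj i ((h.adj j ∘ h.adj i)^[m] Φ) := by
  have hmod : ∀ m, (h.adj j ∘ h.adj i)^[m % p] Φ = (h.adj j ∘ h.adj i)^[m] Φ := fun m =>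
    Function.IsPeriodicPt.iterate_mod_apply hper m
  refine h.flag_induction (Φ := Φ) (Ψ := Ψ)
    (p := fun Ψ => ∃ m < p, Ψ = (h.adj j ∘ h.adj i)^[m] Φ ∨
      Ψ = h.adj i ((h.adj j ∘ h.adj i)^[m] Φ)) ⟨0, hp, Or.inl rfl⟩ ?_
  rintro Θ l hl ⟨m, hm, hΘ⟩
  by_cases hli : l = i
  · subst hli
    rcases hΘ with rfl | rfl
    · exact ⟨m, hm, Or.inr rfl⟩
    · exact ⟨m, hm, Or.inl (h.adj_adj _ _)⟩
  · by_cases hlj : l = j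
    · subst hlj
      rcases hΘ with rfl | rfl
      · refine ⟨(m + (p - 1)) % p, Nat.mod_lt _ hp, Or.inr ?_⟩
        rw [hmod]
        have h2 : (h.adj l ∘ h.adj i)^[m] Φ =
            (h.adj l ∘ h.adj i) ((h.adj l ∘ h.adj i)^[m + (p - 1)] Φ) := by
          rw [← Function.iterate_succ_apply' (h.adj l ∘ h.adj i), ← hmod (m + (p - 1) + 1),
            show m + (p - 1) + 1 = m + p by omega, Nat.add_mod_right, hmod]
        rw [h2, Function.comp_apply, h.adj_adj]
      · refine ⟨(m + 1) % p, Nat.mod_lt _ hp, Or.inl ?_⟩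
        rw [hmod, Function.iterate_succ_apply']
        rfl
    · exact absurd (hf l hli hlj) hl

theorem iterate_adj_flagMap (h : IsPolytope P rk n) (i j : Fin n) (g : ↥(orderAut P)) (m : ℕ)
    (Φ : PolyFlag P) :
    (h.adj j ∘ h.adj i)^[m] (flagMap g Φ) = flagMap g ((h.adj j ∘ h.adj i)^[m] Φ) := by
  have hs : Function.Semiconj (flagMap g) (h.adj j ∘ h.adj i) (h.adj j ∘ h.adj i) := by
    intro Ψ
    simp [h.adj_flagMap]
  exact ((hs.iterate_right m).eq Φ).symm

theorem iterate_adj_injective (h : IsPolytope P rk n) (i j : Fin n) (m : ℕ) :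
    Function.Injective (h.adj j ∘ h.adj i)^[m] := by
  refine Function.Injective.iterate ?_ m
  exact (Function.LeftInverse.injective (h.adj_adj j)).comp
    (Function.LeftInverse.injective (h.adj_adj i))

theorem face_iterate_adj (h : IsPolytope P rk n) {i j k : Fin n} (hi : k ≠ i) (hj : k ≠ j)
    (m : ℕ) (Φ : PolyFlag P) : h.face ((h.adj j ∘ h.adj i)^[m] Φ) k = h.face Φ k := by
  induction m with
  | zero => rfl
  | succ m ih =>
    rw [Function.iterate_succ_apply', Function.comp_apply, h.face_adj_of_ne hj,
      h.face_adj_of_ne hi, ih]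

end IsPolytope

/-! ### The dodecahedron -/

/-- The polyhedron with group of order `120` and type `{5, 3}`, described by its flags. -/
structure IsDodecahedron {K : Type*} [PartialOrder K] {rk : K → ℤ} (h : IsPolytope K rk 3) :
    Prop where
  regular : IsRegularPolytope K
  iterate_zero_one : ∀ Ψ m, (h.adj 1 ∘ h.adj 0)^[m] Ψ = Ψ ↔ 5 ∣ m
  iterate_one_two : ∀ Ψ m, (h.adj 2 ∘ h.adj 1)^[m] Ψ = Ψ ↔ 3 ∣ m
  card_flag : Nat.card (PolyFlag K) = 120

namespace IsDodecahedron

variable {K : Type*} [PartialOrder K] {rk : K → ℤ} {h : IsPolytope K rk 3}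

theorem iterate_eq_of_modEq (hD : IsDodecahedron h) {a b : ℕ} (hab : a ≡ b [MOD 5])
    (Φ : PolyFlag K) : (h.adj 1 ∘ h.adj 0)^[a] Φ = (h.adj 1 ∘ h.adj 0)^[b] Φ := by
  have hp : Function.IsPeriodicPt (h.adj 1 ∘ h.adj 0) 5 Φ := (hD.iterate_zero_one Φ 5).2 dvd_rfl
  rw [← hp.iterate_mod_apply a, ← hp.iterate_mod_apply b, hab]

theorem modEq_of_iterate_eq (hD : IsDodecahedron h) {a b : ℕ} {Φ : PolyFlag K}
    (hab : (h.adj 1 ∘ h.adj 0)^[a] Φ = (h.adj 1 ∘ h.adj 0)^[b] Φ) : a ≡ b [MOD 5] := by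
  wlog hle : a ≤ b generalizing a b
  · exact (this hab.symm (by omega)).symm
  obtain ⟨c, rfl⟩ := Nat.exists_eq_add_of_le hle
  rw [Function.iterate_add_apply] at hab
  have := (hD.iterate_zero_one Φ c).1 (h.iterate_adj_injective 0 1 a hab).symm
  exact (Nat.modEq_iff_dvd' hle).2 (by simpa using this)

theorem adj_zero_ne_iterate (hD : IsDodecahedron h) (Φ : PolyFlag K) (a : ℕ) :
    h.adj 0 Φ ≠ (h.adj 1 ∘ h.adj 0)^[a] Φ := by
  intro he
  obtain ⟨g, hg⟩ := IsPolytope.exists_flagMap hD.regular Φ ((h.adj 1 ∘ h.adj 0)^[a] Φ)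
  have h1 : (h.adj 1 ∘ h.adj 0)^[a + a] Φ = Φ := by
    rw [Function.iterate_add_apply, ← hg, h.iterate_adj_flagMap, ← he, ← h.adj_flagMap, hg,
      ← he, h.adj_adj]
  have h2 := (hD.iterate_zero_one Φ _).1 h1
  have h3 := (hD.iterate_zero_one Φ a).2 (by omega)
  exact h.adj_ne 0 Φ (he.trans h3)

/-- The flags containing the same facet as a given flag. -/
theorem card_flags_facet (hD : IsDodecahedron h) (Φ : PolyFlag K) :
    Nat.card {Ψ : PolyFlag K // h.face Ψ 2 = h.face Φ 2} = 10 := by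
  let φ : Fin 5 × Bool → {Ψ : PolyFlag K // h.face Ψ 2 = h.face Φ 2} := fun q =>
    if q.2 then ⟨h.adj 0 ((h.adj 1 ∘ h.adj 0)^[(q.1 : ℕ)] Φ), by
      rw [h.face_adj_of_ne (by decide), h.face_iterate_adj (by decide) (by decide)]⟩
    else ⟨(h.adj 1 ∘ h.adj 0)^[(q.1 : ℕ)] Φ, h.face_iterate_adj (by decide) (by decide) _ _⟩
  have hfin : ∀ {a b : Fin 5}, (h.adj 1 ∘ h.adj 0)^[(a : ℕ)] Φ =
      (h.adj 1 ∘ h.adj 0)^[(b : ℕ)] Φ → a = b := by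
    intro a b hab
    exact Fin.ext (Nat.ModEq.eq_of_lt_of_lt (hD.modEq_of_iterate_eq hab) a.2 b.2)
  have hcross : ∀ a b : ℕ, h.adj 0 ((h.adj 1 ∘ h.adj 0)^[a] Φ) ≠
      (h.adj 1 ∘ h.adj 0)^[b] Φ := by
    intro a b he
    apply hD.adj_zero_ne_iterate ((h.adj 1 ∘ h.adj 0)^[a] Φ) (b + 4 * a)
    rw [he, ← Function.iterate_add_apply]
    apply hD.iterate_eq_of_modEq
    unfold Nat.ModEq
    omega
  have hφ : Function.Bijective φ := by
    constructor
    · rintro ⟨a, s⟩ ⟨b, t⟩ hab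
      have hab' := congrArg Subtype.val hab
      cases s <;> cases t <;> simp only [φ, if_true, Bool.false_eq_true, if_false] at hab'
      · rw [hfin hab']
      · exact absurd hab'.symm (hcross _ _)
      · exact absurd hab' (hcross _ _)
      · rw [hfin (Function.LeftInverse.injective (h.adj_adj 0) hab')]
    · rintro ⟨Ψ, hΨ⟩
      obtain ⟨m, hm, hΨm⟩ := h.exists_iterate_adj (i := 0) (j := 1) (p := 5) (Φ := Φ) (Ψ := Ψ)
        (by norm_num) ((hD.iterate_zero_one Φ 5).2 dvd_rfl) (by
          intro k hk0 hk1
          obtain rfl : k = 2 := by omega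
          exact hΨ.symm)
      rcases hΨm with e | e
      · exact ⟨(⟨m, hm⟩, false), Subtype.ext e.symm⟩
      · exact ⟨(⟨m, hm⟩, true), Subtype.ext e.symm⟩
  rw [← Nat.card_congr (Equiv.ofBijective φ hφ)]
  simp

/-- The facet of a flag, as a vertex of the dual. -/
def facet (h : IsPolytope K rk 3) (Φ : PolyFlag K) : polyVertices Kᵒᵈ (dualRk rk 3) :=
  ⟨OrderDual.toDual (h.face Φ 2), by
    have := h.rk_face Φ 2
    simp only [dualRk, OrderDual.ofDual_toDual, this]
    norm_num⟩

theorem rk_facet {K : Type*} {rk : K → ℤ} (f : polyVertices Kᵒᵈ (dualRk rk 3)) :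
    rk (OrderDual.ofDual f.1) = 2 := by
  have := f.2
  simp only [dualRk] at this
  push_cast at this
  omega

theorem exists_facet_eq (h : IsPolytope K rk 3) (f : polyVertices Kᵒᵈ (dualRk rk 3)) :
    ∃ Φ, facet h Φ = f := by
  obtain ⟨Φ, hΦ, -⟩ := IsPolytope.exists_flag_of_le (le_refl (OrderDual.ofDual f.1))
  exact ⟨Φ, Subtype.ext (h.face_eq hΦ (rk_facet f))⟩

theorem facet_eq_iff {Φ Ψ : PolyFlag K} : facet h Φ = facet h Ψ ↔ h.face Φ 2 = h.face Ψ 2 :=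
  Subtype.ext_iff

theorem card_facets (hD : IsDodecahedron h) :
    Nat.card (polyVertices Kᵒᵈ (dualRk rk 3)) = 12 := by
  have hfin : Finite (PolyFlag K) := Nat.finite_of_card_ne_zero (by rw [hD.card_flag]; norm_num)
  have : Finite (polyVertices Kᵒᵈ (dualRk rk 3)) :=
    Finite.of_surjective (facet h) (exists_facet_eq h)
  have h1 := Nat.card_congr (Equiv.sigmaFiberEquiv (facet h))
  have := Fintype.ofFinite (polyVertices Kᵒᵈ (dualRk rk 3))
  rw [hD.card_flag, Nat.card_sigma] at h1
  have h2 : ∀ f, Nat.card {Ψ // facet h Ψ = f} = 10 := by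
    intro f
    obtain ⟨Φ, rfl⟩ := exists_facet_eq h f
    rw [← hD.card_flags_facet Φ]
    simp_rw [facet_eq_iff]
  simp_rw [h2] at h1
  rw [Finset.sum_const, smul_eq_mul, Finset.card_univ] at h1
  rw [Nat.card_eq_fintype_card]
  omega

theorem face_adj_two_adj_zero (Φ : PolyFlag K) :
    h.face (h.adj 2 (h.adj 0 Φ)) 2 = h.face (h.adj 2 Φ) 2 := by
  rw [← h.adj_comm (i := 0) (j := 2) (by decide), h.face_adj_of_ne (by decide)]

/-- If an edge lies on the facet of `Φ` and on another facet `g`, then `g` is obtained by the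
adjacency of rank two. -/
theorem face_adj_two_eq {Φ : PolyFlag K} {g : K} (hg : rk g = 2) (hle : h.face Φ 1 ≤ g)
    (hne : g ≠ h.face Φ 2) : h.face (h.adj 2 Φ) 2 = g := by
  obtain ⟨Ψ, h1, h2⟩ := IsPolytope.exists_flag_of_le hle
  have hΨ : h.face Ψ 2 = g := h.face_eq h2 hg
  rw [← hΨ]
  apply h.face_adj_eq_of_ne
  · intro j hj
    fin_cases j
    · exact Or.inr (Or.inl (by decide))
    · exact Or.inl (h.face_eq h1 (h.rk_face Φ 1)).symm
    · exact absurd rfl hj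
  · rw [hΨ]
    exact hne

theorem edge_unique (hD : IsDodecahedron h) {Φ Φ' : PolyFlag K}
    (hf : h.face Φ 2 = h.face Φ' 2)
    (hg : h.face (h.adj 2 Φ) 2 = h.face (h.adj 2 Φ') 2) : h.face Φ 1 = h.face Φ' 1 := by
  by_contra hne
  -- the flag may be chosen as a rotation of the first one
  obtain ⟨j, hj, hgj⟩ : ∃ j, ¬ 5 ∣ j ∧
      h.face (h.adj 2 ((h.adj 1 ∘ h.adj 0)^[j] Φ)) 2 = h.face (h.adj 2 Φ) 2 := by
    obtain ⟨j, -, hj⟩ := h.exists_iterate_adj (i := 0) (j := 1) (p := 5) (Φ := Φ) (Ψ := Φ')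
        (by norm_num) ((hD.iterate_zero_one Φ 5).2 dvd_rfl) (by
          intro k hk0 hk1
          obtain rfl : k = 2 := by omega
          exact hf)
    refine ⟨j, fun h5 => hne ?_, ?_⟩
    · rw [(hD.iterate_zero_one Φ j).2 h5] at hj
      rcases hj with rfl | rfl
      · rfl
      · rw [h.face_adj_of_ne (by decide)]
    · rw [hg]
      rcases hj with rfl | rfl
      · rfl
      · rw [face_adj_two_adj_zero]
  obtain ⟨σ, hσ⟩ := IsPolytope.exists_flagMap hD.regular Φ ((h.adj 1 ∘ h.adj 0)^[j] Φ)
  have hσg : σ.1 (h.face (h.adj 2 Φ) 2) = h.face (h.adj 2 Φ) 2 := by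
    rw [← h.face_flagMap, ← h.adj_flagMap, hσ, hgj]
  have hmul : ∀ m, h.face (h.adj 2 ((h.adj 1 ∘ h.adj 0)^[m * j] Φ)) 2 =
      h.face (h.adj 2 Φ) 2 := by
    intro m
    induction m with
    | zero => simp
    | succ m ih =>
      rw [Nat.succ_mul, Function.iterate_add_apply, ← hσ, h.iterate_adj_flagMap, h.adj_flagMap,
        h.face_flagMap, ih, hσg]
  have hall : ∀ k, h.face (h.adj 2 ((h.adj 1 ∘ h.adj 0)^[k] Φ)) 2 = h.face (h.adj 2 Φ) 2 := by
    intro k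
    have : ∃ m, m * j ≡ k [MOD 5] := by
      have hcop : Nat.Coprime j 5 := ((Nat.Prime.coprime_iff_not_dvd Nat.prime_five).2 hj).symm
      obtain ⟨m, hm⟩ := Nat.exists_mul_mod_eq_one_of_coprime hcop (by norm_num)
      refine ⟨m * k, ?_⟩
      have h1 : j * m ≡ 1 [MOD 5] := hm.2
      calc m * k * j = j * m * k := by ring
        _ ≡ 1 * k [MOD 5] := h1.mul_right k
        _ = k := one_mul k
    obtain ⟨m, hm⟩ := this
    rw [← hD.iterate_eq_of_modEq hm, hmul]
  have hf1 : ∀ Ψ : PolyFlag K, h.face Ψ 2 = h.face Φ 2 →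
      h.face (h.adj 2 Ψ) 2 = h.face (h.adj 2 Φ) 2 := by
    intro Ψ hΨ
    obtain ⟨k, -, hk⟩ := h.exists_iterate_adj (i := 0) (j := 1) (p := 5) (Φ := Φ) (Ψ := Ψ)
        (by norm_num) ((hD.iterate_zero_one Φ 5).2 dvd_rfl) (by
          intro k hk0 hk1
          obtain rfl : k = 2 := by omega
          exact hΨ.symm)
    rcases hk with rfl | rfl
    · exact hall k
    · rw [face_adj_two_adj_zero, hall k]
  have hf2 : ∀ Ψ : PolyFlag K, h.face Ψ 2 = h.face (h.adj 2 Φ) 2 →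
      h.face (h.adj 2 Ψ) 2 = h.face Φ 2 := by
    intro Ψ hΨ
    obtain ⟨τ, hτ⟩ := IsPolytope.exists_flagMap hD.regular (h.adj 2 Φ) Φ
    have h1 : h.face (flagMap τ Ψ) 2 = h.face Φ 2 := by
      rw [h.face_flagMap, hΨ, ← h.face_flagMap, hτ]
    have h2 := hf1 _ h1
    rw [h.adj_flagMap, h.face_flagMap, ← hτ, h.adj_flagMap, h.face_flagMap, h.adj_adj] at h2
    exact τ.1.injective h2
  have htwo : ∀ Ψ : PolyFlag K, h.face Ψ 2 = h.face Φ 2 ∨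
      h.face Ψ 2 = h.face (h.adj 2 Φ) 2 := by
    intro Ψ
    refine h.flag_induction (Φ := Φ) (Ψ := Ψ)
      (p := fun Ψ => h.face Ψ 2 = h.face Φ 2 ∨ h.face Ψ 2 = h.face (h.adj 2 Φ) 2)
      (Or.inl rfl) ?_
    intro Θ i _ hΘ
    by_cases hi : i = 2
    · subst hi
      rcases hΘ with h1 | h1
      · exact Or.inr (hf1 Θ h1)
      · exact Or.inl (hf2 Θ h1)
    · rw [h.face_adj_of_ne (Ne.symm hi)]
      exact hΘ
  have hcard : Set.ncard (Set.univ : Set (polyVertices Kᵒᵈ (dualRk rk 3))) ≤ 2 := by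
    refine le_trans (Set.ncard_le_ncard (t := {facet h Φ, facet h (h.adj 2 Φ)}) ?_
      (Set.toFinite _)) (Set.ncard_insert_le _ _ |>.trans (by simp))
    intro f _
    obtain ⟨Ψ, rfl⟩ := exists_facet_eq h f
    rcases htwo Ψ with h1 | h1
    · exact Or.inl (facet_eq_iff.2 h1)
    · exact Or.inr (facet_eq_iff.2 h1)
  rw [Set.ncard_univ, hD.card_facets] at hcard
  norm_num at hcard

theorem edge_eq_of_le (hD : IsDodecahedron h) {e e' f g : K} (he : rk e = 1) (he' : rk e' = 1)
    (hf : rk f = 2) (hg : rk g = 2) (hfg : g ≠ f) (h1 : e ≤ f) (h2 : e ≤ g) (h3 : e' ≤ f)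
    (h4 : e' ≤ g) : e = e' := by
  obtain ⟨Φ, hΦe, hΦf⟩ := IsPolytope.exists_flag_of_le h1
  obtain ⟨Ψ, hΨe, hΨf⟩ := IsPolytope.exists_flag_of_le h3
  have a1 : h.face Φ 1 = e := h.face_eq hΦe he
  have a2 : h.face Φ 2 = f := h.face_eq hΦf hf
  have b1 : h.face Ψ 1 = e' := h.face_eq hΨe he'
  have b2 : h.face Ψ 2 = f := h.face_eq hΨf hf
  rw [← a1, ← b1]
  apply hD.edge_unique (a2.trans b2.symm)
  rw [face_adj_two_eq hg (a1 ▸ h2) (a2 ▸ hfg), face_adj_two_eq hg (b1 ▸ h4) (b2 ▸ hfg)]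

theorem braid (hD : IsDodecahedron h) (Φ : PolyFlag K) :
    h.adj 2 (h.adj 1 (h.adj 2 Φ)) = h.adj 1 (h.adj 2 (h.adj 1 Φ)) := by
  have h1 := (hD.iterate_one_two (h.adj 1 (h.adj 2 Φ)) 3).2 dvd_rfl
  simp only [Function.iterate_succ, Function.iterate_zero, Function.comp_apply, id,
    h.adj_adj] at h1
  rw [← h1, h.adj_adj]

/-- The facets containing the vertex of a flag. -/
theorem facet_at_vertex (hD : IsDodecahedron h) (Φ : PolyFlag K) {f : K} (hf : rk f = 2)
    (hle : h.face Φ 0 ≤ f) :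
    f = h.face Φ 2 ∨ f = h.face (h.adj 2 Φ) 2 ∨ f = h.face (h.adj 2 (h.adj 1 Φ)) 2 := by
  obtain ⟨Ψ, h1, h2⟩ := IsPolytope.exists_flag_of_le hle
  rw [← h.face_eq (i := 2) h2 hf]
  obtain ⟨m, hm, hΨ⟩ := h.exists_iterate_adj (i := 1) (j := 2) (p := 3) (Φ := Φ) (Ψ := Ψ)
    (by norm_num) ((hD.iterate_one_two Φ 3).2 dvd_rfl) (by
      intro k hk1 hk2
      obtain rfl : k = 0 := by omega
      exact (h.face_eq h1 (h.rk_face Φ 0)).symm)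
  have h3 : h.face Ψ 2 = h.face ((h.adj 2 ∘ h.adj 1)^[m] Φ) 2 := by
    rcases hΨ with rfl | rfl
    · rfl
    · rw [h.face_adj_of_ne (by decide)]
  rw [h3]
  interval_cases m
  · exact Or.inl rfl
  · exact Or.inr (Or.inr rfl)
  · refine Or.inr (Or.inl ?_)
    simp only [Function.iterate_succ, Function.iterate_zero, Function.comp_apply, id]
    rw [← hD.braid, h.adj_adj, h.face_adj_of_ne (by decide)]

/-- A face bounded by all facets through an edge is bounded by that edge. -/
theorem le_edge (hD : IsDodecahedron h) {a b : K} (ha : rk a = 1)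
    (hab : ∀ f, rk f = 2 → a ≤ f → b ≤ f) : b ≤ a := by
  obtain ⟨Φ, hΦ, -⟩ := IsPolytope.exists_flag_of_le (le_refl a)
  have hΦa : h.face Φ 1 = a := h.face_eq hΦ ha
  have hle : ∀ Θ : PolyFlag K, h.face Θ 1 ≤ h.face Θ 2 := fun Θ =>
    (h.face_lt_face Θ (by decide)).le
  have hne := h.face_adj_self_ne 2 Φ
  have hf : b ≤ h.face Φ 2 := hab _ (h.rk_face Φ 2) (hΦa ▸ hle Φ)
  have hg' : a ≤ h.face (h.adj 2 Φ) 2 := by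
    have := hle (h.adj 2 Φ)
    rwa [h.face_adj_of_ne (by decide), hΦa] at this
  have hg : b ≤ h.face (h.adj 2 Φ) 2 := hab _ (h.rk_face _ 2) hg'
  have hb1 := h.neg_one_le_rk b
  have hb2 : rk b < 2 := by
    rcases hf.lt_or_eq with hlt | heq
    · have := h.strictMono hlt
      rw [h.rk_face] at this
      exact this
    · rcases hg.lt_or_eq with hlt | heq'
      · have := h.strictMono hlt
        rw [h.rk_face] at this
        exact this
      · exact absurd (heq'.symm.trans heq) hne
  obtain hb | hb | hb : rk b = -1 ∨ rk b = 0 ∨ rk b = 1 := by omega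
  · exact h.isBot_iff.2 hb a
  · obtain ⟨Ψ, h1, h2⟩ := IsPolytope.exists_flag_of_le hf
    have hΨ0 : h.face Ψ 0 = b := h.face_eq h1 hb
    have hΨ2 : h.face Ψ 2 = h.face Φ 2 := h.face_eq h2 (h.rk_face Φ 2)
    have key : ∀ Θ : PolyFlag K, h.face Θ 0 = b → h.face Θ 2 = h.face Φ 2 →
        h.face (h.adj 2 Φ) 2 = h.face (h.adj 2 Θ) 2 → b ≤ a := by
      intro Θ hΘ0 hΘ2 hΘ
      rw [← hΘ0, ← hΦa, hD.edge_unique hΘ2.symm hΘ]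
      exact (h.face_lt_face Θ (by decide)).le
    rcases hD.facet_at_vertex Ψ (h.rk_face (h.adj 2 Φ) 2) (hΨ0 ▸ hg) with h3 | h3 | h3
    · exact absurd (h3.trans hΨ2) hne
    · exact key Ψ hΨ0 hΨ2 h3
    · refine key (h.adj 1 Ψ) ?_ ?_ h3
      · rw [h.face_adj_of_ne (by decide), hΨ0]
      · rw [h.face_adj_of_ne (by decide), hΨ2]
  · refine (hD.edge_eq_of_le ha hb (h.rk_face Φ 2) (h.rk_face (h.adj 2 Φ) 2) hne
      (hΦa ▸ hle Φ) hg' hf hg).ge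

/-- A face bounded by all facets through a vertex is bounded by that vertex. -/
theorem le_vertex (hD : IsDodecahedron h) {a b : K} (ha : rk a = 0)
    (hab : ∀ f, rk f = 2 → a ≤ f → b ≤ f) : b ≤ a := by
  obtain ⟨Φ, hΦ, -⟩ := IsPolytope.exists_flag_of_le (le_refl a)
  have hΦa : h.face Φ 0 = a := h.face_eq hΦ ha
  have hle : ∀ Θ : PolyFlag K, h.face Θ 0 ≤ h.face Θ 1 := fun Θ =>
    (h.face_lt_face Θ (by decide)).le
  have h1 : b ≤ h.face Φ 1 := hD.le_edge (h.rk_face Φ 1) fun f hf hle' =>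
    hab f hf (hΦa ▸ (hle Φ).trans hle')
  have ha2 : a ≤ h.face (h.adj 1 Φ) 1 := by
    have := hle (h.adj 1 Φ)
    rwa [h.face_adj_of_ne (by decide), hΦa] at this
  have h2 : b ≤ h.face (h.adj 1 Φ) 1 := hD.le_edge (h.rk_face _ 1) fun f hf hle' =>
    hab f hf (ha2.trans hle')
  have hne := h.face_adj_self_ne 1 Φ
  have hb1 := h.neg_one_le_rk b
  have hb2 : rk b < 1 := by
    rcases h1.lt_or_eq with hlt | heq
    · have := h.strictMono hlt
      rw [h.rk_face] at this
      exact this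
    · rcases h2.lt_or_eq with hlt | heq'
      · have := h.strictMono hlt
        rw [h.rk_face] at this
        exact this
      · exact absurd (heq'.symm.trans heq) hne
  obtain hb | hb : rk b = -1 ∨ rk b = 0 := by omega
  · exact h.isBot_iff.2 hb a
  · by_contra hba
    have hba' : b ≠ a := fun e => hba e.le
    have key : ∀ Θ : PolyFlag K, h.face Θ 0 = a → b ≤ h.face Θ 1 →
        h.face (h.adj 0 Θ) 0 = b := by
      intro Θ hΘ hbΘ
      obtain ⟨Ψ, g1, g2⟩ := IsPolytope.exists_flag_of_le hbΘ
      have hΨ : h.face Ψ 0 = b := h.face_eq g1 hb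
      rw [← hΨ]
      apply h.face_adj_eq_of_ne
      · intro j hj
        fin_cases j
        · exact absurd rfl hj
        · exact Or.inl (h.face_eq g2 (h.rk_face Θ 1)).symm
        · exact Or.inr (Or.inr (by decide))
      · rw [hΨ, hΘ]
        exact hba'
    have k1 := key Φ hΦa h1
    have k2 := key (h.adj 1 Φ) ((h.face_adj_of_ne (by decide) Φ).trans hΦa) h2
    -- the two flags at `b` are `1`-adjacent
    have k3 : h.adj 0 (h.adj 1 Φ) = h.adj 1 (h.adj 0 Φ) := by
      apply h.eq_adj
      · intro e
        have := congrArg (fun Θ => h.face Θ 1) e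
        simp only [h.face_adj_of_ne (show (1 : Fin 3) ≠ 0 by decide)] at this
        exact hne this
      · intro x hx hr
        refine h.mem_of_face_eq hx fun j hj => ?_
        fin_cases j
        · exact k1.trans k2.symm
        · exact absurd hj hr
        · change h.face (h.adj 0 Φ) 2 = h.face (h.adj 0 (h.adj 1 Φ)) 2
          rw [h.face_adj_of_ne (by decide), h.face_adj_of_ne (by decide),
            h.face_adj_of_ne (by decide)]
    have k4 : (h.adj 1 ∘ h.adj 0)^[2] Φ = Φ := by
      simp only [Function.iterate_succ, Function.iterate_zero, Function.comp_apply, id]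
      rw [← k3, h.adj_adj, h.adj_adj]
    have := (hD.iterate_zero_one Φ 2).1 k4
    norm_num at this

theorem le_of_facets (hD : IsDodecahedron h) {a b : K}
    (hab : ∀ f, rk f = 2 → a ≤ f → b ≤ f) : b ≤ a := by
  have h1 := h.neg_one_le_rk a
  have h2 := h.rk_le a
  obtain ha | ha | ha | ha | ha :
      rk a = -1 ∨ rk a = 0 ∨ rk a = 1 ∨ rk a = 2 ∨ rk a = 3 := by
    push_cast at h2
    omega
  · by_contra hba
    have hb : rk b ≠ -1 := fun e => hba (h.isBot_iff.2 e a)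
    obtain ⟨Φ, hΦ, -⟩ := IsPolytope.exists_flag_of_le (le_refl b)
    have hv : h.face Φ 0 ≤ b := by
      by_contra hlt
      have hlt' : b < h.face Φ 0 := by
        rcases Φ.le_or_le hΦ (h.face_mem Φ 0) with h3 | h3
        · exact lt_of_le_of_ne h3 fun e => hlt e.ge
        · exact absurd h3 hlt
      have := h.strictMono hlt'
      have h4 := h.neg_one_le_rk b
      rw [h.rk_face] at this
      simp only [Fin.val_zero, Nat.cast_zero] at this
      omega
    have hcard : Set.ncard (Set.univ : Set (polyVertices Kᵒᵈ (dualRk rk 3))) ≤ 3 := by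
      refine le_trans (Set.ncard_le_ncard
        (t := {facet h Φ, facet h (h.adj 2 Φ), facet h (h.adj 2 (h.adj 1 Φ))}) ?_
        (Set.toFinite _)) ?_
      · intro f _
        obtain ⟨Ψ, rfl⟩ := exists_facet_eq h f
        rcases hD.facet_at_vertex Φ (h.rk_face Ψ 2)
          (hv.trans (hab _ (h.rk_face Ψ 2) (h.isBot_iff.2 ha _))) with h3 | h3 | h3
        · exact Or.inl (facet_eq_iff.2 h3)
        · exact Or.inr (Or.inl (facet_eq_iff.2 h3))
        · exact Or.inr (Or.inr (facet_eq_iff.2 h3))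
      · refine (Set.ncard_insert_le _ _).trans (Nat.succ_le_succ ?_)
        exact (Set.ncard_insert_le _ _).trans (by simp)
    rw [Set.ncard_univ, hD.card_facets] at hcard
    norm_num at hcard
  · exact hD.le_vertex ha hab
  · exact hD.le_edge ha hab
  · exact hab a ha le_rfl
  · exact h.isTop_iff.2 (by rw [ha]; norm_num) b

theorem vertexDescribable (hD : IsDodecahedron h) :
    VertexDescribable Kᵒᵈ (dualRk rk 3) := by
  intro a b hab
  refine hD.le_of_facets (a := OrderDual.ofDual a) (b := OrderDual.ofDual b) fun f hf hle => ?_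
  exact hab ⟨OrderDual.toDual f, by simp [dualRk, hf]⟩ hle

end IsDodecahedron

/-! ### Parity of vectors -/

section Parity

variable {V : Type*} [Fintype V]

/-- The parity of the number of coordinates equal to `true`. -/
def parity (x : V → Bool) : ZMod 2 := ∑ v, if x v then 1 else 0

theorem parity_flipAt (v : V) (x : V → Bool) : parity (flipAt v x) = parity x + 1 := by
  classical
  unfold parity
  rw [← Finset.add_sum_erase _ (fun w => if flipAt v x w then (1 : ZMod 2) else 0)
      (Finset.mem_univ v),
    ← Finset.add_sum_erase _ (fun w => if x w then (1 : ZMod 2) else 0) (Finset.mem_univ v)]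
  have h1 : ∑ w ∈ Finset.univ.erase v, (if flipAt v x w then (1 : ZMod 2) else 0) =
      ∑ w ∈ Finset.univ.erase v, if x w then 1 else 0 := by
    refine Finset.sum_congr rfl fun w hw => ?_
    rw [flipAt_of_ne (Finset.ne_of_mem_erase hw)]
  rw [h1, flipAt_self]
  cases x v
  · simp only [Bool.not_false, if_true, Bool.false_eq_true, if_false]
    ring
  · simp only [Bool.not_true, if_true, Bool.false_eq_true, if_false]
    have : (1 : ZMod 2) + 1 = 0 := by decide
    linear_combination -this

theorem parity_flipAt_flipAt (v w : V) (x : V → Bool) :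
    parity (flipAt v (flipAt w x)) = parity x := by
  rw [parity_flipAt, parity_flipAt, add_assoc, show (1 : ZMod 2) + 1 = 0 by decide, add_zero]

theorem card_parity_eq [Nonempty V] (p : ZMod 2) :
    Nat.card {x : V → Bool // parity x = p} = 2 ^ (Fintype.card V - 1) := by
  classical
  obtain ⟨v⟩ := ‹Nonempty V›
  have h1 : Nat.card {x : V → Bool // parity x = p} =
      Nat.card {x : V → Bool // ¬ parity x = p} := by
    have hp : ∀ a : ZMod 2, a = p ↔ ¬ a + 1 = p := by
      revert p
      decide
    refine Nat.card_congr ((Function.Involutive.toPerm (flipAt v) (flipAt_flipAt v)).subtypeEquiv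
      fun x => ?_)
    change parity x = p ↔ ¬ parity (flipAt v x) = p
    rw [parity_flipAt, ← hp]
  have h2 := Nat.card_congr (Equiv.sumCompl fun x : V → Bool => parity x = p)
  rw [Nat.card_sum, ← h1, Nat.card_fun, Nat.card_eq_fintype_card (α := V),
    Nat.card_eq_fintype_card (α := Bool), Fintype.card_bool] at h2
  have h3 : 0 < Fintype.card V := Fintype.card_pos_iff.2 ⟨v⟩
  obtain ⟨m, hm⟩ := Nat.exists_eq_succ_of_ne_zero h3.ne'
  rw [hm, Nat.pow_succ] at h2
  rw [hm, Nat.succ_sub_one]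
  omega

theorem exists_ne_ne_of_parity_eq {x y : V → Bool} (hp : parity x = parity y) (hxy : x ≠ y) :
    ∃ v w, v ≠ w ∧ x v ≠ y v ∧ x w ≠ y w := by
  obtain ⟨v, hv⟩ := Function.ne_iff.1 hxy
  have h1 : flipAt v x ≠ y := by
    rintro rfl
    rw [parity_flipAt] at hp
    exact one_ne_zero (left_eq_add.1 hp)
  obtain ⟨w, hw⟩ := Function.ne_iff.1 h1
  have hvw : w ≠ v := by
    rintro rfl
    exact hw (flipAt_eq_of_ne hv)
  rw [flipAt_of_ne hvw] at hw
  exact ⟨v, w, hvw.symm, hv, hw⟩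

end Parity

/-! ### Chambers of the halved polytope -/

section Chambers

open IsDodecahedron

variable {K : Type*} [PartialOrder K] {rk : K → ℤ}

/-- Pairs of a vector indexed by the facets and a flag; they encode the flags of `D2`. -/
abbrev Chamber (K : Type*) [PartialOrder K] (rk : K → ℤ) : Type _ :=
  (polyVertices Kᵒᵈ (dualRk rk 3) → Bool) × PolyFlag K

/-- The vectors agree at all facets which do not contain the face `F`. -/
def AgreeOff (F : K) (x y : polyVertices Kᵒᵈ (dualRk rk 3) → Bool) : Prop :=
  ∀ f : polyVertices Kᵒᵈ (dualRk rk 3), ¬ F ≤ OrderDual.ofDual f.1 → x f = y f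

theorem AgreeOff.symm {F : K} {x y : polyVertices Kᵒᵈ (dualRk rk 3) → Bool}
    (hxy : AgreeOff F x y) : AgreeOff F y x := fun f hf => (hxy f hf).symm

theorem AgreeOff.trans {F : K} {x y z : polyVertices Kᵒᵈ (dualRk rk 3) → Bool}
    (hxy : AgreeOff F x y) (hyz : AgreeOff F y z) : AgreeOff F x z :=
  fun f hf => (hxy f hf).trans (hyz f hf)

theorem AgreeOff.mono {F G : K} (hFG : F ≤ G) {x y : polyVertices Kᵒᵈ (dualRk rk 3) → Bool}
    (hxy : AgreeOff G x y) : AgreeOff F x y := fun f hf => hxy f fun hG => hf (hFG.trans hG)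

theorem agreeOff_flipAt {F : K} {f : polyVertices Kᵒᵈ (dualRk rk 3)}
    (hf : F ≤ OrderDual.ofDual f.1) (x : polyVertices Kᵒᵈ (dualRk rk 3) → Bool) :
    AgreeOff F (flipAt f x) x := by
  intro g hg
  apply flipAt_of_ne
  rintro rfl
  exact hg hf

variable (h : IsPolytope K rk 3)

/-- The adjacency maps of the halved polytope. -/
def chamberMove (i : Fin 4) (c : Chamber K rk) : Chamber K rk :=
  match i with
  | 0 => (c.1, h.adj 0 c.2)
  | 1 => (c.1, h.adj 1 c.2)
  | 2 => (c.1, h.adj 2 c.2)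
  | 3 => (flipAt (facet h (h.adj 2 c.2)) (flipAt (facet h c.2) c.1), h.adj 2 c.2)

/-- Two chambers have the same element of type `i`. -/
def ChamberRel (i : Fin 4) (c d : Chamber K rk) : Prop :=
  match i with
  | 0 => h.face c.2 0 = h.face d.2 0 ∧ AgreeOff (h.face c.2 0) c.1 d.1
  | 1 => h.face c.2 1 = h.face d.2 1 ∧ AgreeOff (h.face c.2 1) c.1 d.1
  | 2 => flipAt (facet h c.2) c.1 = flipAt (facet h d.2) d.1
  | 3 => c.1 = d.1

theorem face_le_facet (Φ : PolyFlag K) (i : Fin 3) :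
    h.face Φ i ≤ OrderDual.ofDual (facet h Φ).1 := by
  change h.face Φ i ≤ h.face Φ 2
  rcases (Fin.le_last i).lt_or_eq with h1 | rfl
  · exact (h.face_lt_face Φ h1).le
  · exact le_rfl

theorem facet_adj_of_ne {i : Fin 3} (hi : i ≠ 2) (Φ : PolyFlag K) :
    facet h (h.adj i Φ) = facet h Φ :=
  facet_eq_iff.2 (h.face_adj_of_ne hi.symm Φ)

theorem chamberRel_equivalence (i : Fin 4) : Equivalence (ChamberRel h i) := by
  fin_cases i
  · exact ⟨fun _ => ⟨rfl, fun _ _ => rfl⟩, fun h1 => ⟨h1.1.symm, h1.1 ▸ h1.2.symm⟩,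
      fun h1 h2 => ⟨h1.1.trans h2.1, h1.2.trans (h1.1 ▸ h2.2)⟩⟩
  · exact ⟨fun _ => ⟨rfl, fun _ _ => rfl⟩, fun h1 => ⟨h1.1.symm, h1.1 ▸ h1.2.symm⟩,
      fun h1 h2 => ⟨h1.1.trans h2.1, h1.2.trans (h1.1 ▸ h2.2)⟩⟩
  · exact ⟨fun _ => rfl, fun h1 => Eq.symm h1, fun h1 h2 => Eq.trans h1 h2⟩
  · exact ⟨fun _ => rfl, fun h1 => Eq.symm h1, fun h1 h2 => Eq.trans h1 h2⟩

theorem chamberMove_chamberMove (i : Fin 4) (c : Chamber K rk) :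
    chamberMove h i (chamberMove h i c) = c := by
  obtain ⟨x, Φ⟩ := c
  fin_cases i <;> simp [chamberMove, h.adj_adj, flipAt_flipAt]

theorem chamberMove_ne (i : Fin 4) (c : Chamber K rk) : chamberMove h i c ≠ c := by
  intro e
  have e' := congrArg Prod.snd e
  fin_cases i
  · exact h.adj_ne _ _ e'
  · exact h.adj_ne _ _ e'
  · exact h.adj_ne _ _ e'
  · exact h.adj_ne _ _ e'

theorem chamberRel_chamberMove {i j : Fin 4} (hij : j ≠ i) (c : Chamber K rk) :
    ChamberRel h i c (chamberMove h j c) := by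
  obtain ⟨x, Φ⟩ := c
  have hface : ∀ k l : Fin 3, k ≠ l → h.face Φ k = h.face (h.adj l Φ) k := fun k l hkl =>
    (h.face_adj_of_ne hkl Φ).symm
  have hflip : ∀ k : Fin 3, k ≠ 2 → AgreeOff (h.face Φ k) x
      (flipAt (facet h (h.adj 2 Φ)) (flipAt (facet h Φ) x)) := by
    intro k hk
    refine ((agreeOff_flipAt ?_ _).trans (agreeOff_flipAt (face_le_facet h Φ k) _)).symm
    rw [hface k 2 hk]
    exact face_le_facet h _ k
  fin_cases i <;> fin_cases j
  · exact absurd rfl hij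
  · exact ⟨hface 0 1 (by decide), fun _ _ => rfl⟩
  · exact ⟨hface 0 2 (by decide), fun _ _ => rfl⟩
  · exact ⟨hface 0 2 (by decide), hflip 0 (by decide)⟩
  · exact ⟨hface 1 0 (by decide), fun _ _ => rfl⟩
  · exact absurd rfl hij
  · exact ⟨hface 1 2 (by decide), fun _ _ => rfl⟩
  · exact ⟨hface 1 2 (by decide), hflip 1 (by decide)⟩
  · exact congrArg (flipAt · x) (facet_adj_of_ne h (i := 0) (by decide) Φ).symm
  · exact congrArg (flipAt · x) (facet_adj_of_ne h (i := 1) (by decide) Φ).symm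
  · exact absurd rfl hij
  · exact (flipAt_flipAt _ _).symm
  · rfl
  · rfl
  · rfl
  · exact absurd rfl hij

/-- Chambers joined by the adjacency maps of types outside `J`. -/
def ChamberReach (J : Set (Fin 4)) : Chamber K rk → Chamber K rk → Prop :=
  Relation.ReflTransGen fun c d => ∃ l ∉ J, d = chamberMove h l c

theorem chamberReach_of_flagMoves {J : Set (Fin 4)} {S : Set (Fin 3)}
    {c : PolyFlag K → Chamber K rk}
    (hc : ∀ i ∉ S, ∀ Θ, ∃ l ∉ J, c (h.adj i Θ) = chamberMove h l (c Θ)) {Φ Ψ : PolyFlag K}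
    (hf : ∀ i ∈ S, h.face Φ i = h.face Ψ i) : ChamberReach h J (c Φ) (c Ψ) := by
  refine h.flag_induction (p := fun Θ => ChamberReach h J (c Φ) (c Θ)) .refl ?_
  exact fun Θ i hi hΘ => hΘ.tail (hc i (fun hiS => hi (hf i hiS)) Θ)

theorem chamberReach_fst {J : Set (Fin 4)} (x : polyVertices Kᵒᵈ (dualRk rk 3) → Bool)
    {Φ Ψ : PolyFlag K} (h0 : 0 ∈ J → h.face Φ 0 = h.face Ψ 0)
    (h1 : 1 ∈ J → h.face Φ 1 = h.face Ψ 1) (h2 : 2 ∈ J → h.face Φ 2 = h.face Ψ 2) :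
    ChamberReach h J (x, Φ) (x, Ψ) := by
  refine chamberReach_of_flagMoves h (S := {i | i.castSucc ∈ J}) (c := fun Θ => (x, Θ))
    (fun i hi Θ => ⟨i.castSucc, hi, ?_⟩) fun i hi => ?_
  · fin_cases i <;> rfl
  · fin_cases i
    · exact h0 hi
    · exact h1 hi
    · exact h2 hi

theorem chamberReach_flipAt {J : Set (Fin 4)} (y : polyVertices Kᵒᵈ (dualRk rk 3) → Bool)
    {Φ Ψ : PolyFlag K} (h0 : 0 ∈ J → h.face Φ 0 = h.face Ψ 0)
    (h1 : 1 ∈ J → h.face Φ 1 = h.face Ψ 1) (h3 : 3 ∈ J → h.face Φ 2 = h.face Ψ 2) :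
    ChamberReach h J (flipAt (facet h Φ) y, Φ) (flipAt (facet h Ψ) y, Ψ) := by
  refine chamberReach_of_flagMoves h (S := {i | ![0, 1, 3] i ∈ J})
    (c := fun Θ => (flipAt (facet h Θ) y, Θ))
    (fun i hi Θ => ⟨![0, 1, 3] i, hi, ?_⟩) fun i hi => ?_
  · fin_cases i
    · exact Prod.ext (congrArg (flipAt · y) (facet_adj_of_ne h (i := 0) (by decide) Θ)) rfl
    · exact Prod.ext (congrArg (flipAt · y) (facet_adj_of_ne h (i := 1) (by decide) Θ)) rfl
    · refine Prod.ext ?_ rfl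
      change flipAt _ y = flipAt _ (flipAt _ (flipAt _ y))
      rw [flipAt_flipAt]
      rfl
  · fin_cases i
    · exact h0 hi
    · exact h1 hi
    · exact h3 hi

theorem facet_eq_of_flipAt_eq {V : Type*} {v w : V} {x : V → Bool}
    (he : flipAt v x = flipAt w x) : v = w := by
  by_contra hvw
  have := congrFun he v
  rw [flipAt_self, flipAt_of_ne hvw] at this
  exact Bool.not_ne_self _ this

theorem exists_flag_face {S : Set (Fin 3)} {a : Fin 3 → K}
    (ha : ∀ i ∈ S, rk (a i) = (i : ℕ)) (hS : ∀ i ∈ S, ∀ j ∈ S, i < j → a i ≤ a j) :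
    ∃ Θ, ∀ i ∈ S, h.face Θ i = a i := by
  obtain ⟨Θ, hΘ⟩ := exists_polyFlag (a '' S) (by
    rintro _ ⟨i, hi, rfl⟩ _ ⟨j, hj, rfl⟩
    rcases lt_trichotomy i j with hij | rfl | hij
    · exact Or.inl (hS i hi j hj hij)
    · exact Or.inl le_rfl
    · exact Or.inr (hS j hj i hi hij))
  exact ⟨Θ, fun i hi => h.face_eq (hΘ ⟨i, hi, rfl⟩) (ha i hi)⟩

/-- A flag containing some of the faces of `Ψ` and a facet lying above them. -/
theorem exists_flag_face_facet {p q : Prop} (Ψ : PolyFlag K)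
    (f : polyVertices Kᵒᵈ (dualRk rk 3)) (hp : p → h.face Ψ 0 ≤ OrderDual.ofDual f.1)
    (hq : q → h.face Ψ 1 ≤ OrderDual.ofDual f.1) :
    ∃ Θ, (p → h.face Θ 0 = h.face Ψ 0) ∧ (q → h.face Θ 1 = h.face Ψ 1) ∧ facet h Θ = f := by
  obtain ⟨Θ, hΘ⟩ := exists_polyFlag
    ({z | p ∧ z = h.face Ψ 0} ∪ {z | q ∧ z = h.face Ψ 1} ∪ {OrderDual.ofDual f.1}) (by
    have h01 : h.face Ψ 0 ≤ h.face Ψ 1 := (h.face_lt_face Ψ (by decide)).le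
    rintro _ ((⟨hp', rfl⟩ | ⟨hq', rfl⟩) | rfl) _ ((⟨hp'', rfl⟩ | ⟨hq'', rfl⟩) | rfl) <;>
      simp_all)
  refine ⟨Θ, fun hp' => ?_, fun hq' => ?_, ?_⟩
  · exact h.face_eq (hΘ (Or.inl (Or.inl ⟨hp', rfl⟩))) (h.rk_face Ψ 0)
  · exact h.face_eq (hΘ (Or.inl (Or.inr ⟨hq', rfl⟩))) (h.rk_face Ψ 1)
  · exact Subtype.ext (h.face_eq (i := 2) (hΘ (Or.inr rfl)) (rk_facet f))

variable [Fintype (polyVertices Kᵒᵈ (dualRk rk 3))]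

theorem chamberReach_of_agreeOff {J : Set (Fin 4)} (h2 : 2 ∉ J) (h3 : 3 ∉ J)
    {x y : polyVertices Kᵒᵈ (dualRk rk 3) → Bool} {Φ Ψ : PolyFlag K}
    (hp : parity x = parity y) (hΦ0 : 0 ∈ J → h.face Φ 0 = h.face Ψ 0)
    (hΦ1 : 1 ∈ J → h.face Φ 1 = h.face Ψ 1)
    (ha0 : 0 ∈ J → AgreeOff (h.face Ψ 0) x y) (ha1 : 1 ∈ J → AgreeOff (h.face Ψ 1) x y) :
    ChamberReach h J (x, Φ) (y, Ψ) := by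
  induction hs : {f | x f ≠ y f}.ncard using Nat.strong_induction_on generalizing x Φ with
  | _ s ih =>
  by_cases hxy : x = y
  · subst hxy
    exact chamberReach_fst h x hΦ0 hΦ1 fun h2' => absurd h2' h2
  obtain ⟨f, g, hfg, hf, hg⟩ := exists_ne_ne_of_parity_eq hp hxy
  have hle : ∀ {F : K}, AgreeOff F x y →
      F ≤ OrderDual.ofDual f.1 ∧ F ≤ OrderDual.ofDual g.1 := fun hF =>
    ⟨by_contra fun hn => hf (hF f hn), by_contra fun hn => hg (hF g hn)⟩
  obtain ⟨Θ, hΘ0, hΘ1, hΘf⟩ := exists_flag_face_facet h Ψ f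
    (fun h0 => (hle (ha0 h0)).1) (fun h1 => (hle (ha1 h1)).1)
  obtain ⟨Ξ, hΞ0, hΞ1, hΞg⟩ := exists_flag_face_facet h Ψ g
    (fun h0 => (hle (ha0 h0)).2) (fun h1 => (hle (ha1 h1)).2)
  have r1 : ChamberReach h J (x, Φ) (x, Θ) := chamberReach_fst h x
    (fun h0 => (hΦ0 h0).trans (hΘ0 h0).symm) (fun h1 => (hΦ1 h1).trans (hΘ1 h1).symm)
    fun h2' => absurd h2' h2
  have r2 : ChamberReach h J (x, Θ) (flipAt g (flipAt f x), Ξ) := by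
    have := chamberReach_flipAt h (J := J) (flipAt f x) (Φ := Θ) (Ψ := Ξ)
      (fun h0 => (hΘ0 h0).trans (hΞ0 h0).symm) (fun h1 => (hΘ1 h1).trans (hΞ1 h1).symm)
      fun h3' => absurd h3' h3
    rwa [hΘf, hΞg, flipAt_flipAt] at this
  refine (r1.trans r2).trans (ih _ ?_ ?_ hΞ0 hΞ1 (fun h0 => ?_) (fun h1 => ?_) rfl)
  · rw [← hs]
    refine Set.ncard_lt_ncard ((Set.ssubset_iff_of_subset ?_).2 ⟨f, hf, ?_⟩) (Set.toFinite _)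
    · intro k hk
      by_cases hkf : k = f
      · exact hkf ▸ hf
      · by_cases hkg : k = g
        · exact hkg ▸ hg
        · rwa [Set.mem_ofPred_eq, flipAt_of_ne hkg, flipAt_of_ne hkf] at hk
    · rw [Set.mem_ofPred_eq, not_not, flipAt_of_ne hfg, flipAt_eq_of_ne hf]
  · rw [parity_flipAt_flipAt, hp]
  · exact (agreeOff_flipAt (hle (ha0 h0)).2 _).trans
      ((agreeOff_flipAt (hle (ha0 h0)).1 _).trans (ha0 h0))
  · exact (agreeOff_flipAt (hle (ha1 h1)).2 _).trans
      ((agreeOff_flipAt (hle (ha1 h1)).1 _).trans (ha1 h1))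

theorem chamberReach_of_chamberRel {J : Set (Fin 4)} {c d : Chamber K rk}
    (hp : parity c.1 = parity d.1) (hJ : ∀ j ∈ J, ChamberRel h j c d) :
    ChamberReach h J c d := by
  obtain ⟨x, Φ⟩ := c
  obtain ⟨y, Ψ⟩ := d
  have h0 : 0 ∈ J → h.face Φ 0 = h.face Ψ 0 := fun h0 => (hJ 0 h0).1
  have h1 : 1 ∈ J → h.face Φ 1 = h.face Ψ 1 := fun h1 => (hJ 1 h1).1
  by_cases h3 : 3 ∈ J
  · obtain rfl : x = y := hJ 3 h3
    exact chamberReach_fst h x h0 h1 fun h2 => facet_eq_iff.1 (facet_eq_of_flipAt_eq (hJ 2 h2))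
  · by_cases h2 : 2 ∈ J
    · have hxy : flipAt (facet h Φ) x = flipAt (facet h Ψ) y := hJ 2 h2
      have := chamberReach_flipAt h (flipAt (facet h Φ) x) h0 h1 fun h3' => absurd h3' h3
      rwa [flipAt_flipAt, hxy, flipAt_flipAt] at this
    · exact chamberReach_of_agreeOff h h2 h3 hp h0 h1
        (fun h0' => h0 h0' ▸ (hJ 0 h0').2) (fun h1' => h1 h1' ▸ (hJ 1 h1').2)

theorem parity_chamberMove (i : Fin 4) (c : Chamber K rk) :
    parity (chamberMove h i c).1 = parity c.1 := by
  fin_cases i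
  · rfl
  · rfl
  · rfl
  · exact parity_flipAt_flipAt _ _ _

theorem exists_chamberRel {J : Set (Fin 4)} {p : ZMod 2} {c : Fin 4 → Chamber K rk}
    (hc : ∀ i, parity (c i).1 = p)
    (hJ : ∀ i ∈ J, ∀ j ∈ J, ∃ e : Chamber K rk, ChamberRel h i e (c i) ∧ ChamberRel h j e (c j)) :
    ∃ e : Chamber K rk, parity e.1 = p ∧ ∀ i ∈ J, ChamberRel h i e (c i) := by
  have h01 : 0 ∈ J → 1 ∈ J → h.face (c 0).2 0 ≤ h.face (c 1).2 1 ∧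
      AgreeOff (h.face (c 0).2 0) (c 1).1 (c 0).1 := by
    intro h0 h1
    obtain ⟨⟨x, Θ⟩, ⟨e1, e2⟩, e3, e4⟩ := hJ 0 h0 1 h1
    dsimp only at e1 e2 e3 e4
    have hle : h.face Θ 0 ≤ h.face Θ 1 := (h.face_lt_face Θ (by decide)).le
    rw [← e1, ← e3]
    exact ⟨hle, (e4.mono hle).symm.trans e2⟩
  have h03 : 0 ∈ J → 3 ∈ J → AgreeOff (h.face (c 0).2 0) (c 3).1 (c 0).1 := by
    intro h0 h3
    obtain ⟨⟨x, Θ⟩, ⟨e1, e2⟩, e3⟩ := hJ 0 h0 3 h3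
    obtain rfl : x = (c 3).1 := e3
    exact e1 ▸ e2
  have h13 : 1 ∈ J → 3 ∈ J → AgreeOff (h.face (c 1).2 1) (c 3).1 (c 1).1 := by
    intro h1 h3
    obtain ⟨⟨x, Θ⟩, ⟨e1, e2⟩, e3⟩ := hJ 1 h1 3 h3
    obtain rfl : x = (c 3).1 := e3
    exact e1 ▸ e2
  have h02 : 0 ∈ J → 2 ∈ J →
      AgreeOff (h.face (c 0).2 0) (flipAt (facet h (c 2).2) (c 2).1) (c 0).1 := by
    intro h0 h2
    obtain ⟨⟨x, Θ⟩, ⟨e1, e2⟩, e3⟩ := hJ 0 h0 2 h2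
    have e3' : flipAt (facet h Θ) x = flipAt (facet h (c 2).2) (c 2).1 := e3
    dsimp only at e1 e2
    rw [← e3', ← e1]
    exact (agreeOff_flipAt (face_le_facet h Θ 0) x).trans e2
  have h12 : 1 ∈ J → 2 ∈ J →
      AgreeOff (h.face (c 1).2 1) (flipAt (facet h (c 2).2) (c 2).1) (c 1).1 := by
    intro h1 h2
    obtain ⟨⟨x, Θ⟩, ⟨e1, e2⟩, e3⟩ := hJ 1 h1 2 h2
    have e3' : flipAt (facet h Θ) x = flipAt (facet h (c 2).2) (c 2).1 := e3
    dsimp only at e1 e2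
    rw [← e3', ← e1]
    exact (agreeOff_flipAt (face_le_facet h Θ 1) x).trans e2
  have h23 : 2 ∈ J → 3 ∈ J → ∃ f, flipAt f (c 3).1 = flipAt (facet h (c 2).2) (c 2).1 := by
    intro h2 h3
    obtain ⟨⟨x, Θ⟩, e2, e3⟩ := hJ 2 h2 3 h3
    obtain rfl : x = (c 3).1 := e3
    exact ⟨facet h Θ, e2⟩
  -- a flag realising the vertex and the edge
  obtain ⟨Ψ, hΨ0, hΨ1⟩ : ∃ Ψ, (0 ∈ J → h.face Ψ 0 = h.face (c 0).2 0) ∧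
      (1 ∈ J → h.face Ψ 1 = h.face (c 1).2 1) := by
    obtain ⟨Θ, hΘ⟩ := exists_flag_face h (S := {i | i.castSucc ∈ J ∧ i ≠ 2})
      (a := fun i => h.face (c i.castSucc).2 i) (fun i _ => h.rk_face _ i) (by
        rintro i ⟨hi, hi2⟩ j ⟨hj, hj2⟩ hij
        obtain rfl : i = 0 := by omega
        obtain rfl : j = 1 := by omega
        exact (h01 hi hj).1)
    exact ⟨Θ, fun h0 => hΘ 0 ⟨h0, by decide⟩, fun h1 => hΘ 1 ⟨h1, by decide⟩⟩
  have mk : ∀ (x : polyVertices Kᵒᵈ (dualRk rk 3) → Bool) (Θ : PolyFlag K), parity x = p →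
      (0 ∈ J → h.face Θ 0 = h.face (c 0).2 0 ∧ AgreeOff (h.face (c 0).2 0) x (c 0).1) →
      (1 ∈ J → h.face Θ 1 = h.face (c 1).2 1 ∧ AgreeOff (h.face (c 1).2 1) x (c 1).1) →
      (2 ∈ J → flipAt (facet h Θ) x = flipAt (facet h (c 2).2) (c 2).1) →
      (3 ∈ J → x = (c 3).1) →
      ∃ e : Chamber K rk, parity e.1 = p ∧ ∀ i ∈ J, ChamberRel h i e (c i) := by
    intro x Θ hx k0 k1 k2 k3
    refine ⟨(x, Θ), hx, fun i hi => ?_⟩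
    fin_cases i
    · exact ⟨(k0 hi).1, (k0 hi).1 ▸ (k0 hi).2⟩
    · exact ⟨(k1 hi).1, (k1 hi).1 ▸ (k1 hi).2⟩
    · exact k2 hi
    · exact k3 hi
  by_cases h3 : 3 ∈ J
  · by_cases h2 : 2 ∈ J
    · obtain ⟨f, hf⟩ := h23 h2 h3
      have hle : ∀ {F : K} {z : polyVertices Kᵒᵈ (dualRk rk 3) → Bool},
          AgreeOff F (flipAt (facet h (c 2).2) (c 2).1) z → AgreeOff F (c 3).1 z →
          F ≤ OrderDual.ofDual f.1 := by
        intro F z a1 a2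
        by_contra hn
        have := (a1 f hn).trans (a2 f hn).symm
        rw [← hf, flipAt_self] at this
        exact Bool.not_ne_self _ this
      obtain ⟨Θ, hΘ0, hΘ1, hΘf⟩ := exists_flag_face_facet h (p := 0 ∈ J) (q := 1 ∈ J) Ψ f
        (fun h0 => (hΨ0 h0).symm ▸ hle (h02 h0 h2) (h03 h0 h3))
        (fun h1 => (hΨ1 h1).symm ▸ hle (h12 h1 h2) (h13 h1 h3))
      exact mk (c 3).1 Θ (hc 3) (fun h0 => ⟨(hΘ0 h0).trans (hΨ0 h0), h03 h0 h3⟩)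
        (fun h1 => ⟨(hΘ1 h1).trans (hΨ1 h1), h13 h1 h3⟩) (fun _ => by rw [hΘf, hf])
        fun _ => rfl
    · exact mk (c 3).1 Ψ (hc 3) (fun h0 => ⟨hΨ0 h0, h03 h0 h3⟩)
        (fun h1 => ⟨hΨ1 h1, h13 h1 h3⟩) (fun h2' => absurd h2' h2) fun _ => rfl
  · by_cases h2 : 2 ∈ J
    · refine mk (flipAt (facet h Ψ) (flipAt (facet h (c 2).2) (c 2).1)) Ψ ?_
        (fun h0 => ⟨hΨ0 h0, ?_⟩) (fun h1 => ⟨hΨ1 h1, ?_⟩) (fun _ => flipAt_flipAt _ _)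
        (fun h3' => absurd h3' h3)
      · rw [parity_flipAt_flipAt, hc]
      · exact (agreeOff_flipAt (hΨ0 h0 ▸ face_le_facet h Ψ 0) _).trans (h02 h0 h2)
      · exact (agreeOff_flipAt (hΨ1 h1 ▸ face_le_facet h Ψ 1) _).trans (h12 h1 h2)
    · by_cases h1 : 1 ∈ J
      · exact mk (c 1).1 Ψ (hc 1) (fun h0 => ⟨hΨ0 h0, (h01 h0 h1).2⟩)
          (fun _ => ⟨hΨ1 h1, fun _ _ => rfl⟩) (fun h2' => absurd h2' h2)
          (fun h3' => absurd h3' h3)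
      · exact mk (c 0).1 Ψ (hc 0) (fun h0 => ⟨hΨ0 h0, fun _ _ => rfl⟩)
          (fun h1' => absurd h1' h1) (fun h2' => absurd h2' h2) (fun h3' => absurd h3' h3)

end Chambers

/-- If a group acts freely on a set of chambers, compatibly with the equivalence relations
`R i` of having the same element of type `i`, then its generators form a hypertope family
as soon as chambers sharing elements are connected by moves fixing these elements, and
pairwise incident elements lie in a common chamber. -/
theorem IsHypertopeFamily.of_chambers {H I C : Type*} [Group H] {r : I → H} {c : H → C}
    {move : I → C → C} {R : I → C → C → Prop} (hinj : Function.Injective c)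
    (hmove : ∀ g i, c (g * r i) = move i (c g))
    (hR : ∀ i k g g', R i (c (k * g)) (c (k * g')) ↔ R i (c g) (c g'))
    (hequiv : ∀ i, Equivalence (R i)) (hclosure : Subgroup.closure (Set.range r) = ⊤)
    (hRmove : ∀ i j e, j ≠ i → R i e (move j e)) (hmm : ∀ i e, move i (move i e) = e)
    (hne : ∀ i e, move i e ≠ e)
    (hreach : ∀ (J : Set I) g g', (∀ j ∈ J, R j (c g) (c g')) →
      Relation.ReflTransGen (fun d e => ∃ l ∉ J, e = move l d) (c g) (c g'))
    (hlift : ∀ (J : Set I) (g : I → H),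
      (∀ i ∈ J, ∀ j ∈ J, ∃ e, R i e (c (g i)) ∧ R j e (c (g j))) →
        ∃ k, ∀ i ∈ J, R i (c k) (c (g i))) :
    IsHypertopeFamily r fun i => Subgroup.closure (r '' {j | j ≠ i}) := by
  have hgen : ∀ (J : Set I) g, (∀ j ∈ J, R j (c 1) (c g)) → g ∈ Subgroup.closure (r '' Jᶜ) := by
    intro J g hg
    have key : ∀ d, Relation.ReflTransGen (fun d e => ∃ l ∉ J, e = move l d) (c 1) d →
        ∃ m ∈ Subgroup.closure (r '' Jᶜ), d = c m := by
      intro d hd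
      induction hd with
      | refl => exact ⟨1, one_mem _, rfl⟩
      | tail _ hl ih =>
        obtain ⟨m, hm, rfl⟩ := ih
        obtain ⟨l, hl, rfl⟩ := hl
        exact ⟨m * r l, mul_mem hm (Subgroup.subset_closure ⟨l, hl, rfl⟩), (hmove m l).symm⟩
    obtain ⟨m, hm, e⟩ := key _ (hreach J 1 g hg)
    exact hinj e ▸ hm
  have hmem : ∀ i g, g ∈ Subgroup.closure (r '' {j | j ≠ i}) ↔ R i (c 1) (c g) := by
    refine fun i g => ⟨fun hg => ?_, fun hg => ?_⟩
    · induction hg using Subgroup.closure_induction with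
      | mem x hx =>
        obtain ⟨j, hj, rfl⟩ := hx
        rw [← one_mul (r j), hmove]
        exact hRmove i j _ hj
      | one => exact (hequiv i).refl _
      | mul x y _ _ hx hy =>
        refine (hequiv i).trans hx ?_
        rwa [← hR i x, mul_one] at hy
      | inv x _ hx =>
        rw [← hR i x⁻¹, mul_one, inv_mul_cancel] at hx
        exact (hequiv i).symm hx
    · exact hgen {i} g fun j hj => hj ▸ hg
  have hcoset : ∀ i g k, k ∈ rCoset (Subgroup.closure (r '' {j | j ≠ i})) g ↔
      R i (c k⁻¹) (c g⁻¹) := by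
    intro i g k
    rw [mem_rCoset, hmem, ← hR i k⁻¹, mul_one, inv_mul_cancel_left]
  refine ⟨fun i => hinj ?_, fun i e => ?_, hclosure,
    fun i j hij => Subgroup.subset_closure ⟨j, hij, rfl⟩,
    fun J g hg => hgen J g fun j hj => (hmem j g).1 (hg j hj), fun J g hg => ?_⟩
  · rw [hmove, ← one_mul (r i), hmove, hmm]
  · apply hne i (c 1)
    rw [← hmove, one_mul, e]
  · obtain ⟨k, hk⟩ := hlift J (fun i => (g i)⁻¹) fun i hi j hj => by
      obtain ⟨x, hx, hx'⟩ := hg i hi j hj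
      exact ⟨c x⁻¹, (hcoset i _ x).1 hx, (hcoset j _ x).1 hx'⟩
    exact ⟨k⁻¹, fun i hi => (hcoset i _ _).2 (by rw [inv_inv]; exact hk i hi)⟩

section Code

open IsDodecahedron

variable {K : Type*} [PartialOrder K] {rk : K → ℤ}

/-- The flag of `D2K` given by a vertex of the cube and a flag of `K`. -/
def code (hV : VertexDescribable Kᵒᵈ (dualRk rk 3)) (c : Chamber K rk) :
    PolyFlag (D2 K rk 3) :=
  ⟨(cubeFlag hV c.1 ⟨c.2.1, c.2.2.dual⟩).1, (cubeFlag hV c.1 ⟨c.2.1, c.2.2.dual⟩).2.dual⟩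

/-- The face `F(x)` of `D2K`. -/
def codeFace (F : K) (x : polyVertices Kᵒᵈ (dualRk rk 3) → Bool) : D2 K rk 3 :=
  OrderDual.toDual (cubeMk (dualRk rk 3) (OrderDual.toDual F) x)

theorem codeFace_eq_iff (hV : VertexDescribable Kᵒᵈ (dualRk rk 3)) {F G : K}
    {x y : polyVertices Kᵒᵈ (dualRk rk 3) → Bool} :
    codeFace F x = codeFace G y ↔ F = G ∧ AgreeOff F x y :=
  cubeMk_eq_iff hV

theorem codeFace_lt_iff (hV : VertexDescribable Kᵒᵈ (dualRk rk 3)) {F G : K}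
    {x : polyVertices Kᵒᵈ (dualRk rk 3) → Bool} :
    codeFace F x < codeFace G x ↔ F < G := by
  have hle : ∀ {F G : K}, codeFace F x ≤ codeFace G x ↔ F ≤ G := fun {F G} =>
    (cubeMk_le_iff hV).trans (and_iff_left fun _ _ => rfl)
  rw [lt_iff_le_not_ge, lt_iff_le_not_ge, hle, hle]

theorem rk_codeFace (hV : VertexDescribable Kᵒᵈ (dualRk rk 3)) (F : K)
    (x : polyVertices Kᵒᵈ (dualRk rk 3) → Bool) :
    dualRk (cubeRk (dualRk rk 3)) 4 (codeFace F x) = rk F := by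
  change ((4 : ℕ) : ℤ) - 1 - cubeRk (dualRk rk 3) (cubeMk _ (OrderDual.toDual F) x) = rk F
  rw [cubeRk_mk hV]
  simp only [dualRk, OrderDual.ofDual_toDual]
  push_cast
  ring

variable (hV : VertexDescribable Kᵒᵈ (dualRk rk 3))

theorem codeFace_mem_code {F : K} {c : Chamber K rk} :
    codeFace F c.1 ∈ (code hV c).1 ↔ F ∈ c.2.1 :=
  cubeMk_mem_cubeFlag_iff hV

/-- The greatest face of `D2K`. -/
def codeTop : D2 K rk 3 := OrderDual.toDual (cubeBot (dualRk rk 3))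

theorem codeTop_mem_code (c : Chamber K rk) : codeTop ∈ (code hV c).1 :=
  cubeBot_mem_cubeFlag hV _ _

theorem mem_code_cases {c : Chamber K rk} {S : D2 K rk 3} (hS : S ∈ (code hV c).1) :
    S = codeTop ∨ ∃ F ∈ c.2.1, S = codeFace F c.1 := by
  rcases hS with rfl | ⟨F, hF, rfl⟩
  · exact Or.inl rfl
  · exact Or.inr ⟨F, hF, rfl⟩

variable (h : IsPolytope K rk 3)

theorem code_injective (h : IsPolytope K rk 3) : Function.Injective (code hV) := by
  rintro ⟨x, Φ⟩ ⟨y, Ψ⟩ e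
  have e' : cubeFlag hV x ⟨Φ.1, Φ.2.dual⟩ = cubeFlag hV y ⟨Ψ.1, Ψ.2.dual⟩ :=
    Subtype.ext (congrArg Subtype.val e :)
  obtain ⟨h1, h2⟩ := cubeFlag_injective h.dual hV e'
  exact Prod.ext h1 (Subtype.ext (congrArg Subtype.val h2 :))

theorem code_surjective (h : IsPolytope K rk 3) [Finite K] : Function.Surjective (code hV) := by
  intro M
  obtain ⟨x, Φ, hM⟩ := exists_cubeFlag h.dual hV ⟨M.1, M.2.dual⟩
  exact ⟨(x, ⟨Φ.1, Φ.2.dual⟩), Subtype.ext (congrArg Subtype.val hM).symm⟩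

/-- Flags of `D2K` correspond to pairs of a vertex of the cube and a flag of `K`. -/
def codeEquiv [Finite K] : Chamber K rk ≃ PolyFlag (D2 K rk 3) :=
  Equiv.ofBijective (code hV) ⟨code_injective hV h, code_surjective hV h⟩

variable (hQ : IsPolytope (D2 K rk 3) (dualRk (cubeRk (dualRk rk 3)) 4) 4)

theorem face_code {c : Chamber K rk} {i : Fin 4} {F : K} (hF : F ∈ c.2.1) (hr : rk F = (i : ℕ)) :
    hQ.face (code hV c) i = codeFace F c.1 :=
  hQ.face_eq ((codeFace_mem_code hV).2 hF) ((rk_codeFace hV F c.1).trans hr)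

theorem adj_code (i : Fin 3) (c : Chamber K rk) :
    hQ.adj i.castSucc (code hV c) = code hV (c.1, h.adj i c.2) := by
  refine (hQ.eq_adj (fun e => ?_) fun S hS hr => ?_).symm
  · exact h.adj_ne i c.2 (congrArg Prod.snd (code_injective hV h e))
  · rcases mem_code_cases hV hS with rfl | ⟨F, hF, rfl⟩
    · exact codeTop_mem_code hV _
    · rw [rk_codeFace hV] at hr
      exact (codeFace_mem_code hV (c := (c.1, h.adj i c.2))).2 (h.mem_adj hF hr)

theorem adj_three_code (c : Chamber K rk) :
    hQ.adj 3 (code hV c) = code hV (flipAt (facet h c.2) c.1, c.2) := by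
  refine (hQ.eq_adj (fun e => ?_) fun S hS hr => ?_).symm
  · exact flipAt_ne _ _ (congrArg Prod.fst (code_injective hV h e))
  · rcases mem_code_cases hV hS with rfl | ⟨F, hF, rfl⟩
    · exact codeTop_mem_code hV _
    · rw [rk_codeFace hV] at hr
      refine cubeMk_mem_cubeFlag_flipAt h.dual hV (h.face_mem c.2 2) hF fun e => hr ?_
      simp only [dualRk] at e
      change ((3 : ℕ) : ℤ) - 1 - rk F = -1 at e
      change rk F = ((3 : ℕ) : ℤ)
      omega

/-- The element of type `i` of the halved polytope determined by a flag. -/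
def halvedElt (i : Fin 4) (M : PolyFlag (D2 K rk 3)) : D2 K rk 3 :=
  if i = 2 then hQ.face (hQ.adj 3 M) 3 else hQ.face M i

theorem halvedElt_flagMap (i : Fin 4) (g : ↥(orderAut (D2 K rk 3)))
    (M : PolyFlag (D2 K rk 3)) : halvedElt hQ i (flagMap g M) = g.1 (halvedElt hQ i M) := by
  unfold halvedElt
  split_ifs
  · rw [hQ.adj_flagMap, hQ.face_flagMap]
  · rw [hQ.face_flagMap]

theorem face_three_code_eq_iff (h : IsPolytope K rk 3) {c d : Chamber K rk} :
    hQ.face (code hV c) 3 = hQ.face (code hV d) 3 ↔ c.1 = d.1 := by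
  obtain ⟨F, hF, hr⟩ := h.exists_mem_rk c.2 (k := 3) (by norm_num) le_rfl
  obtain ⟨G, hG, hr'⟩ := h.exists_mem_rk d.2 (k := 3) (by norm_num) le_rfl
  have hFG : F = G := le_antisymm (h.isTop_iff.2 hr' F) (h.isTop_iff.2 hr G)
  rw [face_code hV hQ hF hr, face_code hV hQ hG hr', codeFace_eq_iff hV, and_iff_right hFG]
  refine ⟨fun e => funext fun f => e f fun hle => ?_, fun e _ _ => congrFun e _⟩
  have := h.strictMono.monotone hle
  rw [hr, rk_facet f] at this
  omega

theorem chamberRel_iff (i : Fin 4) (c d : Chamber K rk) :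
    ChamberRel h i c d ↔ halvedElt hQ i (code hV c) = halvedElt hQ i (code hV d) := by
  have key : ∀ k : Fin 3, (h.face c.2 k = h.face d.2 k ∧ AgreeOff (h.face c.2 k) c.1 d.1) ↔
      hQ.face (code hV c) k.castSucc = hQ.face (code hV d) k.castSucc := by
    intro k
    rw [face_code hV hQ (h.face_mem c.2 k) (h.rk_face c.2 k),
      face_code hV hQ (h.face_mem d.2 k) (h.rk_face d.2 k), codeFace_eq_iff hV]
  fin_cases i
  · exact key 0
  · exact key 1
  · change _ ↔ hQ.face (hQ.adj 3 _) 3 = hQ.face (hQ.adj 3 _) 3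
    rw [adj_three_code hV h, adj_three_code hV h, face_three_code_eq_iff hV hQ h]
    rfl
  · exact (face_three_code_eq_iff hV hQ h).symm

/-- The adjacency in the halved polytope in terms of flags of the original one. -/
def halvedAdj (i : Fin 4) (M : PolyFlag (D2 K rk 3)) : PolyFlag (D2 K rk 3) :=
  if i = 3 then hQ.adj 3 (hQ.adj 2 (hQ.adj 3 M)) else hQ.adj i M

theorem code_chamberMove (i : Fin 4) (c : Chamber K rk) :
    code hV (chamberMove h i c) = halvedAdj hQ i (code hV c) := by
  fin_cases i
  · exact (adj_code hV h hQ 0 c).symm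
  · exact (adj_code hV h hQ 1 c).symm
  · exact (adj_code hV h hQ 2 c).symm
  · change _ = hQ.adj 3 (hQ.adj 2 (hQ.adj 3 (code hV c)))
    rw [adj_three_code hV h]
    erw [adj_code hV h hQ 2]
    rw [adj_three_code hV h]
    rfl

theorem flagMap_mul_halvingGens {Φ : PolyFlag (D2 K rk 3)}
    {ϱ : Fin 4 → ↥(orderAut (D2 K rk 3))}
    (hϱ : IsDistinguishedGens (D2 K rk 3) (dualRk (cubeRk (dualRk rk 3)) 4) 4 Φ.1 ϱ)
    (g : ↥(orderAut (D2 K rk 3))) (i : Fin 4) :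
    flagMap (g * halvingGens 4 ϱ i) Φ = halvedAdj hQ i (flagMap g Φ) := by
  fin_cases i
  · exact hQ.flagMap_mul_gen hϱ g 0
  · exact hQ.flagMap_mul_gen hϱ g 1
  · exact hQ.flagMap_mul_gen hϱ g 2
  · change flagMap (g * (ϱ 3 * ϱ 2 * ϱ 3)) Φ = hQ.adj 3 (hQ.adj 2 (hQ.adj 3 _))
    rw [← mul_assoc, ← mul_assoc, hQ.flagMap_mul_gen hϱ, hQ.flagMap_mul_gen hϱ,
      hQ.flagMap_mul_gen hϱ]

end Code

theorem closure_range_liftGens {G I : Type*} [Group G] (ρ : I → G) :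
    Subgroup.closure (Set.range (liftGens ρ)) = ⊤ := by
  have hr : Set.range (liftGens ρ) =
      ((↑) : Subgroup.closure (Set.range ρ) → G) ⁻¹' Set.range ρ := by
    ext x
    constructor
    · rintro ⟨i, rfl⟩
      exact ⟨i, rfl⟩
    · rintro ⟨i, hi⟩
      exact ⟨i, Subtype.ext hi⟩
  rw [hr, Subgroup.closure_closure_coe_preimage]

section HalvingGroup

variable {K : Type*} [PartialOrder K] [Finite K] {rk : K → ℤ}
  (hV : VertexDescribable Kᵒᵈ (dualRk rk 3)) (h : IsPolytope K rk 3)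

/-- The chamber corresponding to an automorphism of `D2K`, given a base flag. -/
def chamberOf (Φ : PolyFlag (D2 K rk 3)) (g : ↥(orderAut (D2 K rk 3))) : Chamber K rk :=
  (codeEquiv hV h).symm (flagMap g Φ)

theorem code_chamberOf (Φ : PolyFlag (D2 K rk 3)) (g : ↥(orderAut (D2 K rk 3))) :
    code hV (chamberOf hV h Φ g) = flagMap g Φ :=
  (codeEquiv hV h).apply_symm_apply _

theorem chamberOf_injective
    (hQ : IsPolytope (D2 K rk 3) (dualRk (cubeRk (dualRk rk 3)) 4) 4)
    (Φ : PolyFlag (D2 K rk 3)) : Function.Injective (chamberOf hV h Φ) :=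
  (codeEquiv hV h).symm.injective.comp (hQ.flagMap_injective Φ)

theorem chamberRel_chamberOf_mul
    (hQ : IsPolytope (D2 K rk 3) (dualRk (cubeRk (dualRk rk 3)) 4) 4)
    (Φ : PolyFlag (D2 K rk 3)) (i : Fin 4) (k g g' : ↥(orderAut (D2 K rk 3))) :
    ChamberRel h i (chamberOf hV h Φ (k * g)) (chamberOf hV h Φ (k * g')) ↔
      ChamberRel h i (chamberOf hV h Φ g) (chamberOf hV h Φ g') := by
  simp only [chamberRel_iff hV h hQ, code_chamberOf, flagMap_mul, halvedElt_flagMap,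
    k.1.injective.eq_iff]

variable {Φ : PolyFlag (D2 K rk 3)} {ϱ : Fin 4 → ↥(orderAut (D2 K rk 3))}

theorem chamberOf_mul
    (hQ : IsPolytope (D2 K rk 3) (dualRk (cubeRk (dualRk rk 3)) 4) 4)
    (hϱ : IsDistinguishedGens (D2 K rk 3) (dualRk (cubeRk (dualRk rk 3)) 4) 4 Φ.1 ϱ)
    (g : ↥(orderAut (D2 K rk 3))) (i : Fin 4) :
    chamberOf hV h Φ (g * halvingGens 4 ϱ i) = chamberMove h i (chamberOf hV h Φ g) := by
  apply code_injective hV h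
  rw [code_chamberMove hV h hQ, code_chamberOf, code_chamberOf, flagMap_mul_halvingGens hQ hϱ]

variable [Fintype (polyVertices Kᵒᵈ (dualRk rk 3))]

theorem parity_chamberOf
    (hQ : IsPolytope (D2 K rk 3) (dualRk (cubeRk (dualRk rk 3)) 4) 4)
    (hϱ : IsDistinguishedGens (D2 K rk 3) (dualRk (cubeRk (dualRk rk 3)) 4) 4 Φ.1 ϱ)
    {g : ↥(orderAut (D2 K rk 3))}
    (hg : g ∈ Subgroup.closure (Set.range (halvingGens 4 ϱ))) :
    parity (chamberOf hV h Φ g).1 = parity (chamberOf hV h Φ 1).1 := by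
  suffices ∀ k, parity (chamberOf hV h Φ (k * g)).1 = parity (chamberOf hV h Φ k).1 by
    simpa using this 1
  induction hg using Subgroup.closure_induction with
  | mem x hx =>
    obtain ⟨i, rfl⟩ := hx
    intro k
    rw [chamberOf_mul hV h hQ hϱ, parity_chamberMove]
  | one => simp
  | mul x y _ _ hx hy =>
    intro k
    rw [← mul_assoc, hy, hx]
  | inv x _ hx =>
    intro k
    rw [← hx, inv_mul_cancel_right]

theorem exists_chamberOf_eq
    (hQ : IsPolytope (D2 K rk 3) (dualRk (cubeRk (dualRk rk 3)) 4) 4)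
    (hϱ : IsDistinguishedGens (D2 K rk 3) (dualRk (cubeRk (dualRk rk 3)) 4) 4 Φ.1 ϱ)
    {d : Chamber K rk} (hd : parity d.1 = parity (chamberOf hV h Φ 1).1) :
    ∃ g ∈ Subgroup.closure (Set.range (halvingGens 4 ϱ)), chamberOf hV h Φ g = d := by
  have hreach : ChamberReach h ∅ (chamberOf hV h Φ 1) d :=
    chamberReach_of_chamberRel h hd.symm fun j hj => hj.elim
  clear hd
  induction hreach with
  | refl => exact ⟨1, one_mem _, rfl⟩
  | tail _ hl ih =>
    obtain ⟨g, hg, rfl⟩ := ih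
    obtain ⟨i, -, rfl⟩ := hl
    exact ⟨g * halvingGens 4 ϱ i, mul_mem hg (Subgroup.subset_closure ⟨i, rfl⟩),
      chamberOf_mul hV h hQ hϱ g i⟩

theorem isHypertopeFamily_halving
    (hV : VertexDescribable Kᵒᵈ (dualRk rk 3)) (h : IsPolytope K rk 3)
    (hQ : IsPolytope (D2 K rk 3) (dualRk (cubeRk (dualRk rk 3)) 4) 4)
    (hϱ : IsDistinguishedGens (D2 K rk 3) (dualRk (cubeRk (dualRk rk 3)) 4) 4 Φ.1 ϱ) :
    IsHypertopeFamily (liftGens (halvingGens 4 ϱ)) (halvingCosetFamily 4 ϱ) := by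
  refine IsHypertopeFamily.of_chambers
    (c := fun g : ↥(Subgroup.closure (Set.range (halvingGens 4 ϱ))) => chamberOf hV h Φ g.1)
    (move := chamberMove h) (R := ChamberRel h)
    ((chamberOf_injective hV h hQ Φ).comp Subtype.val_injective)
    (fun g i => chamberOf_mul hV h hQ hϱ g.1 i)
    (fun i k g g' => chamberRel_chamberOf_mul hV h hQ Φ i k.1 g.1 g'.1)
    (chamberRel_equivalence h) (closure_range_liftGens _)
    (fun i j e hij => chamberRel_chamberMove h hij e) (chamberMove_chamberMove h)
    (chamberMove_ne h) (fun J g g' hJ => chamberReach_of_chamberRel h ?_ hJ) fun J g hJ => ?_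
  · rw [parity_chamberOf hV h hQ hϱ g.2, parity_chamberOf hV h hQ hϱ g'.2]
  · obtain ⟨e, he, heJ⟩ := exists_chamberRel h
      (fun i => parity_chamberOf hV h hQ hϱ (g i).2) hJ
    obtain ⟨k, hk, rfl⟩ := exists_chamberOf_eq hV h hQ hϱ he
    exact ⟨⟨k, hk⟩, heJ⟩

theorem card_halvingGroup [Nonempty (polyVertices Kᵒᵈ (dualRk rk 3))]
    (hV : VertexDescribable Kᵒᵈ (dualRk rk 3)) (h : IsPolytope K rk 3)
    (hQ : IsPolytope (D2 K rk 3) (dualRk (cubeRk (dualRk rk 3)) 4) 4)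
    (hϱ : IsDistinguishedGens (D2 K rk 3) (dualRk (cubeRk (dualRk rk 3)) 4) 4 Φ.1 ϱ) :
    Nat.card ↥(Subgroup.closure (Set.range (halvingGens 4 ϱ))) =
      2 ^ (Fintype.card (polyVertices Kᵒᵈ (dualRk rk 3)) - 1) * Nat.card (PolyFlag K) := by
  rw [← card_parity_eq (parity (chamberOf hV h Φ 1).1), ← Nat.card_prod]
  refine Nat.card_eq_of_bijective (fun g => (⟨(chamberOf hV h Φ g.1).1,
    parity_chamberOf hV h hQ hϱ g.2⟩, (chamberOf hV h Φ g.1).2)) ⟨fun g g' e => ?_, ?_⟩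
  · refine Subtype.ext (chamberOf_injective hV h hQ Φ (Prod.ext ?_ ?_))
    · exact congrArg (fun c => c.1.1) e
    · exact (congrArg Prod.snd e :)
  · rintro ⟨⟨x, hx⟩, Ψ⟩
    obtain ⟨g, hg, e⟩ := exists_chamberOf_eq hV h hQ hϱ (d := (x, Ψ)) hx
    exact ⟨⟨g, hg⟩, by simp only [e]⟩

end HalvingGroup

theorem orderOf_conj_of_mul_self {G : Type*} [Group G] {a : G} (ha : a * a = 1) (b : G) :
    orderOf (a * b * a) = orderOf b := by
  have := (MulAut.conj a).orderOf_eq b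
  rwa [MulAut.conj_apply, inv_eq_of_mul_eq_one_right ha] at this

theorem orderOf_halvingGens {G : Type*} [Group G] {ϱ : Fin 4 → G} (hsq : ∀ i, ϱ i * ϱ i = 1)
    (h02 : ϱ 0 * ϱ 2 = ϱ 2 * ϱ 0) (h03 : ϱ 0 * ϱ 3 = ϱ 3 * ϱ 0) (h13 : ϱ 1 * ϱ 3 = ϱ 3 * ϱ 1)
    (hne : ϱ 0 ≠ ϱ 2) (h23 : orderOf (ϱ 2 * ϱ 3) = 4) :
    orderOf (halvingGens 4 ϱ 0 * halvingGens 4 ϱ 1) = orderOf (ϱ 0 * ϱ 1) ∧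
    orderOf (halvingGens 4 ϱ 1 * halvingGens 4 ϱ 2) = orderOf (ϱ 1 * ϱ 2) ∧
    orderOf (halvingGens 4 ϱ 1 * halvingGens 4 ϱ 3) = orderOf (ϱ 1 * ϱ 2) ∧
    orderOf (halvingGens 4 ϱ 2 * halvingGens 4 ϱ 3) = 2 ∧
    orderOf (halvingGens 4 ϱ 0 * halvingGens 4 ϱ 2) = 2 ∧
    orderOf (halvingGens 4 ϱ 0 * halvingGens 4 ϱ 3) = 2 := by
  have conj : ∀ i, ϱ i * ϱ 3 = ϱ 3 * ϱ i →
      orderOf (ϱ i * (ϱ 3 * ϱ 2 * ϱ 3)) = orderOf (ϱ i * ϱ 2) := by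
    intro i hi
    rw [← orderOf_conj_of_mul_self (hsq 3) (ϱ i * ϱ 2), ← mul_assoc, ← mul_assoc, hi]
    simp only [mul_assoc]
  have o02 : orderOf (ϱ 0 * ϱ 2) = 2 := by
    refine orderOf_eq_prime ?_ fun e => hne ?_
    · rw [pow_two, mul_assoc, ← mul_assoc (ϱ 2), ← h02, mul_assoc, hsq, mul_one, hsq]
    · rw [← mul_one (ϱ 0), ← hsq 2, ← mul_assoc, e, one_mul]
  refine ⟨rfl, rfl, conj 1 h13, ?_, o02, (conj 0 h03).trans o02⟩
  change orderOf (ϱ 2 * (ϱ 3 * ϱ 2 * ϱ 3)) = 2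
  have : ϱ 2 * (ϱ 3 * ϱ 2 * ϱ 3) = (ϱ 2 * ϱ 3) ^ 2 := by simp only [pow_two, mul_assoc]
  rw [this, orderOf_pow_of_dvd two_ne_zero (by rw [h23]; norm_num), h23]

theorem IsRegularPolytope.dual {P : Type*} [PartialOrder P] (h : IsRegularPolytope P) :
    IsRegularPolytope Pᵒᵈ := by
  intro F G hF hG
  obtain ⟨α, hα, e⟩ := h F G hF.dual hG.dual
  exact ⟨α, fun x y => hα y x, e⟩

theorem isDodecahedron_of_orderOf {K : Type*} [PartialOrder K] {rk : K → ℤ}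
    (h : IsPolytope K rk 3) (hreg : IsRegularPolytope K) {Φ : PolyFlag K}
    {ϱ : Fin 3 → ↥(orderAut K)} (hϱ : IsDistinguishedGens K rk 3 Φ.1 ϱ)
    (h5 : orderOf (ϱ 0 * ϱ 1) = 5) (h3 : orderOf (ϱ 1 * ϱ 2) = 3)
    (haut : Nat.card ↥(orderAut K) = 120) : IsDodecahedron h where
  regular := hreg
  iterate_zero_one Ψ m := by rw [h.iterate_adj_eq_iff hreg hϱ, h5]
  iterate_one_two Ψ m := by rw [h.iterate_adj_eq_iff hreg hϱ, h3]
  card_flag := by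
    rw [← haut]
    exact (Nat.card_eq_of_bijective _
      ⟨h.flagMap_injective Φ, IsPolytope.exists_flagMap hreg Φ⟩).symm

section Polytope

open IsDodecahedron

variable {K : Type*} [PartialOrder K] {rk : K → ℤ}

theorem nonDegenerate_D2 (hV : VertexDescribable Kᵒᵈ (dualRk rk 3)) (h : IsPolytope K rk 3)
    (hnd : NonDegenerate K rk) :
    NonDegenerate (D2 K rk 3) (dualRk (cubeRk (dualRk rk 3)) 4) := by
  intro S T hST hr
  rcases cube_cases (OrderDual.ofDual S) with hS | ⟨A, x, hS⟩
  · have hTS : OrderDual.ofDual T < OrderDual.ofDual S := hST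
    rw [hS] at hTS
    exact absurd hTS (cubeBot_le _).not_gt
  obtain rfl : S = codeFace (OrderDual.ofDual A) x := hS
  set A := OrderDual.ofDual A
  rcases cube_cases (OrderDual.ofDual T) with hT | ⟨B, y, hT⟩
  · obtain rfl : T = codeTop := hT
    have htop : ∀ F z, codeFace (rk := rk) F z < codeTop := fun F z => cubeBot_lt_mk _ z
    rw [rk_codeFace hV] at hr ⊢
    change ((4 : ℕ) : ℤ) - 1 - cubeRk (dualRk rk 3) (cubeBot _) = _ at hr
    rw [cubeRk_bot] at hr
    have hA : rk A = ((1 : Fin 3) : ℕ) := by push_cast at hr ⊢; omega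
    obtain ⟨Φ, hΦ, -⟩ := IsPolytope.exists_flag_of_le (le_refl A)
    have hf : h.face Φ 1 = A := h.face_eq hΦ hA
    have hf' : h.face (h.adj 2 Φ) 1 = A := (h.face_adj_of_ne (by decide) Φ).trans hf
    have hlt : A < h.face Φ 2 := hf ▸ h.face_lt_face Φ (by decide)
    have hlt' : A < h.face (h.adj 2 Φ) 2 := hf' ▸ h.face_lt_face (h.adj 2 Φ) (by decide)
    have hne := h.face_adj_self_ne 2 Φ
    have hr2 : ∀ Ψ : PolyFlag K, rk (h.face Ψ 2) = rk A + 1 := by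
      intro Ψ
      rw [h.rk_face, hA]
      rfl
    have hflip : codeFace A x = codeFace A (flipAt (facet h (h.adj 2 Φ)) x) :=
      (codeFace_eq_iff hV).2 ⟨rfl, (agreeOff_flipAt hlt'.le x).symm⟩
    refine ⟨codeFace (h.face Φ 2) x, codeFace (h.face (h.adj 2 Φ) 2) x,
      codeFace (h.face Φ 2) (flipAt (facet h (h.adj 2 Φ)) x),
      ⟨(codeFace_lt_iff hV).2 hlt, htop _ _, ?_⟩, ⟨(codeFace_lt_iff hV).2 hlt', htop _ _, ?_⟩,
      ⟨?_, htop _ _, ?_⟩, ?_, ?_, ?_⟩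
    · rw [rk_codeFace hV, hr2]
    · rw [rk_codeFace hV, hr2]
    · rw [hflip, codeFace_lt_iff hV]
      exact hlt
    · rw [rk_codeFace hV, hr2]
    · rw [Ne, codeFace_eq_iff hV]
      exact fun e => hne e.1.symm
    · rw [Ne, codeFace_eq_iff hV]
      intro e
      have := e.2 (facet h (h.adj 2 Φ)) fun hle =>
        hne (h.eq_of_rk_eq (Or.inl hle) ((hr2 _).trans (hr2 _).symm)).symm
      rw [flipAt_self] at this
      exact Bool.not_ne_self _ this.symm
    · rw [Ne, codeFace_eq_iff hV]
      exact fun e => hne e.1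
  · obtain rfl : T = codeFace (OrderDual.ofDual B) y := hT
    set B := OrderDual.ofDual B
    have hxy : codeFace A x = codeFace (rk := rk) A y :=
      (codeFace_eq_iff hV).2 ⟨rfl, fun v hv => (((cubeMk_le_iff hV).1 hST.le).2 v hv).symm⟩
    rw [hxy] at hST hr ⊢
    rw [codeFace_lt_iff hV] at hST
    rw [rk_codeFace hV, rk_codeFace hV] at hr
    obtain ⟨H₁, H₂, H₃, ⟨a1, b1, r1⟩, ⟨a2, b2, r2⟩, ⟨a3, b3, r3⟩, n1, n2, n3⟩ :=
      hnd A B hST hr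
    have hne : ∀ {F G : K}, F ≠ G → codeFace (rk := rk) F y ≠ codeFace G y :=
      fun hFG e => hFG ((codeFace_eq_iff hV).1 e).1
    refine ⟨codeFace H₁ y, codeFace H₂ y, codeFace H₃ y, ?_, ?_, ?_, hne n1, hne n2, hne n3⟩ <;>
      simp only [codeFace_lt_iff hV, rk_codeFace hV] <;> exact ⟨‹_›, ‹_›, ‹_›⟩

theorem orderOf_gens_D2 [Finite K] {h : IsPolytope K rk 3} (hD : IsDodecahedron h)
    (hQ : IsPolytope (D2 K rk 3) (dualRk (cubeRk (dualRk rk 3)) 4) 4)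
    (hreg : IsRegularPolytope (D2 K rk 3)) {Φ : PolyFlag (D2 K rk 3)}
    {ϱ : Fin 4 → ↥(orderAut (D2 K rk 3))}
    (hϱ : IsDistinguishedGens (D2 K rk 3) (dualRk (cubeRk (dualRk rk 3)) 4) 4 Φ.1 ϱ) :
    orderOf (ϱ 0 * ϱ 1) = 5 ∧ orderOf (ϱ 1 * ϱ 2) = 3 ∧ orderOf (ϱ 2 * ϱ 3) = 4 := by
  have hV := hD.vertexDescribable
  obtain ⟨⟨x, Ψ⟩, -⟩ := code_surjective hV h Φ
  have hiter : ∀ i j : Fin 3, ∀ m, (hQ.adj j.castSucc ∘ hQ.adj i.castSucc)^[m]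
      (code hV (x, Ψ)) = code hV (x, (h.adj j ∘ h.adj i)^[m] Ψ) := by
    intro i j m
    induction m with
    | zero => rfl
    | succ m ih =>
      rw [Function.iterate_succ_apply', Function.iterate_succ_apply', ih, Function.comp_apply,
        adj_code hV h, adj_code hV h]
      rfl
  have hiff : ∀ i j : Fin 3, ∀ m, orderOf (ϱ i.castSucc * ϱ j.castSucc) ∣ m ↔
      (h.adj j ∘ h.adj i)^[m] Ψ = Ψ := by
    intro i j m
    rw [← hQ.iterate_adj_eq_iff hreg hϱ (code hV (x, Ψ)), hiter]
    exact ⟨fun e => congrArg Prod.snd (code_injective hV h e), fun e => by rw [e]⟩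
  have hmove : ∀ y Θ, (hQ.adj 3 ∘ hQ.adj 2) (code hV (y, Θ)) =
      code hV (flipAt (facet h (h.adj 2 Θ)) y, h.adj 2 Θ) := by
    intro y Θ
    rw [Function.comp_apply, ← adj_three_code hV h hQ (y, h.adj 2 Θ)]
    exact congrArg _ (adj_code hV h hQ 2 (y, Θ))
  refine ⟨?_, ?_, orderOf_eq_prime_pow (p := 2) (n := 1) (fun e => ?_) ?_⟩
  · exact Nat.dvd_right_iff_eq.1 fun m => (hiff 0 1 m).trans (hD.iterate_zero_one Ψ m)
  · exact Nat.dvd_right_iff_eq.1 fun m => (hiff 1 2 m).trans (hD.iterate_one_two Ψ m)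
  · rw [← orderOf_dvd_iff_pow_eq_one, ← hQ.iterate_adj_eq_iff hreg hϱ (code hV (x, Ψ))] at e
    change (hQ.adj 3 ∘ hQ.adj 2) ((hQ.adj 3 ∘ hQ.adj 2) _) = _ at e
    rw [hmove, hmove, h.adj_adj] at e
    have e' := congrArg Prod.fst (code_injective hV h e)
    apply h.face_adj_self_ne 2 Ψ
    rw [← facet_eq_iff]
    refine (facet_eq_of_flipAt_eq (x := flipAt (facet h (h.adj 2 Ψ)) x) ?_).symm
    rw [flipAt_flipAt]
    exact e'
  · rw [← orderOf_dvd_iff_pow_eq_one, ← hQ.iterate_adj_eq_iff hreg hϱ (code hV (x, Ψ))]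
    change (hQ.adj 3 ∘ hQ.adj 2) ((hQ.adj 3 ∘ hQ.adj 2) ((hQ.adj 3 ∘ hQ.adj 2)
      ((hQ.adj 3 ∘ hQ.adj 2) _))) = _
    rw [hmove, hmove, hmove, hmove, h.adj_adj, h.adj_adj,
      flipAt_comm (facet h (h.adj 2 Ψ)) (facet h Ψ), flipAt_flipAt, flipAt_flipAt]

end Polytope

/-- for `K` the dodecahedron `{5,3}`, the polytope
`D2K = (2^{K*})*` is a non-degenerate regular polytope of rank 4 of type
`{5,3,4}`, its halving group has order `2^11 · 120 = 245760`, and it is the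
type-preserving automorphism group of the regular rank-4 hypertope
`Γ(H(D2K))` of type `{5, ₃³}`. -/
theorem halving_D2_dodecahedron {K : Type*} [PartialOrder K]
    (rkK : K → ℤ) [Finite K]
    (hK : IsPolytope K rkK 3) (hnd : NonDegenerate K rkK)
    (hreg : IsRegularPolytope K)
    (ΦK : Set K) (ϱK : Fin 3 → ↥(orderAut K))
    (hϱK : IsDistinguishedGens K rkK 3 ΦK ϱK)
    (h5 : orderOf (ϱK 0 * ϱK 1) = 5) (h3 : orderOf (ϱK 1 * ϱK 2) = 3)
    (haut : Nat.card ↥(orderAut K) = 120) :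
    (∃ rkC : genCube Kᵒᵈ (dualRk rkK 3) → ℤ,
      IsPolytope (genCube Kᵒᵈ (dualRk rkK 3)) rkC 4) ∧
    ∀ rkC : genCube Kᵒᵈ (dualRk rkK 3) → ℤ,
      IsPolytope (genCube Kᵒᵈ (dualRk rkK 3)) rkC 4 →
      -- `D2K` is a non-degenerate regular polytope of rank 4 of type `{5,3,4}`
      IsPolytope (D2 K rkK 3) (dualRk rkC 4) 4 ∧
      NonDegenerate (D2 K rkK 3) (dualRk rkC 4) ∧
      IsRegularPolytope (D2 K rkK 3) ∧
      ∀ (ΦD : Set (D2 K rkK 3)) (ϱ : Fin 4 → ↥(orderAut (D2 K rkK 3))),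
        IsDistinguishedGens (D2 K rkK 3) (dualRk rkC 4) 4 ΦD ϱ →
          (orderOf (ϱ 0 * ϱ 1) = 5 ∧ orderOf (ϱ 1 * ϱ 2) = 3 ∧
            orderOf (ϱ 2 * ϱ 3) = 4) ∧
          -- the halving group has order `2^11 · 120 = 245760`
          Nat.card ↥(Subgroup.closure (Set.range (halvingGens 4 ϱ))) =
            2 ^ 11 * 120 ∧
          Nat.card ↥(Subgroup.closure (Set.range (halvingGens 4 ϱ))) = 245760 ∧
          -- `Γ(H(D2K))` is a regular hypertope …
          (halvingCosetSystem 4 ϱ).IsRegularHypertope ∧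
          -- … whose type-preserving automorphism group is `H(D2K)`
          (∀ g : ↥(Subgroup.closure (Set.range (halvingGens 4 ϱ))),
            ∃ α ∈ (halvingCosetSystem 4 ϱ).typeAut,
              ⇑α = cosetMul (halvingCosetFamily 4 ϱ) g) ∧
          (∀ α ∈ (halvingCosetSystem 4 ϱ).typeAut,
            ∃! g : ↥(Subgroup.closure (Set.range (halvingGens 4 ϱ))),
              ⇑α = cosetMul (halvingCosetFamily 4 ϱ) g) ∧
          -- … of type `{5, ₃³}` (tail-triangle Coxeter diagram)
          orderOf (halvingGens 4 ϱ 0 * halvingGens 4 ϱ 1) = 5 ∧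
          orderOf (halvingGens 4 ϱ 1 * halvingGens 4 ϱ 2) = 3 ∧
          orderOf (halvingGens 4 ϱ 1 * halvingGens 4 ϱ 3) = 3 ∧
          orderOf (halvingGens 4 ϱ 2 * halvingGens 4 ϱ 3) = 2 ∧
          orderOf (halvingGens 4 ϱ 0 * halvingGens 4 ϱ 2) = 2 ∧
          orderOf (halvingGens 4 ϱ 0 * halvingGens 4 ϱ 3) = 2 := by
  have hD : IsDodecahedron hK :=
    isDodecahedron_of_orderOf (Φ := ⟨ΦK, hϱK.1⟩) hK hreg hϱK h5 h3 haut
  have hV := hD.vertexDescribable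
  have hC := cube_isPolytope hK.dual hV
  refine ⟨⟨_, hC⟩, fun rkC hrkC => ?_⟩
  obtain rfl : rkC = cubeRk (dualRk rkK 3) := hrkC.rk_unique hC
  have hQ := hC.dual
  have hregQ : IsRegularPolytope (D2 K rkK 3) :=
    (cube_isRegularPolytope hK.dual hV hreg.dual).dual
  refine ⟨hQ, nonDegenerate_D2 hV hK hnd, hregQ, fun ΦD ϱ hϱ => ?_⟩
  have hϱ' : IsDistinguishedGens _ _ 4 (⟨ΦD, hϱ.1⟩ : PolyFlag (D2 K rkK 3)).1 ϱ := hϱ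
  let := Fintype.ofFinite (polyVertices Kᵒᵈ (dualRk rkK 3))
  have hcard : Fintype.card (polyVertices Kᵒᵈ (dualRk rkK 3)) = 12 :=
    Nat.card_eq_fintype_card.symm.trans hD.card_facets
  have : Nonempty (polyVertices Kᵒᵈ (dualRk rkK 3)) :=
    Fintype.card_pos_iff.1 (by rw [hcard]; norm_num)
  have hH := card_halvingGroup hV hK hQ hϱ'
  rw [hcard, hD.card_flag] at hH
  have hF := isHypertopeFamily_halving hV hK hQ hϱ'
  obtain ⟨o1, o2, o3⟩ := orderOf_gens_D2 hD hQ hregQ hϱ'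
  have hne : ϱ 0 ≠ ϱ 2 := by
    intro e
    refine hQ.face_adj_self_ne 0 ⟨ΦD, hϱ.1⟩ ?_
    rw [← hQ.flagMap_gen hϱ', e, hQ.flagMap_gen hϱ', hQ.face_adj_of_ne (by decide)]
  obtain ⟨p1, p2, p3, p4, p5, p6⟩ := orderOf_halvingGens (hQ.gen_mul_self hϱ')
    (hQ.gen_comm hϱ' (by decide)) (hQ.gen_comm hϱ' (by decide)) (hQ.gen_comm hϱ' (by decide))
    hne o3
  exact ⟨⟨o1, o2, o3⟩, hH, hH, hF.isRegularHypertope (by simp [Set.ncard_univ]),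
    fun g => ⟨cosetPerm _ g, cosetPerm_mem g, rfl⟩,
    fun α hα => hF.existsUnique_of_mem_typeAut hα, p1.trans o1, p2.trans o2, p3.trans o2,
    p4, p5, p6⟩
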